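/- For the Wright–Fisher diffusion with selection (parameters σ > 0 and s ≥ 0 fixed) and a bounded continuous group-level selection profile r⁰ attaining its maximum only in the interior of (0,1), there exists a critical value R_∨ > 0 such that for every R > R_∨, the killed system with r = R·r⁰ satisfies ρ_α < ρ_0 ∧ ρ_1, i.e. the extinction rate of the quasi-stationary distribution on (0,1) is strictly smaller than the extinction rates at both absorbing boundaries. -/

import Mathlib

open MeasureTheory ProbabilityTheory Filter Set
open scoped ENNReal NNReal Topology

noncomputable section

/-- The Wright–Fisher generator with selection `s` and diffusion parameter `σ`:
`𝓛_WF f(x) = -s x (1-x) f'(x) + (σ²/2) x (1-x) f''(x)`. -/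
def LWF (s σ : ℝ) (f : ℝ → ℝ) : ℝ → ℝ := fun x =>
  -s * x * (1 - x) * deriv f x + σ ^ 2 / 2 * (x * (1 - x)) * deriv (deriv f) x

/-- A (weak) solution of the Wright–Fisher SDE with selection
`dX_t = -s X_t (1-X_t) dt + σ √(X_t(1-X_t)) dB_t`, `X_0 ∼ μ₀`, characterized through
the associated martingale problem for the generator `LWF s σ`, enriched with an
independent standard exponential random variable `Tkill` used for the soft killing at
rate `-r ≥ 0`:  `τ_∂ = inf{t ≥ 0 : ∫₀ᵗ (-r(X_u)) du ≥ Tkill}`. -/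
structure WFKilled (s σ : ℝ) (r : ℝ → ℝ) (μ₀ : Measure ℝ) where
  (Ω : Type)
  [mΩ : MeasurableSpace Ω]
  (P : Measure Ω)
  (probP : IsProbabilityMeasure P)
  (X : ℝ → Ω → ℝ)
  (measX : ∀ t, Measurable (X t))
  (contX : ∀ ω, Continuous fun t => X t ω)
  (preZero : ∀ t ≤ (0:ℝ), X t = X 0)
  (range01 : ∀ t ω, X t ω ∈ Icc (0:ℝ) 1)
  (initLaw : P.map (X 0) = μ₀)
  (ℱ : Filtration ℝ mΩ)
  (adaptedX : Adapted ℱ X)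
  (martProblem : ∀ f : ℝ → ℝ, ContDiff ℝ 2 f →
    Martingale (fun t ω => f (X t ω) - ∫ u in Ioc (0:ℝ) t, LWF s σ f (X u ω)) ℱ P)
  (Tkill : Ω → ℝ)
  (measT : Measurable Tkill)
  (expLaw : ∀ t : ℝ, 0 ≤ t → P {ω | t < Tkill ω} = ENNReal.ofReal (Real.exp (-t)))
  (indepT : IndepFun (fun ω t => X t ω) Tkill P)

attribute [instance] WFKilled.mΩ WFKilled.probP

variable {s σ : ℝ} {r : ℝ → ℝ} {μ₀ : Measure ℝ}

/-- The survival event `{t < τ_∂}` for the soft killing at rate `-r`. -/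
def WFKilled.aliveSoft (W : WFKilled s σ r μ₀) (t : ℝ) : Set W.Ω :=
  {ω | ∫ u in Ioc (0:ℝ) t, (-(r (W.X u ω))) < W.Tkill ω}

/-- The event `{t < τ_0}`: the boundary point `0` has not been hit by time `t`. -/
def WFKilled.noHit0 (W : WFKilled s σ r μ₀) (t : ℝ) : Set W.Ω :=
  {ω | ∀ u ∈ Icc (0:ℝ) t, W.X u ω ≠ 0}

/-- The event `{t < τ_1}`: the boundary point `1` has not been hit by time `t`. -/
def WFKilled.noHit1 (W : WFKilled s σ r μ₀) (t : ℝ) : Set W.Ω :=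
  {ω | ∀ u ∈ Icc (0:ℝ) t, W.X u ω ≠ 1}

/-- The event `{t < τ_{0,1,∂}}`. -/
def WFKilled.aliveAll (W : WFKilled s σ r μ₀) (t : ℝ) : Set W.Ω :=
  W.aliveSoft t ∩ W.noHit0 t ∩ W.noHit1 t

/-- The law of `X_t` conditioned on an event `E` (e.g. survival up to time `t`). -/
def WFKilled.condLaw (W : WFKilled s σ r μ₀) (E : Set W.Ω) (t : ℝ) : Measure ℝ :=
  (W.P E)⁻¹ • (W.P.restrict E).map (W.X t)

/-- The hitting time of `0`, as an element of `ℝ≥0∞`. -/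
def WFKilled.hit0 (W : WFKilled s σ r μ₀) (ω : W.Ω) : ℝ≥0∞ :=
  sInf {t : ℝ≥0∞ | ∃ u : ℝ, 0 ≤ u ∧ t = ENNReal.ofReal u ∧ W.X u ω = 0}

/-- The hitting time of `1`, as an element of `ℝ≥0∞`. -/
def WFKilled.hit1 (W : WFKilled s σ r μ₀) (ω : W.Ω) : ℝ≥0∞ :=
  sInf {t : ℝ≥0∞ | ∃ u : ℝ, 0 ≤ u ∧ t = ENNReal.ofReal u ∧ W.X u ω = 1}

/-- The soft killing time `τ_∂`, as an element of `ℝ≥0∞`. -/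
def WFKilled.killT (W : WFKilled s σ r μ₀) (ω : W.Ω) : ℝ≥0∞ :=
  sInf {t : ℝ≥0∞ | ∃ u : ℝ, 0 ≤ u ∧ t = ENNReal.ofReal u ∧
    W.Tkill ω ≤ ∫ v in Ioc (0:ℝ) u, (-(r (W.X v ω)))}

/-- Quasi-stationary distribution on `(0,1)` for the extinction time `τ_{0,1,∂}`,
with extinction rate `ρ`: under any realization of the killed Wright–Fisher diffusion
started from `α`, one has `ℙ_α(X_t ∈ A ; t < τ_{0,1,∂}) = e^{-ρ t} α(A)`. -/
def IsQSD (s σ : ℝ) (r : ℝ → ℝ) (α : Measure ℝ) (ρ : ℝ) : Prop :=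
  IsProbabilityMeasure α ∧ α (Ioo (0:ℝ) 1)ᶜ = 0 ∧
  ∀ W : WFKilled s σ r α, ∀ t : ℝ, 0 < t → ∀ A : Set ℝ, MeasurableSet A →
    W.P ({ω | W.X t ω ∈ A} ∩ W.aliveAll t) = ENNReal.ofReal (Real.exp (-(ρ * t))) * α A

/-- Quasi-stationary distribution on `[0,1]` for the soft killing time `τ_∂` alone,
with extinction rate `ρ`. -/
def IsQSDsoft (s σ : ℝ) (r : ℝ → ℝ) (α : Measure ℝ) (ρ : ℝ) : Prop :=
  IsProbabilityMeasure α ∧ α (Icc (0:ℝ) 1)ᶜ = 0 ∧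
  ∀ W : WFKilled s σ r α, ∀ t : ℝ, 0 < t → ∀ A : Set ℝ, MeasurableSet A →
    W.P ({ω | W.X t ω ∈ A} ∩ W.aliveSoft t) = ENNReal.ofReal (Real.exp (-(ρ * t))) * α A

/-- Survival capacity `η` with extinction rate `ρ`:
`η(x) = e^{ρ t} 𝔼_x[η(X_t) ; t < τ_{0,1,∂}]`. -/
def IsSurvCap (s σ : ℝ) (r : ℝ → ℝ) (ρ : ℝ) (η : ℝ → ℝ) : Prop :=
  Measurable η ∧ ∀ x ∈ Icc (0:ℝ) 1, ∀ W : WFKilled s σ r (Measure.dirac x), ∀ t : ℝ, 0 < t →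
    η x = Real.exp (ρ * t) * ∫ ω in W.aliveAll t, η (W.X t ω) ∂W.P

/-- Total variation distance between two (finite) measures on `ℝ`. -/
def tvDist (μ ν : Measure ℝ) : ℝ :=
  ⨆ A : Set ℝ, |(μ A).toReal - (ν A).toReal|

/-- Existence of realizations of the killed Wright–Fisher diffusion from any initial law
on `[0,1]` (granted by the classical well-posedness of the Wright–Fisher SDE). -/
def WFExists (s σ : ℝ) (r : ℝ → ℝ) : Prop :=
  ∀ μ : Measure ℝ, IsProbabilityMeasure μ → μ (Icc (0:ℝ) 1)ᶜ = 0 →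
    Nonempty (WFKilled s σ r μ)



lemma wfc_ineq4 {Z b d A h : ℝ} (z : |Z| ≤ 1) (hb : |b| ≤ A * h) (d0 : 0 ≤ d) (d1 : d ≤ 2 * A * h)
    (hA : 1 ≤ A) (h0 : 0 < h) (h1 : h ≤ 1) :
    (Z - b) ^ 4 + 6 * (Z - b) ^ 2 * d + d ^ 2 ≤ Z ^ 4 + 40 * A ^ 4 * (h * Z ^ 2 + h ^ 2) := by
  have hh : h ^ 2 ≤ h := by nlinarith
  have hh3 : h ^ 3 ≤ h ^ 2 := by nlinarith [sq_nonneg h]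
  have hh4 : h ^ 4 ≤ h ^ 2 := by nlinarith [sq_nonneg h]
  have A1 : A ≤ A ^ 4 := by nlinarith [pow_le_pow_right₀ hA (show 1 ≤ 4 by norm_num)]
  have A2 : A ^ 2 ≤ A ^ 4 := pow_le_pow_right₀ hA (by norm_num)
  have A3 : A ^ 3 ≤ A ^ 4 := pow_le_pow_right₀ hA (by norm_num)
  have e1 : |Z ^ 3 * b| ≤ A ^ 4 * (h * Z ^ 2) := by
    have : |Z ^ 3 * b| = Z ^ 2 * (|Z| * |b|) := by
      rw [abs_mul, abs_pow, pow_succ, sq_abs]; ring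
    rw [this]
    calc Z ^ 2 * (|Z| * |b|) ≤ Z ^ 2 * (1 * (A * h)) := by gcongr
      _ ≤ Z ^ 2 * (1 * (A ^ 4 * h)) := by gcongr
      _ = _ := by ring
  have b2 : b ^ 2 ≤ A ^ 2 * h ^ 2 := by rw [← sq_abs, ← mul_pow]; gcongr
  have e2 : Z ^ 2 * b ^ 2 ≤ A ^ 4 * (h * Z ^ 2) := by
    calc Z ^ 2 * b ^ 2 ≤ Z ^ 2 * (A ^ 2 * h ^ 2) := by gcongr
      _ ≤ Z ^ 2 * (A ^ 4 * h) := by gcongr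
      _ = _ := by ring
  have e3 : |Z * b ^ 3| ≤ A ^ 4 * h ^ 2 := by
    rw [abs_mul, abs_pow]
    calc |Z| * |b| ^ 3 ≤ 1 * (A * h) ^ 3 := by gcongr
      _ = A ^ 3 * h ^ 3 := by ring
      _ ≤ A ^ 4 * h ^ 2 := by gcongr
  have e4 : b ^ 4 ≤ A ^ 4 * h ^ 2 := by
    calc b ^ 4 = |b| ^ 4 := by rw [← abs_pow, abs_of_nonneg (by positivity)]
      _ ≤ (A * h) ^ 4 := by gcongr
      _ = A ^ 4 * h ^ 4 := by ring
      _ ≤ _ := by gcongr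
  have e5 : Z ^ 2 * d ≤ 2 * (A ^ 4 * (h * Z ^ 2)) := by
    calc Z ^ 2 * d ≤ Z ^ 2 * (2 * A * h) := by gcongr
      _ ≤ Z ^ 2 * (2 * A ^ 4 * h) := by gcongr
      _ = _ := by ring
  have e6 : b ^ 2 * d ≤ 2 * (A ^ 4 * h ^ 2) := by
    calc b ^ 2 * d ≤ (A ^ 2 * h ^ 2) * (2 * A * h) := by gcongr
      _ = 2 * (A ^ 3 * h ^ 3) := by ring
      _ ≤ _ := by gcongr
  have e7 : d ^ 2 ≤ 4 * (A ^ 4 * h ^ 2) := by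
    calc d ^ 2 ≤ (2 * A * h) ^ 2 := by gcongr
      _ = 4 * (A ^ 2 * h ^ 2) := by ring
      _ ≤ _ := by gcongr
  have e8 : (Z - b) ^ 2 * d ≤ 2 * (Z ^ 2 * d) + 2 * (b ^ 2 * d) := by
    nlinarith [mul_nonneg (sq_nonneg (Z + b)) d0]
  have := (abs_le.1 e1).1
  have := (abs_le.1 e3).1
  have e9 : (Z - b) ^ 4 = Z ^ 4 - 4 * (Z ^ 3 * b) + 6 * (Z ^ 2 * b ^ 2) - 4 * (Z * b ^ 3) + b ^ 4 := by
    ring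
  have p1 : 0 ≤ A ^ 4 * (h * Z ^ 2) := by positivity
  have p2 : 0 ≤ A ^ 4 * h ^ 2 := by positivity
  nlinarith

lemma wfc_step {Ω : Type} [mΩ : MeasurableSpace Ω] (P : Measure Ω) [IsProbabilityMeasure P]
    (m : MeasurableSpace Ω) (hm : m ≤ mΩ) (e : Ω → ℝ) (he : Measurable[mΩ] e)
    (he1 : ∀ ω, e ω ^ 2 = 1)
    (ho : ∀ G : Ω → ℝ, Measurable[m] G → (∃ B, ∀ ω, |G ω| ≤ B) → ∫ ω, G ω * e ω ∂P = 0)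
    (F U G : Ω → ℝ) (hU : Measurable[m] U) (hUb : ∃ B, ∀ ω, |U ω| ≤ B)
    (hG : Measurable[m] G) (hGb : ∃ B, ∀ ω, |G ω| ≤ B)
    (hF : ∀ ω, F ω = U ω + G ω * e ω) : ∫ ω, F ω ∂P = ∫ ω, U ω ∂P := by
  obtain ⟨B, hB⟩ := hUb
  obtain ⟨B', hB'⟩ := hGb
  have i1 : Integrable U P := Integrable.of_bound (hU.mono hm le_rfl).aestronglyMeasurable B
    (ae_of_all _ hB)
  have i2 : Integrable (fun ω => G ω * e ω) P := by
    refine Integrable.of_bound ((hG.mono hm le_rfl).mul he).aestronglyMeasurable B'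
      (ae_of_all _ fun ω => ?_)
    have : |e ω| = 1 := by
      have := he1 ω
      rw [← sq_abs] at this
      nlinarith [abs_nonneg (e ω)]
    rw [Real.norm_eq_abs, abs_mul, this, mul_one]
    exact hB' ω
  rw [funext hF, integral_add i1 i2, ho G hG ⟨B', hB'⟩, add_zero]

/-- Data of the approximating chain. -/
structure WFChain (s σ A h : ℝ) where
  (Ω : Type)
  [mΩ : MeasurableSpace Ω]
  (P : Measure Ω)
  (probP : IsProbabilityMeasure P)
  (G : ℕ → MeasurableSpace Ω)
  (Gle : ∀ k, G k ≤ mΩ)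
  (Gmono : Monotone G)
  (e : ℕ → Ω → ℝ)
  (he : ∀ k, Measurable (e k))
  (he1 : ∀ k ω, e k ω ^ 2 = 1)
  (ho : ∀ k (g : Ω → ℝ), Measurable[G k] g → (∃ B, ∀ ω, |g ω| ≤ B) → ∫ ω, g ω * e k ω ∂P = 0)
  (X : ℕ → Ω → ℝ)
  (hX : ∀ k, Measurable[G k] (X k))
  (hX01 : ∀ k ω, X k ω ∈ Icc (0:ℝ) 1)
  (δ : ℝ → ℝ)
  (hδ : Measurable δ)
  (hδb : ∀ x ∈ Icc (0:ℝ) 1, |δ x ^ 2 - σ ^ 2 * h * (x * (1 - x))| ≤ A * h ^ 2)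
  (hrec : ∀ k ω, X (k + 1) ω = X k ω - s * h * (X k ω * (1 - X k ω)) + δ (X k ω) * e k ω)
  (hs : 0 ≤ s) (hsA : s ≤ A) (hσA : σ ^ 2 ≤ A) (hA : 1 ≤ A) (h0 : 0 < h) (h1 : h ≤ 1)

attribute [instance] WFChain.mΩ WFChain.probP

namespace WFChain

variable {s σ A h : ℝ} (W : WFChain s σ A h)

lemma aX (x : ℝ) (hx : x ∈ Icc (0:ℝ) 1) : 0 ≤ x * (1 - x) ∧ x * (1 - x) ≤ 1 := by
  obtain ⟨h1, h2⟩ := hx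
  constructor <;> nlinarith

lemma δsq (x : ℝ) (hx : x ∈ Icc (0:ℝ) 1) : W.δ x ^ 2 ≤ 2 * A * h := by
  have h1 := (abs_le.1 (W.hδb x hx)).2
  have h2 := aX x hx
  have := W.hσA
  have := W.h1
  have := W.h0
  have := W.hA
  have a1 : σ ^ 2 * h * (x * (1 - x)) ≤ A * h * 1 := by
    apply mul_le_mul _ h2.2 h2.1 (by positivity)
    gcongr
  have a2 : A * h ^ 2 ≤ A * h := by
    have : h ^ 2 ≤ h := by nlinarith
    gcongr
  linarith

lemma measX (k : ℕ) : Measurable (W.X k) := (W.hX k).mono (W.Gle k) le_rfl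

lemma hXle {j k : ℕ} (hjk : j ≤ k) : Measurable[W.G k] (W.X j) :=
  (W.hX j).mono (W.Gmono hjk) le_rfl

lemma Zabs (j k : ℕ) (ω : W.Ω) : |W.X k ω - W.X j ω| ≤ 1 := by
  have h1 := W.hX01 k ω
  have h2 := W.hX01 j ω
  rw [abs_le]; constructor <;> linarith [h1.1, h1.2, h2.1, h2.2]

lemma babs (k : ℕ) (ω : W.Ω) : |s * h * (W.X k ω * (1 - W.X k ω))| ≤ A * h := by
  have h2 := aX _ (W.hX01 k ω)
  have := W.hs
  have := W.hsA
  have := W.h0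
  rw [abs_of_nonneg (mul_nonneg (by positivity) h2.1)]
  calc _ ≤ A * h * 1 := by
        apply mul_le_mul _ h2.2 h2.1 (by nlinarith [W.hA])
        gcongr
    _ = _ := by ring

lemma int_bdd {f : W.Ω → ℝ} (hf : Measurable f) (B : ℝ) (hB : ∀ ω, |f ω| ≤ B) :
    Integrable f W.P :=
  Integrable.of_bound hf.aestronglyMeasurable B (ae_of_all _ hB)

lemma intZ (j k : ℕ) (n : ℕ) : Integrable (fun ω => (W.X k ω - W.X j ω) ^ n) W.P := by
  refine W.int_bdd (((W.measX k).sub (W.measX j)).pow_const n) 1 fun ω => ?_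
  rw [abs_pow]
  exact pow_le_one₀ (abs_nonneg _) (W.Zabs j k ω)

lemma sec (j k : ℕ) : ∫ ω, (W.X (j + k) ω - W.X j ω) ^ 2 ∂W.P ≤ 5 * A ^ 2 * (k * h) := by
  have hA := W.hA
  have h0 := W.h0
  have h1 := W.h1
  induction k with
  | zero => simp
  | succ k ih =>
    have hm := W.hXle (Nat.le_add_right j k)
    have hX := W.hX (j + k)
    have key : ∫ ω, (W.X (j + (k + 1)) ω - W.X j ω) ^ 2 ∂W.P =
      ∫ ω, ((W.X (j + k) ω - W.X j ω - s * h * (W.X (j + k) ω * (1 - W.X (j + k) ω))) ^ 2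
        + W.δ (W.X (j + k) ω) ^ 2) ∂W.P := by
      refine wfc_step W.P (W.G (j + k)) (W.Gle _) (W.e (j + k)) (W.he _) (W.he1 _) (W.ho _) _ _
        (fun ω => 2 * (W.X (j + k) ω - W.X j ω - s * h * (W.X (j + k) ω * (1 - W.X (j + k) ω)))
          * W.δ (W.X (j + k) ω)) ?_ ?_ ?_ ?_ ?_
      · have := W.hδ.comp hX
        simp only [Function.comp_def] at this
        fun_prop
      · refine ⟨(1 + A * h) ^ 2 + 2 * A * h, fun ω => ?_⟩
        rw [abs_of_nonneg (by positivity)]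
        have z := W.Zabs j (j + k) ω
        have b := W.babs (j + k) ω
        have d := W.δsq _ (W.hX01 (j + k) ω)
        refine add_le_add ?_ d
        rw [← sq_abs]
        gcongr
        exact (abs_sub _ _).trans (add_le_add z b)
      · have := W.hδ.comp hX
        simp only [Function.comp_def] at this
        fun_prop
      · refine ⟨2 * (1 + A * h) * (1 + 2 * A * h), fun ω => ?_⟩
        have z := W.Zabs j (j + k) ω
        have b := W.babs (j + k) ω
        have d := W.δsq _ (W.hX01 (j + k) ω)
        rw [abs_mul, abs_mul, abs_two]
        gcongr
        · exact (abs_sub _ _).trans (add_le_add z b)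
        · rw [← sq_abs] at d
          nlinarith [abs_nonneg (W.δ (W.X (j + k) ω)), sq_nonneg (|W.δ (W.X (j + k) ω)| - 1)]
      · intro ω
        rw [← add_assoc, W.hrec]
        have := W.he1 (j + k) ω
        linear_combination (W.δ (W.X (j + k) ω)) ^ 2 * this
    rw [key]
    calc _ ≤ ∫ ω, ((W.X (j + k) ω - W.X j ω) ^ 2 + 5 * A ^ 2 * h) ∂W.P := by
          apply integral_mono_of_nonneg (ae_of_all _ fun ω => by positivity)
          · exact (W.intZ j (j + k) 2).add (integrable_const _)
          · refine ae_of_all _ fun ω => ?_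
            have z := W.Zabs j (j + k) ω
            have b := W.babs (j + k) ω
            have d := W.δsq _ (W.hX01 (j + k) ω)
            beta_reduce
            generalize W.X (j + k) ω - W.X j ω = Z at *
            generalize s * h * (W.X (j + k) ω * (1 - W.X (j + k) ω)) = b' at *
            have e1 : |Z * b'| ≤ 1 * (A * h) := by rw [abs_mul]; gcongr
            have e2 : b' ^ 2 ≤ (A * h) ^ 2 := by rw [← sq_abs]; gcongr
            have e3 : (A * h) ^ 2 ≤ A ^ 2 * h := by
              rw [mul_pow]
              have : h ^ 2 ≤ h := by nlinarith
              gcongr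
            have e4 : A * h ≤ A ^ 2 * h := by
              have : A ≤ A ^ 2 := by nlinarith
              gcongr
            nlinarith [abs_le.1 e1]
      _ = ∫ ω, (W.X (j + k) ω - W.X j ω) ^ 2 ∂W.P + 5 * A ^ 2 * h := by
          rw [integral_add (W.intZ j (j + k) 2) (integrable_const _)]
          simp
      _ ≤ _ := by push_cast; linarith

lemma four (j k : ℕ) : ∫ ω, (W.X (j + k) ω - W.X j ω) ^ 4 ∂W.P
    ≤ 40 * A ^ 4 * (5 * A ^ 2 + 1) * (k * h) ^ 2 := by
  have hA := W.hA
  have h0 := W.h0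
  have h1 := W.h1
  induction k with
  | zero => simp
  | succ k ih =>
    have hm := W.hXle (Nat.le_add_right j k)
    have hX := W.hX (j + k)
    have key : ∫ ω, (W.X (j + (k + 1)) ω - W.X j ω) ^ 4 ∂W.P =
      ∫ ω, ((W.X (j + k) ω - W.X j ω - s * h * (W.X (j + k) ω * (1 - W.X (j + k) ω))) ^ 4
        + 6 * (W.X (j + k) ω - W.X j ω - s * h * (W.X (j + k) ω * (1 - W.X (j + k) ω))) ^ 2
          * W.δ (W.X (j + k) ω) ^ 2 + (W.δ (W.X (j + k) ω) ^ 2) ^ 2) ∂W.P := by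
      refine wfc_step W.P (W.G (j + k)) (W.Gle _) (W.e (j + k)) (W.he _) (W.he1 _) (W.ho _) _ _
        (fun ω => 4 * (W.X (j + k) ω - W.X j ω - s * h * (W.X (j + k) ω * (1 - W.X (j + k) ω))) ^ 3
          * W.δ (W.X (j + k) ω) +
          4 * (W.X (j + k) ω - W.X j ω - s * h * (W.X (j + k) ω * (1 - W.X (j + k) ω)))
          * (W.δ (W.X (j + k) ω) ^ 2 * W.δ (W.X (j + k) ω))) ?_ ?_ ?_ ?_ ?_
      · have := W.hδ.comp hX
        simp only [Function.comp_def] at this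
        fun_prop
      · refine ⟨(1 + A * h) ^ 4 + 6 * (1 + A * h) ^ 2 * (2 * A * h) + (2 * A * h) ^ 2,
          fun ω => ?_⟩
        rw [abs_of_nonneg (by positivity)]
        have z := W.Zabs j (j + k) ω
        have b := W.babs (j + k) ω
        have d := W.δsq _ (W.hX01 (j + k) ω)
        have t := (abs_sub (W.X (j + k) ω - W.X j ω)
          (s * h * (W.X (j + k) ω * (1 - W.X (j + k) ω)))).trans (add_le_add z b)
        have t2 := pow_le_pow_left₀ (abs_nonneg _) t 2
        have t4 := pow_le_pow_left₀ (abs_nonneg _) t 4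
        rw [← abs_pow, abs_of_nonneg (by positivity)] at t2 t4
        gcongr
      · have := W.hδ.comp hX
        simp only [Function.comp_def] at this
        fun_prop
      · refine ⟨4 * (1 + A * h) ^ 3 * (1 + 2 * A * h) +
          4 * (1 + A * h) * (2 * A * h * (1 + 2 * A * h)), fun ω => ?_⟩
        have z := W.Zabs j (j + k) ω
        have b := W.babs (j + k) ω
        have d := W.δsq _ (W.hX01 (j + k) ω)
        have t := (abs_sub (W.X (j + k) ω - W.X j ω)
          (s * h * (W.X (j + k) ω * (1 - W.X (j + k) ω)))).trans (add_le_add z b)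
        have d1 : |W.δ (W.X (j + k) ω)| ≤ 1 + 2 * A * h := by
          rw [← sq_abs] at d
          nlinarith [abs_nonneg (W.δ (W.X (j + k) ω)), sq_nonneg (|W.δ (W.X (j + k) ω)| - 1)]
        have d2 : |W.δ (W.X (j + k) ω)| ^ 2 ≤ 2 * A * h := by rwa [sq_abs]
        refine (abs_add_le _ _).trans ?_
        simp only [abs_mul, abs_pow]
        rw [show |(4:ℝ)| = 4 by norm_num]
        gcongr
      · intro ω
        rw [← add_assoc, W.hrec]
        have := W.he1 (j + k) ω
        set q := W.X (j + k) ω - W.X j ω - s * h * (W.X (j + k) ω * (1 - W.X (j + k) ω)) with hq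
        linear_combination (6 * q ^ 2 * (W.δ (W.X (j + k) ω)) ^ 2
          + 4 * q * (W.δ (W.X (j + k) ω)) ^ 3 * W.e (j + k) ω
          + (W.δ (W.X (j + k) ω)) ^ 4 * (W.e (j + k) ω ^ 2 + 1)) * this
    rw [key]
    calc _ ≤ ∫ ω, ((W.X (j + k) ω - W.X j ω) ^ 4
            + 40 * A ^ 4 * (h * (W.X (j + k) ω - W.X j ω) ^ 2 + h ^ 2)) ∂W.P := by
          apply integral_mono_of_nonneg (ae_of_all _ fun ω => by positivity)
          · exact (W.intZ j (j + k) 4).add ((((W.intZ j (j + k) 2).const_mul _).add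
              (integrable_const _)).const_mul _)
          · refine ae_of_all _ fun ω => ?_
            have z := W.Zabs j (j + k) ω
            have b := W.babs (j + k) ω
            have d := W.δsq _ (W.hX01 (j + k) ω)
            have d0 := sq_nonneg (W.δ (W.X (j + k) ω))
            show (_ : ℝ) ≤ _
            exact wfc_ineq4 z b d0 d hA h0 h1
      _ = ∫ ω, (W.X (j + k) ω - W.X j ω) ^ 4 ∂W.P
          + 40 * A ^ 4 * (h * ∫ ω, (W.X (j + k) ω - W.X j ω) ^ 2 ∂W.P + h ^ 2) := by
          have i2 : Integrable (fun ω => h * (W.X (j + k) ω - W.X j ω) ^ 2) W.P :=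
            (W.intZ j (j + k) 2).const_mul _
          have i3 : Integrable (fun ω => 40 * A ^ 4 *
              (h * (W.X (j + k) ω - W.X j ω) ^ 2 + h ^ 2)) W.P :=
            (i2.add (integrable_const _)).const_mul _
          rw [integral_add (W.intZ j (j + k) 4) i3, integral_const_mul,
              integral_add i2 (integrable_const _), integral_const_mul]
          simp
      _ ≤ 40 * A ^ 4 * (5 * A ^ 2 + 1) * (k * h) ^ 2
          + 40 * A ^ 4 * (h * (5 * A ^ 2 * (k * h)) + h ^ 2) := by
          gcongr
          exact W.sec j k
      _ ≤ _ := by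
          push_cast
          have : 0 ≤ 40 * A ^ 4 * h ^ 2 := by positivity
          have k0 : (0:ℝ) ≤ k := by positivity
          have : 0 ≤ (40 * A ^ 4 * h ^ 2) * (5 * A ^ 2 * (k + 1) + 2 * k) := by positivity
          nlinarith

lemma drift (j : ℕ) (c B ε : ℝ) (hc : 0 ≤ c) (hB : 0 ≤ B) (hε : 0 < ε) (Ψ : W.Ω → ℝ)
    (hΨ : Measurable[W.G j] Ψ) (hΨB : ∀ ω, |Ψ ω| ≤ B)
    (D R g : ℕ → W.Ω → ℝ) (hD : ∀ k, Measurable[W.G (j + k)] (D k))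
    (hR : ∀ k, Measurable[W.G (j + k)] (R k)) (hg : ∀ k, Measurable[W.G (j + k)] (g k))
    (hDb : ∀ k, ∃ B, ∀ ω, |D k ω| ≤ B) (hgb : ∀ k, ∃ B, ∀ ω, |g k ω| ≤ B)
    (hRb : ∀ k ω, |R k ω| ≤ c * (h * |W.X (j + k) ω - W.X j ω| + h ^ 2))
    (h00 : ∀ ω, D 0 ω = 0)
    (hDrec : ∀ k ω, D (k + 1) ω = D k ω + R k ω + g k ω * W.e (j + k) ω) (k : ℕ) :
    |∫ ω, Ψ ω * D k ω ∂W.P| ≤ B * c * (ε * (k * h) + (5 * A ^ 2 / ε + 1) * (k * h) ^ 2) := by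
  have hA := W.hA
  have h0 := W.h0
  have h1 := W.h1
  induction k with
  | zero => simp [h00]
  | succ k ih =>
    have hΨ' : Measurable[W.G (j + k)] Ψ := hΨ.mono (W.Gmono (Nat.le_add_right j k)) le_rfl
    have mm : ∀ {f : W.Ω → ℝ}, Measurable[W.G (j + k)] f → Measurable f :=
      fun hf => hf.mono (W.Gle _) le_rfl
    have hRb' : ∀ ω, |R k ω| ≤ c * (h * 1 + h ^ 2) := fun ω => (hRb k ω).trans (by
      have := W.Zabs j (j + k) ω
      gcongr)
    obtain ⟨BD, hBD⟩ := hDb k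
    obtain ⟨Bg, hBg⟩ := hgb k
    have key : ∫ ω, Ψ ω * D (k + 1) ω ∂W.P = ∫ ω, (Ψ ω * D k ω + Ψ ω * R k ω) ∂W.P := by
      refine wfc_step W.P (W.G (j + k)) (W.Gle _) (W.e (j + k)) (W.he _) (W.he1 _) (W.ho _) _ _
        (fun ω => Ψ ω * g k ω) ((hΨ'.mul (hD k)).add (hΨ'.mul (hR k))) ?_ (hΨ'.mul (hg k)) ?_ ?_
      · refine ⟨B * BD + B * (c * (h * 1 + h ^ 2)), fun ω => (abs_add_le _ _).trans ?_⟩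
        rw [abs_mul, abs_mul]
        have := hRb' ω
        have := hBD ω
        have := hΨB ω
        gcongr
      · refine ⟨B * Bg, fun ω => ?_⟩
        rw [abs_mul]
        have := hBg ω
        have := hΨB ω
        gcongr
      · intro ω
        rw [hDrec]; ring
    have i1 : Integrable (fun ω => Ψ ω * D k ω) W.P := by
      refine W.int_bdd (mm (hΨ'.mul (hD k))) (B * BD) fun ω => ?_
      rw [abs_mul]
      have := hBD ω
      have := hΨB ω
      gcongr
    have i2 : Integrable (fun ω => Ψ ω * R k ω) W.P := by
      refine W.int_bdd (mm (hΨ'.mul (hR k))) (B * (c * (h * 1 + h ^ 2))) fun ω => ?_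
      rw [abs_mul]
      have := hRb' ω
      have := hΨB ω
      gcongr
    rw [key, integral_add i1 i2]
    have i3 : Integrable (fun ω => (W.X (j + k) ω - W.X j ω) ^ 2 / ε) W.P :=
      (W.intZ j (j + k) 2).div_const ε
    have i4 : Integrable (fun ω => ε + (W.X (j + k) ω - W.X j ω) ^ 2 / ε) W.P :=
      (integrable_const ε).add i3
    have i5 : Integrable (fun ω => h * (ε + (W.X (j + k) ω - W.X j ω) ^ 2 / ε)) W.P :=
      i4.const_mul h
    have key2 : |∫ ω, Ψ ω * R k ω ∂W.P| ≤ B * c * (h * (ε + 5 * A ^ 2 * (k * h) / ε) + h ^ 2) := by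
      calc |∫ ω, Ψ ω * R k ω ∂W.P| ≤ ∫ ω, |Ψ ω * R k ω| ∂W.P := abs_integral_le_integral_abs
        _ ≤ ∫ ω, B * c * (h * (ε + (W.X (j + k) ω - W.X j ω) ^ 2 / ε) + h ^ 2) ∂W.P := by
          apply integral_mono_of_nonneg (ae_of_all _ fun ω => abs_nonneg _)
          · exact (i5.add (integrable_const _)).const_mul _
          · refine ae_of_all _ fun ω => ?_
            beta_reduce
            rw [abs_mul, mul_assoc]
            have a1 := hRb k ω
            have a2 := hΨB ω
            have a3 : |W.X (j + k) ω - W.X j ω| ≤ ε + (W.X (j + k) ω - W.X j ω) ^ 2 / ε := by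
              rw [← sub_le_iff_le_add', le_div_iff₀ hε, ← sq_abs]
              nlinarith [sq_nonneg (|W.X (j + k) ω - W.X j ω| - ε),
                abs_nonneg (W.X (j + k) ω - W.X j ω)]
            have a4 : |R k ω| ≤ c * (h * (ε + (W.X (j + k) ω - W.X j ω) ^ 2 / ε) + h ^ 2) :=
              a1.trans (by gcongr)
            gcongr
        _ = B * c * (h * (ε + (∫ ω, (W.X (j + k) ω - W.X j ω) ^ 2 ∂W.P) / ε) + h ^ 2) := by
          rw [integral_const_mul, integral_add i5 (integrable_const _), integral_const_mul,
            integral_add (integrable_const _) i3, integral_div]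
          simp
        _ ≤ _ := by
          have := W.sec j k
          gcongr
    calc _ ≤ _ := abs_add_le _ _
      _ ≤ _ := add_le_add ih key2
      _ ≤ _ := by
        rw [← mul_add]
        have k0 : (0:ℝ) ≤ k := by positivity
        have : 0 ≤ A ^ 2 / ε := by positivity
        refine mul_le_mul_of_nonneg_left ?_ (by positivity)
        push_cast
        have e1 : 5 * A ^ 2 * (k * h) / ε = 5 * (A ^ 2 / ε) * (k * h) := by ring
        have e2 : 5 * A ^ 2 / ε = 5 * (A ^ 2 / ε) := by ring
        rw [e1, e2]
        generalize A ^ 2 / ε = q at *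
        have : 0 ≤ q * h ^ 2 * (5 * k + 5) + 2 * k * h ^ 2 := by positivity
        nlinarith

lemma first (j k : ℕ) (B ε : ℝ) (hB : 0 ≤ B) (hε : 0 < ε) (Ψ : W.Ω → ℝ)
    (hΨ : Measurable[W.G j] Ψ) (hΨB : ∀ ω, |Ψ ω| ≤ B) :
    |∫ ω, Ψ ω * (W.X (j + k) ω - W.X j ω + s * (k * h) * (W.X j ω * (1 - W.X j ω))) ∂W.P|
      ≤ B * (3 * A ^ 2) * (ε * (k * h) + (5 * A ^ 2 / ε + 1) * (k * h) ^ 2) := by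
  have hA := W.hA
  have h0 := W.h0
  have h1 := W.h1
  have hs := W.hs
  have hsA := W.hsA
  have mδ : ∀ k, Measurable[W.G k] (fun ω => W.δ (W.X k ω)) := fun k => W.hδ.comp (W.hX k)
  have mj : ∀ k, Measurable[W.G (j + k)] (W.X j) := fun k => W.hXle (Nat.le_add_right j k)
  refine W.drift j (3 * A ^ 2) B ε (by positivity) hB hε Ψ hΨ hΨB
    (fun k ω => W.X (j + k) ω - W.X j ω + s * (k * h) * (W.X j ω * (1 - W.X j ω)))
    (fun k ω => s * h * (W.X j ω * (1 - W.X j ω) - W.X (j + k) ω * (1 - W.X (j + k) ω)))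
    (fun k ω => W.δ (W.X (j + k) ω)) ?_ ?_ ?_ ?_ ?_ ?_ ?_ ?_ k
  · intro k; have := mj k; have := W.hX (j + k); fun_prop
  · intro k; have := mj k; have := W.hX (j + k); fun_prop
  · intro k; exact mδ _
  · intro k
    refine ⟨1 + s * (k * h) * 1, fun ω => (abs_add_le _ _).trans ?_⟩
    have := W.Zabs j (j + k) ω
    have a := aX _ (W.hX01 j ω)
    rw [abs_mul (s * (k * h)), abs_of_nonneg a.1, abs_of_nonneg (a := s * (k * h)) (by positivity)]
    have := a.2
    gcongr
  · intro k
    refine ⟨1 + 2 * A * h, fun ω => ?_⟩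
    have d := W.δsq _ (W.hX01 (j + k) ω)
    rw [← sq_abs] at d
    nlinarith [abs_nonneg (W.δ (W.X (j + k) ω)), sq_nonneg (|W.δ (W.X (j + k) ω)| - 1)]
  · intro k ω
    have a : |W.X j ω * (1 - W.X j ω) - W.X (j + k) ω * (1 - W.X (j + k) ω)|
      ≤ |W.X (j + k) ω - W.X j ω| := by
      have : W.X j ω * (1 - W.X j ω) - W.X (j + k) ω * (1 - W.X (j + k) ω)
        = (W.X (j + k) ω - W.X j ω) * (W.X (j + k) ω + W.X j ω - 1) := by ring
      rw [this, abs_mul]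
      refine mul_le_of_le_one_right (abs_nonneg _) ?_
      have h1 := W.hX01 (j + k) ω
      have h2 := W.hX01 j ω
      rw [abs_le]; constructor <;> linarith [h1.1, h1.2, h2.1, h2.2]
    rw [abs_mul, abs_of_nonneg (a := s * h) (by positivity)]
    have : s ≤ 3 * A ^ 2 := by nlinarith
    calc s * h * |W.X j ω * (1 - W.X j ω) - W.X (j + k) ω * (1 - W.X (j + k) ω)|
        ≤ 3 * A ^ 2 * h * |W.X (j + k) ω - W.X j ω| := by gcongr
      _ = 3 * A ^ 2 * (h * |W.X (j + k) ω - W.X j ω| + 0) := by ring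
      _ ≤ _ := by gcongr; positivity
  · intro ω; simp
  · intro k ω
    beta_reduce
    rw [← add_assoc, W.hrec]; push_cast; ring

lemma second (j k : ℕ) (B ε : ℝ) (hB : 0 ≤ B) (hε : 0 < ε) (Ψ : W.Ω → ℝ)
    (hΨ : Measurable[W.G j] Ψ) (hΨB : ∀ ω, |Ψ ω| ≤ B) :
    |∫ ω, Ψ ω * ((W.X (j + k) ω - W.X j ω) ^ 2 - σ ^ 2 * (k * h) * (W.X j ω * (1 - W.X j ω))) ∂W.P|
      ≤ B * (3 * A ^ 2) * (ε * (k * h) + (5 * A ^ 2 / ε + 1) * (k * h) ^ 2) := by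
  have hA := W.hA
  have h0 := W.h0
  have h1 := W.h1
  have hs := W.hs
  have hsA := W.hsA
  have hσA := W.hσA
  have mδ : ∀ k, Measurable[W.G k] (fun ω => W.δ (W.X k ω)) := fun k => W.hδ.comp (W.hX k)
  have mj : ∀ k, Measurable[W.G (j + k)] (W.X j) := fun k => W.hXle (Nat.le_add_right j k)
  refine W.drift j (3 * A ^ 2) B ε (by positivity) hB hε Ψ hΨ hΨB
    (fun k ω => (W.X (j + k) ω - W.X j ω) ^ 2 - σ ^ 2 * (k * h) * (W.X j ω * (1 - W.X j ω)))
    (fun k ω => -(2 * (W.X (j + k) ω - W.X j ω) * (s * h * (W.X (j + k) ω * (1 - W.X (j + k) ω))))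
      + (s * h * (W.X (j + k) ω * (1 - W.X (j + k) ω))) ^ 2
      + (W.δ (W.X (j + k) ω) ^ 2 - σ ^ 2 * h * (W.X j ω * (1 - W.X j ω))))
    (fun k ω => 2 * (W.X (j + k) ω - W.X j ω - s * h * (W.X (j + k) ω * (1 - W.X (j + k) ω)))
          * W.δ (W.X (j + k) ω)) ?_ ?_ ?_ ?_ ?_ ?_ ?_ ?_ k
  · intro k; have := mj k; have := W.hX (j + k); fun_prop
  · intro k; have := mj k; have := W.hX (j + k); have := mδ (j + k); fun_prop
  · intro k; have := mj k; have := W.hX (j + k); have := mδ (j + k); fun_prop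
  · intro k
    refine ⟨1 ^ 2 + σ ^ 2 * (k * h) * 1, fun ω => (abs_sub _ _).trans ?_⟩
    have := W.Zabs j (j + k) ω
    have a := aX _ (W.hX01 j ω)
    rw [abs_mul (σ ^ 2 * (k * h)), abs_of_nonneg a.1, abs_pow,
      abs_of_nonneg (a := σ ^ 2 * (k * h)) (by positivity)]
    have := a.2
    gcongr
  · intro k
    refine ⟨2 * (1 + A * h) * (1 + 2 * A * h), fun ω => ?_⟩
    have z := W.Zabs j (j + k) ω
    have b := W.babs (j + k) ω
    have d := W.δsq _ (W.hX01 (j + k) ω)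
    rw [abs_mul, abs_mul, abs_two]
    gcongr
    · exact (abs_sub _ _).trans (add_le_add z b)
    · rw [← sq_abs] at d
      nlinarith [abs_nonneg (W.δ (W.X (j + k) ω)), sq_nonneg (|W.δ (W.X (j + k) ω)| - 1)]
  · intro k ω
    have a : |W.X (j + k) ω * (1 - W.X (j + k) ω) - W.X j ω * (1 - W.X j ω)|
      ≤ |W.X (j + k) ω - W.X j ω| := by
      have : W.X (j + k) ω * (1 - W.X (j + k) ω) - W.X j ω * (1 - W.X j ω)
        = (W.X (j + k) ω - W.X j ω) * (1 - W.X (j + k) ω - W.X j ω) := by ring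
      rw [this, abs_mul]
      refine mul_le_of_le_one_right (abs_nonneg _) ?_
      have h1 := W.hX01 (j + k) ω
      have h2 := W.hX01 j ω
      rw [abs_le]; constructor <;> linarith [h1.1, h1.2, h2.1, h2.2]
    have b := W.babs (j + k) ω
    have d := W.hδb _ (W.hX01 (j + k) ω)
    beta_reduce
    generalize W.X (j + k) ω - W.X j ω = Z at *
    generalize W.X (j + k) ω * (1 - W.X (j + k) ω) = p at *
    generalize W.X j ω * (1 - W.X j ω) = q at *
    generalize W.δ (W.X (j + k) ω) ^ 2 = d' at *
    have e0 : |2 * Z * (s * h * p)| ≤ 2 * |Z| * (A * h) := by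
      rw [abs_mul, abs_mul, abs_two]; gcongr
    have e1 : |(s * h * p) ^ 2| ≤ (A * h) ^ 2 := by rw [abs_pow]; gcongr
    have e2 : |d' - σ ^ 2 * h * q| ≤ A * h ^ 2 + A * h * |Z| := by
      have : d' - σ ^ 2 * h * q = (d' - σ ^ 2 * h * p) + σ ^ 2 * h * (p - q) := by ring
      rw [this]
      refine (abs_add_le _ _).trans (add_le_add d ?_)
      rw [abs_mul, abs_of_nonneg (a := σ ^ 2 * h) (by positivity)]
      gcongr
    calc _ ≤ 2 * |Z| * (A * h) + (A * h) ^ 2 + (A * h ^ 2 + A * h * |Z|) := by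
          refine (abs_add_le _ _).trans (add_le_add ((abs_add_le _ _).trans (add_le_add ?_ e1)) e2)
          rwa [abs_neg]
      _ = 3 * A * (h * |Z|) + (A ^ 2 + A) * h ^ 2 := by ring
      _ ≤ 3 * A ^ 2 * (h * |Z|) + (3 * A ^ 2) * h ^ 2 := by
          gcongr <;> nlinarith
      _ = _ := by ring
  · intro ω; simp
  · intro k ω
    have := W.he1 (j + k) ω
    beta_reduce
    rw [← add_assoc, W.hrec]; push_cast
    linear_combination (W.δ (W.X (j + k) ω)) ^ 2 * this

end WFChain

/-- The drifted position. -/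
def wfM (s h x : ℝ) : ℝ := x - s * h * (x * (1 - x))

/-- The step size. -/
def wfδ (s σ h x : ℝ) : ℝ :=
  min (Real.sqrt (σ ^ 2 * h * (wfM s h x * (1 - wfM s h x)))) (min (wfM s h x) (1 - wfM s h x))

/-- Signs. -/
def wfe (k : ℕ) (ω : ℕ → ℝ) : ℝ := if 0 ≤ ω (k + 1) then 1 else -1

/-- The approximating chain. -/
def wfX (s σ h : ℝ) : ℕ → (ℕ → ℝ) → ℝ
  | 0, ω => max 0 (min 1 (ω 0))
  | k + 1, ω => wfX s σ h k ω - s * h * (wfX s σ h k ω * (1 - wfX s σ h k ω))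
      + wfδ s σ h (wfX s σ h k ω) * wfe k ω

lemma wfM_mem {s h x : ℝ} (hs : 0 ≤ s) (h0 : 0 ≤ h) (hsh : s * h ≤ 1) (hx : x ∈ Icc (0:ℝ) 1) :
    wfM s h x ∈ Icc (0:ℝ) 1 := by
  obtain ⟨h1, h2⟩ := hx
  unfold wfM
  have : 0 ≤ s * h := by positivity
  have a : 0 ≤ x * (1 - x) := by nlinarith
  constructor
  · have : s * h * (x * (1 - x)) ≤ 1 * (x * (1 - x)) := by gcongr
    nlinarith
  · have := mul_nonneg this a
    linarith

lemma wfe_cases (k : ℕ) (ω : ℕ → ℝ) : wfe k ω = 1 ∨ wfe k ω = -1 := by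
  unfold wfe; split_ifs <;> simp

lemma wfX_mem {s σ h : ℝ} (hs : 0 ≤ s) (h0 : 0 ≤ h) (hsh : s * h ≤ 1) (k : ℕ) (ω : ℕ → ℝ) :
    wfX s σ h k ω ∈ Icc (0:ℝ) 1 := by
  induction k with
  | zero => simp [wfX]
  | succ k ih =>
    have hm := wfM_mem hs h0 hsh ih
    have : wfX s σ h (k + 1) ω = wfM s h (wfX s σ h k ω) + wfδ s σ h (wfX s σ h k ω) * wfe k ω := rfl
    rw [this]
    unfold wfδ
    set m := wfM s h (wfX s σ h k ω)
    have d0 : 0 ≤ min (Real.sqrt (σ ^ 2 * h * (m * (1 - m)))) (min m (1 - m)) :=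
      le_min (Real.sqrt_nonneg _) (le_min hm.1 (by linarith [hm.2]))
    have d1 : min (Real.sqrt (σ ^ 2 * h * (m * (1 - m)))) (min m (1 - m)) ≤ m :=
      (min_le_right _ _).trans (min_le_left _ _)
    have d2 : min (Real.sqrt (σ ^ 2 * h * (m * (1 - m)))) (min m (1 - m)) ≤ 1 - m :=
      (min_le_right _ _).trans (min_le_right _ _)
    rcases wfe_cases k ω with h | h <;> rw [h] <;> constructor <;> linarith

lemma wfδ_bound {s σ h x : ℝ} (hs : 0 ≤ s) (h0 : 0 ≤ h) (hsh : s * h ≤ 1) (hx : x ∈ Icc (0:ℝ) 1) :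
    |wfδ s σ h x ^ 2 - σ ^ 2 * h * (x * (1 - x))| ≤ (σ ^ 4 + σ ^ 2 * s) * h ^ 2 := by
  have hm := wfM_mem hs h0 hsh hx
  have e1 : |wfM s h x * (1 - wfM s h x) - x * (1 - x)| ≤ s * h := by
    have a : |wfM s h x - x| ≤ s * h := by
      unfold wfM
      have a0 := WFChain.aX x hx
      have : 0 ≤ s * h := by positivity
      rw [show x - s * h * (x * (1 - x)) - x = -(s * h * (x * (1 - x))) by ring, abs_neg,
        abs_of_nonneg (mul_nonneg this a0.1)]
      nlinarith
    have : wfM s h x * (1 - wfM s h x) - x * (1 - x) = (wfM s h x - x) * (1 - wfM s h x - x) := by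
      ring
    rw [this, abs_mul]
    refine (mul_le_of_le_one_right (abs_nonneg _) ?_).trans a
    rw [abs_le]; constructor <;> linarith [hm.1, hm.2, hx.1, hx.2]
  unfold wfδ
  set m := wfM s h x
  have mm : 0 ≤ m * (1 - m) := (WFChain.aX m hm).1
  have e2 : |(min (Real.sqrt (σ ^ 2 * h * (m * (1 - m)))) (min m (1 - m))) ^ 2
      - σ ^ 2 * h * (m * (1 - m))| ≤ σ ^ 4 * h ^ 2 := by
    have hq : 0 ≤ σ ^ 2 * h * (m * (1 - m)) := by positivity
    have hc : 0 ≤ σ ^ 2 * h := by positivity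
    rcases le_total (Real.sqrt (σ ^ 2 * h * (m * (1 - m)))) (min m (1 - m)) with hle | hle
    · rw [min_eq_left hle, Real.sq_sqrt hq]
      simp only [sub_self, abs_zero]; positivity
    · rw [min_eq_right hle]
      have : σ ^ 4 * h ^ 2 = (σ ^ 2 * h) ^ 2 := by ring
      rw [this]
      generalize σ ^ 2 * h = c at *
      have hmin0 : 0 ≤ min m (1 - m) := le_min hm.1 (by linarith [hm.2])
      have hsq : (min m (1 - m)) ^ 2 ≤ c * (m * (1 - m)) := by
        calc _ ≤ (Real.sqrt (c * (m * (1 - m)))) ^ 2 := by gcongr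
          _ = _ := Real.sq_sqrt hq
      have key : c * (m * (1 - m)) ≤ c ^ 2 := by
        rcases le_total m (1 - m) with h' | h'
        · rw [min_eq_left h'] at hsq
          rcases eq_or_lt_of_le hm.1 with h'' | h''
          · rw [← h'']; nlinarith
          · have : m ≤ c * (1 - m) := by
              by_contra hcon
              push Not at hcon
              nlinarith
            have : m ≤ c := by nlinarith [hm.2]
            nlinarith [hm.1]
        · rw [min_eq_right h'] at hsq
          rcases eq_or_lt_of_le hm.2 with h'' | h''
          · rw [h'']; nlinarith
          · have : 1 - m ≤ c * m := by
              by_contra hcon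
              push Not at hcon
              nlinarith
            have : 1 - m ≤ c := by nlinarith [hm.2]
            nlinarith [hm.1]
      rw [abs_le]; constructor <;> nlinarith
  have : ∀ D : ℝ, D ^ 2 - σ ^ 2 * h * (x * (1 - x)) = (D ^ 2 - σ ^ 2 * h * (m * (1 - m)))
    + σ ^ 2 * h * (m * (1 - m) - x * (1 - x)) := by intro D; ring
  rw [this]
  refine (abs_add_le _ _).trans ?_
  rw [abs_mul, abs_of_nonneg (a := σ ^ 2 * h) (by positivity)]
  calc _ ≤ σ ^ 4 * h ^ 2 + σ ^ 2 * h * (s * h) := by gcongr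
    _ = _ := by ring

/-- coordinate law -/
def wfcoin : Measure ℝ := (2⁻¹ : ℝ≥0∞) • (Measure.dirac (1:ℝ) + Measure.dirac (-1))

instance : IsProbabilityMeasure wfcoin := by
  constructor
  simp only [wfcoin, Measure.smul_apply, Measure.add_apply, measure_univ, smul_eq_mul]
  rw [show (1:ℝ≥0∞) + 1 = 2 by norm_num]
  exact ENNReal.inv_mul_cancel (by norm_num) (by norm_num)

lemma wfchain_exists (s σ : ℝ) (hs : 0 ≤ s) (α : Measure ℝ) [IsProbabilityMeasure α]
    (hα : α (Icc (0:ℝ) 1)ᶜ = 0) (h : ℝ) (h0 : 0 < h) (h1 : h ≤ 1) (hsh : s * h ≤ 1) :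
    ∃ W : WFChain s σ (1 + s + σ ^ 2 + σ ^ 4 + σ ^ 2 * s) h, W.P.map (W.X 0) = α := by
  let μ : ℕ → Measure ℝ := fun k => if k = 0 then α else wfcoin
  have hμ : ∀ k, IsProbabilityMeasure (μ k) := by
    intro k; by_cases hk : k = 0 <;> simp only [μ, hk, if_true, if_false] <;> infer_instance
  have hsm : ∀ k : ℕ, StronglyMeasurable (fun ω : ℕ → ℝ => ω k) :=
    fun k => (measurable_pi_apply k).stronglyMeasurable
  let G := Filtration.natural (fun (k : ℕ) (ω : ℕ → ℝ) => ω k) hsm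
  have hco : ∀ j k : ℕ, j ≤ k → Measurable[G k] (fun ω : ℕ → ℝ => ω j) := by
    intro j k hjk
    exact ((Filtration.stronglyAdapted_natural hsm j).measurable).mono (G.mono hjk) le_rfl
  have hme : ∀ k, Measurable (wfe k) := by
    intro k
    unfold wfe
    exact Measurable.ite (measurableSet_le measurable_const (measurable_pi_apply _))
      measurable_const measurable_const
  have hmδ : Measurable (wfδ s σ h) := by
    unfold wfδ wfM
    fun_prop
  have hind : iIndepFun (fun (k : ℕ) (ω : ℕ → ℝ) => ω k) (Measure.infinitePi μ) :=
    iIndepFun_infinitePi (X := fun _ x => x) (fun _ => measurable_id)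
  have hint : ∀ k, ∫ ω, wfe k ω ∂(Measure.infinitePi μ) = 0 := by
    intro k
    have hmm : Measurable (fun x : ℝ => if 0 ≤ x then (1:ℝ) else -1) :=
      Measurable.ite (measurableSet_le measurable_const measurable_id)
        measurable_const measurable_const
    have : ∫ ω, wfe k ω ∂(Measure.infinitePi μ)
      = ∫ x, (if 0 ≤ x then (1:ℝ) else -1) ∂((Measure.infinitePi μ).map (fun ω => ω (k + 1))) := by
      rw [integral_map (measurable_pi_apply _).aemeasurable hmm.aestronglyMeasurable]
      rfl
    rw [this, Measure.infinitePi_map_eval]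
    simp only [μ, Nat.succ_ne_zero, if_false, wfcoin]
    rw [integral_smul_measure, integral_add_measure (integrable_dirac (by finiteness))
      (integrable_dirac (by finiteness)), integral_dirac, integral_dirac]
    norm_num
  have hmX : ∀ k, Measurable[G k] (wfX s σ h k) := by
    intro k
    induction k with
    | zero =>
      have := hco 0 0 le_rfl
      show Measurable[G 0] (fun ω : ℕ → ℝ => max 0 (min 1 (ω 0)))
      exact measurable_const.max (measurable_const.min this)
    | succ k ih =>
      have ih' : Measurable[G (k + 1)] (wfX s σ h k) := ih.mono (G.mono (Nat.le_succ k)) le_rfl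
      have a1 : Measurable[G (k + 1)] (fun ω => wfδ s σ h (wfX s σ h k ω)) := hmδ.comp ih'
      have a2 : Measurable[G (k + 1)] (wfe k) := by
        have hmm : Measurable (fun x : ℝ => if 0 ≤ x then (1:ℝ) else -1) :=
          Measurable.ite (measurableSet_le measurable_const measurable_id)
            measurable_const measurable_const
        exact hmm.comp (hco (k + 1) (k + 1) le_rfl)
      show Measurable[G (k + 1)] (fun ω : ℕ → ℝ => wfX s σ h k ω
        - s * h * (wfX s σ h k ω * (1 - wfX s σ h k ω)) + wfδ s σ h (wfX s σ h k ω) * wfe k ω)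
      fun_prop
  refine ⟨{ Ω := ℕ → ℝ, P := Measure.infinitePi μ, probP := inferInstance, G := G, Gle := G.le,
            Gmono := fun _ _ hij => G.mono hij, e := wfe, he := hme, he1 := ?_, ho := ?_, X := wfX s σ h, hX := hmX,
            hX01 := wfX_mem hs h0.le hsh, δ := wfδ s σ h, hδ := hmδ, hδb := ?_,
            hrec := fun k ω => rfl, hs := hs, hsA := ?_, hσA := ?_, hA := ?_, h0 := h0, h1 := h1}, ?_⟩
  · intro k ω
    rcases wfe_cases k ω with h | h <;> rw [h] <;> norm_num
  · intro k g hg _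
    have i1 := hind.indep_comap_natural_of_lt hsm (Nat.lt_succ_self k)
    have i2 : IndepFun g (wfe k) (Measure.infinitePi μ) := by
      rw [IndepFun_iff_Indep]
      have hmm : Measurable (fun x : ℝ => if 0 ≤ x then (1:ℝ) else -1) :=
        Measurable.ite (measurableSet_le measurable_const measurable_id)
          measurable_const measurable_const
      refine indep_of_indep_of_le_left (indep_of_indep_of_le_right i1.symm ?_) hg.comap_le
      exact (hmm.comp (comap_measurable (fun ω : ℕ → ℝ => ω (k + 1)))).comap_le
    have := i2.integral_mul_eq_mul_integral
      (hg.mono (G.le k) le_rfl).aestronglyMeasurable (hme k).aestronglyMeasurable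
    rw [hint k, mul_zero] at this
    exact this
  · intro x hx
    refine (wfδ_bound hs h0.le hsh hx).trans ?_
    gcongr
    nlinarith [sq_nonneg σ]
  · nlinarith [sq_nonneg σ, mul_nonneg (sq_nonneg σ) hs, sq_nonneg (σ ^ 2)]
  · nlinarith [sq_nonneg σ, mul_nonneg (sq_nonneg σ) hs, sq_nonneg (σ ^ 2)]
  · nlinarith [sq_nonneg σ, mul_nonneg (sq_nonneg σ) hs, sq_nonneg (σ ^ 2)]
  · show (Measure.infinitePi μ).map (wfX s σ h 0) = α
    have hcl : Measurable (fun x : ℝ => max 0 (min 1 x)) := by fun_prop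
    have e1 : wfX s σ h 0 = (fun x : ℝ => max 0 (min 1 x)) ∘ (fun ω : ℕ → ℝ => ω 0) := rfl
    rw [e1, ← Measure.map_map hcl (measurable_pi_apply 0), Measure.infinitePi_map_eval]
    simp only [μ, if_true]
    conv_rhs => rw [← Measure.map_id (μ := α)]
    refine Measure.map_congr ?_
    have : ∀ᵐ x ∂α, x ∈ Icc (0:ℝ) 1 := hα
    filter_upwards [this] with x hx
    simp [hx.1, hx.2]

/-- dyadic nonnegative rationals -/
def WFDy (q : ℚ) : Prop := ∃ m k : ℕ, q = (k : ℚ) / 2 ^ m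

def wfidx (n : ℕ) (q : ℚ) : ℕ := ⌊q * 2 ^ n⌋₊

lemma wfidx_dy {q : ℚ} (hq : WFDy q) : ∀ᶠ n : ℕ in atTop, ((wfidx n q : ℕ) : ℚ) = q * 2 ^ n := by
  obtain ⟨m, k, rfl⟩ := hq
  filter_upwards [eventually_ge_atTop m] with n hn
  obtain ⟨j, rfl⟩ := Nat.exists_eq_add_of_le hn
  have : (k : ℚ) / 2 ^ m * 2 ^ (m + j) = ((k * 2 ^ j : ℕ) : ℚ) := by
    push_cast
    rw [pow_add]; field_simp
  rw [wfidx, this, Nat.floor_natCast]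

lemma wfidx_mono (n : ℕ) {p q : ℚ} (h : p ≤ q) : wfidx n p ≤ wfidx n q := by
  unfold wfidx
  gcongr

structure WFDyadic (s σ A : ℝ) (α : Measure ℝ) where
  (Ω : Type)
  [mΩ : MeasurableSpace Ω]
  (P : Measure Ω)
  (probP : IsProbabilityMeasure P)
  (Y : ℚ → Ω → ℝ)
  (measY : ∀ q, Measurable (Y q))
  (Y01 : ∀ q ω, Y q ω ∈ Icc (0:ℝ) 1)
  (law : P.map (Y 0) = α)
  (hA : 1 ≤ A)
  (four : ∀ p q, WFDy p → WFDy q → p ≤ q →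
    ∫ ω, (Y q ω - Y p ω) ^ 4 ∂P ≤ 40 * A ^ 4 * (5 * A ^ 2 + 1) * ((q : ℝ) - p) ^ 2)
  (first : ∀ (n : ℕ) (u : Fin n → ℚ) (p q : ℚ) (Φ : (Fin n → ℝ) → ℝ) (B ε : ℝ),
    0 ≤ B → 0 < ε → (∀ i, WFDy (u i)) → (∀ i, u i ≤ p) → WFDy p → WFDy q → p ≤ q →
    Continuous Φ → (∀ v, |Φ v| ≤ B) →
    |∫ ω, Φ (fun i => Y (u i) ω) * (Y q ω - Y p ω + s * ((q : ℝ) - p) * (Y p ω * (1 - Y p ω))) ∂P|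
      ≤ B * (3 * A ^ 2) * (ε * ((q : ℝ) - p) + (5 * A ^ 2 / ε + 1) * ((q : ℝ) - p) ^ 2))
  (second : ∀ (n : ℕ) (u : Fin n → ℚ) (p q : ℚ) (Φ : (Fin n → ℝ) → ℝ) (B ε : ℝ),
    0 ≤ B → 0 < ε → (∀ i, WFDy (u i)) → (∀ i, u i ≤ p) → WFDy p → WFDy q → p ≤ q →
    Continuous Φ → (∀ v, |Φ v| ≤ B) →
    |∫ ω, Φ (fun i => Y (u i) ω) * ((Y q ω - Y p ω) ^ 2 - σ ^ 2 * ((q : ℝ) - p) * (Y p ω * (1 - Y p ω))) ∂P|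
      ≤ B * (3 * A ^ 2) * (ε * ((q : ℝ) - p) + (5 * A ^ 2 / ε + 1) * ((q : ℝ) - p) ^ 2))

attribute [instance] WFDyadic.mΩ WFDyadic.probP

abbrev WFK := ℚ → unitInterval

lemma wfdyadic_exists (s σ : ℝ) (hs : 0 ≤ s) (α : Measure ℝ) [IsProbabilityMeasure α]
    (hα : α (Icc 0 1)ᶜ = 0) : Nonempty (WFDyadic s σ (1+s+σ^2+σ^4+σ^2*s) α) := by
  set A := 1+s+σ^2+σ^4+σ^2*s with hAdef
  have hA : 1 ≤ A := by
    nlinarith [sq_nonneg σ, mul_nonneg (sq_nonneg σ) hs, sq_nonneg (σ ^ 2)]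
  obtain ⟨n0, hn0⟩ := pow_unbounded_of_one_lt s (one_lt_two)
  have key : ∀ n : ℕ, ∃ W : WFChain s σ A (1 / 2 ^ (n + n0)), W.P.map (W.X 0) = α := by
    intro n
    apply wfchain_exists s σ hs α hα
    · positivity
    · rw [div_le_one (by positivity)]; exact one_le_pow₀ (by norm_num)
    · rw [mul_one_div, div_le_one (by positivity)]
      calc s ≤ 2 ^ n0 := hn0.le
        _ ≤ 2 ^ (n + n0) := pow_le_pow_right₀ (by norm_num) (by omega)
  choose W hW using key
  let T : ∀ n, (W n).Ω → WFK := fun n ω q => ⟨(W n).X (wfidx (n + n0) q) ω, (W n).hX01 _ _⟩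
  have hT : ∀ n, Measurable (T n) := fun n =>
    measurable_pi_lambda _ fun q => ((W n).measX _).subtype_mk
  let ν : ℕ → ProbabilityMeasure WFK := fun n =>
    ⟨(W n).P.map (T n), Measure.isProbabilityMeasure_map (hT n).aemeasurable⟩
  obtain ⟨μ, hμ⟩ : ∃ μ : ProbabilityMeasure WFK, Tendsto ν (hyperfilter ℕ) (𝓝 μ) :=
    ⟨_, ((hyperfilter ℕ).map ν).le_nhds_lim⟩
  have hint : ∀ F : WFK → ℝ, Continuous F →
      Tendsto (fun n => ∫ ω, F (T n ω) ∂(W n).P) (hyperfilter ℕ) (𝓝 (∫ x, F x ∂(μ : Measure WFK))) := by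
    intro F hF
    have := (ProbabilityMeasure.tendsto_iff_forall_integral_tendsto.1 hμ)
      (BoundedContinuousFunction.mkOfCompact ⟨F, hF⟩)
    refine this.congr fun n => ?_
    show ∫ x, F x ∂((W n).P.map (T n)) = _
    rw [integral_map (hT n).aemeasurable hF.measurable.aestronglyMeasurable]
  have hev : ∀ {p : ℕ → Prop}, (∀ᶠ n in atTop, p n) → ∀ᶠ n in (hyperfilter ℕ : Filter ℕ), p n :=
    fun h => Nat.hyperfilter_le_atTop h
  have hdy : ∀ {q : ℚ}, WFDy q → ∀ᶠ n in (hyperfilter ℕ : Filter ℕ),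
      ((wfidx (n + n0) q : ℕ) : ℝ) = q * 2 ^ (n + n0) := by
    intro q hq
    apply hev
    filter_upwards [(tendsto_add_atTop_nat n0).eventually (wfidx_dy hq)] with n hn
    exact_mod_cast congrArg (fun x : ℚ => (x : ℝ)) hn
  have hinc : ∀ {p q : ℚ}, WFDy p → WFDy q → p ≤ q → ∀ᶠ n in (hyperfilter ℕ : Filter ℕ),
      ∃ k : ℕ, wfidx (n + n0) q = wfidx (n + n0) p + k ∧ (k : ℝ) * (1 / 2 ^ (n + n0)) = (q : ℝ) - p := by
    intro p q hp hq hpq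
    filter_upwards [hdy hp, hdy hq] with n h1 h2
    obtain ⟨k, hk⟩ := Nat.exists_eq_add_of_le (wfidx_mono (n + n0) hpq)
    refine ⟨k, hk, ?_⟩
    rw [hk] at h2
    push_cast at h2
    field_simp
    linarith
  have hYc : ∀ q : ℚ, Continuous (fun x : WFK => (x q : ℝ)) := fun q =>
    continuous_subtype_val.comp (continuous_apply q)
  have hYn : ∀ n q ω, ((T n ω q : unitInterval) : ℝ) = (W n).X (wfidx (n + n0) q) ω := fun _ _ _ => rfl
  refine ⟨{ Ω := WFK, P := μ, probP := inferInstance, Y := fun q x => (x q : ℝ)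
            measY := fun q => (hYc q).measurable, Y01 := fun q x => (x q).2
            law := ?_, hA := hA, four := ?_, first := ?_, second := ?_ }⟩
  · have : IsProbabilityMeasure ((μ : Measure WFK).map (fun x : WFK => (x 0 : ℝ))) :=
      Measure.isProbabilityMeasure_map (hYc 0).measurable.aemeasurable
    apply ext_of_forall_integral_eq_of_IsFiniteMeasure
    intro g
    rw [integral_map (hYc 0).measurable.aemeasurable g.continuous.measurable.aestronglyMeasurable]
    refine tendsto_nhds_unique (hint _ (g.continuous.comp (hYc 0))) ?_
    refine tendsto_const_nhds.congr fun n => ?_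
    conv_lhs => rw [← hW n]
    rw [integral_map ((W n).measX 0).aemeasurable g.continuous.measurable.aestronglyMeasurable]
    have h0 : wfidx (n + n0) 0 = 0 := by simp [wfidx]
    refine integral_congr_ae (ae_of_all _ fun ω => ?_)
    simp only [hYn, h0]
  · intro p q hp hq hpq
    refine le_of_tendsto (hint (fun x => ((x q : ℝ) - x p) ^ 4) (by fun_prop)) ?_
    filter_upwards [hinc hp hq hpq] with n ⟨k, hk, hk2⟩
    have := (W n).four (wfidx (n + n0) p) k
    rw [hk2, ← hk] at this
    exact this
  · intro N u p q Φ B ε hB hε hu hup hp hq hpq hΦ hΦB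
    refine le_of_tendsto (hint (fun x => Φ (fun i => (x (u i) : ℝ)) *
      ((x q : ℝ) - x p + s * ((q : ℝ) - p) * ((x p : ℝ) * (1 - x p)))) ?_).abs ?_
    · have : Continuous (fun x : WFK => (fun i => (x (u i) : ℝ))) := continuous_pi fun i => hYc _
      have := hΦ.comp this
      fun_prop
    filter_upwards [hinc hp hq hpq] with n ⟨k, hk, hk2⟩
    have := (W n).first (wfidx (n + n0) p) k B ε hB hε
      (fun ω => Φ (fun i => (W n).X (wfidx (n + n0) (u i)) ω)) ?_ (fun ω => hΦB _)
    · rw [hk2, ← hk] at this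
      exact this
    · have hm : Measurable[(W n).G (wfidx (n + n0) p)]
          (fun (ω : (W n).Ω) (i : Fin N) => (W n).X (wfidx (n + n0) (u i)) ω) := by
        refine @measurable_pi_lambda _ _ _ ((W n).G (wfidx (n + n0) p)) _ _ fun i => ?_
        exact ((W n).hX _).mono ((W n).Gmono (wfidx_mono _ (hup i))) le_rfl
      exact hΦ.measurable.comp hm
  · intro N u p q Φ B ε hB hε hu hup hp hq hpq hΦ hΦB
    refine le_of_tendsto (hint (fun x => Φ (fun i => (x (u i) : ℝ)) *
      (((x q : ℝ) - x p) ^ 2 - σ ^ 2 * ((q : ℝ) - p) * ((x p : ℝ) * (1 - x p)))) ?_).abs ?_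
    · have : Continuous (fun x : WFK => (fun i => (x (u i) : ℝ))) := continuous_pi fun i => hYc _
      have := hΦ.comp this
      fun_prop
    filter_upwards [hinc hp hq hpq] with n ⟨k, hk, hk2⟩
    have := (W n).second (wfidx (n + n0) p) k B ε hB hε
      (fun ω => Φ (fun i => (W n).X (wfidx (n + n0) (u i)) ω)) ?_ (fun ω => hΦB _)
    · rw [hk2, ← hk] at this
      exact this
    · have hm : Measurable[(W n).G (wfidx (n + n0) p)]
          (fun (ω : (W n).Ω) (i : Fin N) => (W n).X (wfidx (n + n0) (u i)) ω) := by
        refine @measurable_pi_lambda _ _ _ ((W n).G (wfidx (n + n0) p)) _ _ fun i => ?_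
        exact ((W n).hX _).mono ((W n).Gmono (wfidx_mono _ (hup i))) le_rfl
      exact hΦ.measurable.comp hm

def wfd (n : ℕ) (t : ℝ) : ℚ := (⌊t * 2 ^ n⌋₊ : ℚ) / 2 ^ n

lemma wfd_dy (n : ℕ) (t : ℝ) : WFDy (wfd n t) := ⟨n, _, rfl⟩

lemma wfd_mono (n : ℕ) {t t' : ℝ} (h : t ≤ t') : wfd n t ≤ wfd n t' := by
  unfold wfd
  gcongr

lemma wfd_nonpos (n : ℕ) {t : ℝ} (h : t ≤ 0) : wfd n t = 0 := by
  have : ⌊t * 2 ^ n⌋₊ = 0 := Nat.floor_of_nonpos (mul_nonpos_of_nonpos_of_nonneg h (by positivity))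
  simp [wfd, this]

lemma wfd_tendsto {t : ℝ} (h : 0 ≤ t) : Tendsto (fun n => ((wfd n t : ℚ) : ℝ)) atTop (𝓝 t) := by
  have h1 : Tendsto (fun n : ℕ => t - (1 / 2 : ℝ) ^ n) atTop (𝓝 t) := by
    simpa using (tendsto_const_nhds (x := t)).sub
      (tendsto_pow_atTop_nhds_zero_of_lt_one (r := (1/2:ℝ)) (by norm_num) (by norm_num))
  refine tendsto_of_tendsto_of_tendsto_of_le_of_le h1 tendsto_const_nhds ?_ ?_
  · intro n
    have := Nat.lt_floor_add_one (t * 2 ^ n)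
    have h2 : (0:ℝ) < 2 ^ n := by positivity
    simp only [wfd]
    push_cast
    rw [le_div_iff₀ h2, sub_mul, ← mul_pow]
    norm_num
    linarith
  · intro n
    have := Nat.floor_le (a := t * 2 ^ n) (by positivity)
    simp only [wfd]
    push_cast
    rw [div_le_iff₀ (by positivity)]
    exact this

def WFGood (y : ℚ → ℝ) : Prop :=
  ∀ N : ℕ, ∃ M : ℕ, ∀ n k : ℕ, k < N * 2 ^ n →
    |y ((k + 1 : ℕ) / 2 ^ n) - y ((k : ℕ) / 2 ^ n)| ≤ M * (9 / 10 : ℝ) ^ n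

lemma wfgood_succ {y : ℚ → ℝ} {N M : ℕ} (hM : ∀ n k : ℕ, k < N * 2 ^ n →
    |y ((k + 1 : ℕ) / 2 ^ n) - y ((k : ℕ) / 2 ^ n)| ≤ M * (9 / 10 : ℝ) ^ n) {t : ℝ} (ht : t < N) (n : ℕ) :
    dist (y (wfd n t)) (y (wfd (n + 1) t)) ≤ M * (9 / 10 : ℝ) ^ n := by
  have hpos : (0:ℝ) ≤ M * (9 / 10 : ℝ) ^ n := by positivity
  rcases le_or_gt t 0 with h0 | h0
  · rw [wfd_nonpos _ h0, wfd_nonpos _ h0, dist_self]; exact hpos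
  set k := ⌊t * 2 ^ n⌋₊ with hk
  have e1 : wfd n t = ((2 * k : ℕ) : ℚ) / 2 ^ (n + 1) := by
    simp only [wfd, ← hk]; push_cast; rw [pow_succ]; field_simp
  have l1 := Nat.floor_le (a := t * 2 ^ n) (by positivity)
  have l2 := Nat.lt_floor_add_one (t * 2 ^ n)
  rw [← hk] at l1 l2
  have hb : 2 * k < N * 2 ^ (n + 1) := by
    have : (k:ℝ) < N * 2 ^ n := l1.trans_lt (by gcongr)
    have : k < N * 2 ^ n := by exact_mod_cast this
    rw [pow_succ]; linarith
  have hc : ⌊t * 2 ^ (n + 1)⌋₊ = 2 * k ∨ ⌊t * 2 ^ (n + 1)⌋₊ = 2 * k + 1 := by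
    have a1 : 2 * k ≤ ⌊t * 2 ^ (n + 1)⌋₊ := by
      apply Nat.le_floor; push_cast; rw [pow_succ]; linarith
    have a2 : ⌊t * 2 ^ (n + 1)⌋₊ < 2 * k + 2 := by
      rw [Nat.floor_lt (by positivity)]; push_cast; rw [pow_succ]; linarith
    omega
  rcases hc with hc | hc
  · have : wfd (n + 1) t = wfd n t := by rw [e1, wfd, hc]
    rw [this, dist_self]; exact hpos
  · have e2 : wfd (n + 1) t = ((2 * k + 1 : ℕ) : ℚ) / 2 ^ (n + 1) := by rw [wfd, hc]
    rw [e1, e2, dist_comm, Real.dist_eq]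
    refine (hM (n + 1) (2 * k) hb).trans ?_
    rw [pow_succ]
    have : (0:ℝ) ≤ M * (9 / 10 : ℝ) ^ n := by positivity
    nlinarith

lemma wfgood_close {y : ℚ → ℝ} {N M : ℕ} (hM : ∀ n k : ℕ, k < N * 2 ^ n →
    |y ((k + 1 : ℕ) / 2 ^ n) - y ((k : ℕ) / 2 ^ n)| ≤ M * (9 / 10 : ℝ) ^ n) {t t' : ℝ} (ht : t' < N)
    (htt : t ≤ t') (n : ℕ) (hcl : t' - t < 1 / 2 ^ n) :
    dist (y (wfd n t)) (y (wfd n t')) ≤ M * (9 / 10 : ℝ) ^ n := by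
  have hpos : (0:ℝ) ≤ M * (9 / 10 : ℝ) ^ n := by positivity
  have hcl' : t' * 2 ^ n < t * 2 ^ n + 1 := by
    rw [lt_div_iff₀ (by positivity)] at hcl
    linarith
  have m1 : ⌊t * 2 ^ n⌋₊ ≤ ⌊t' * 2 ^ n⌋₊ := by gcongr
  have m2 : ⌊t' * 2 ^ n⌋₊ ≤ ⌊t * 2 ^ n⌋₊ + 1 := by
    rcases le_or_gt t' 0 with h0 | h0
    · rw [Nat.floor_of_nonpos (mul_nonpos_of_nonpos_of_nonneg h0 (by positivity))]; omega
    · have := Nat.lt_floor_add_one (t * 2 ^ n)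
      apply Nat.lt_succ_iff.1
      rw [Nat.floor_lt (by positivity)]
      push_cast
      linarith
  rcases (by omega : ⌊t' * 2 ^ n⌋₊ = ⌊t * 2 ^ n⌋₊ ∨ ⌊t' * 2 ^ n⌋₊ = ⌊t * 2 ^ n⌋₊ + 1) with hc | hc
  · have : wfd n t' = wfd n t := by rw [wfd, wfd, hc]
    rw [this, dist_self]; exact hpos
  · rw [wfd, wfd, hc, dist_comm, Real.dist_eq]
    apply hM n
    have h0 : 0 < t' := by
      by_contra hh
      rw [Nat.floor_of_nonpos (mul_nonpos_of_nonpos_of_nonneg (not_lt.1 hh) (by positivity))] at hc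
      omega
    have l1 := Nat.floor_le (a := t' * 2 ^ n) (by positivity)
    rw [hc] at l1
    have : ((⌊t * 2 ^ n⌋₊ : ℕ) : ℝ) < (N * 2 ^ n : ℕ) := by
      push_cast at l1 ⊢
      have : t' * 2 ^ n < N * 2 ^ n := by gcongr
      linarith
    exact_mod_cast this

lemma wfgood_lim {y : ℚ → ℝ} (hy : WFGood y) :
    ∃ g : ℝ → ℝ, Continuous g ∧ ∀ t, Tendsto (fun n => y (wfd n t)) atTop (𝓝 (g t)) := by
  have h1 : ∀ t : ℝ, ∃ l, Tendsto (fun n => y (wfd n t)) atTop (𝓝 l) := by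
    intro t
    obtain ⟨N, hN⟩ := exists_nat_gt t
    obtain ⟨M, hM⟩ := hy N
    exact cauchySeq_tendsto_of_complete
      (cauchySeq_of_le_geometric (9/10) M (by norm_num) (wfgood_succ hM hN))
  choose g hg using h1
  refine ⟨g, ?_, hg⟩
  rw [continuous_iff_continuousAt]
  intro t0
  obtain ⟨N, hN⟩ := exists_nat_gt (t0 + 1)
  obtain ⟨M, hM⟩ := hy N
  rw [Metric.continuousAt_iff]
  intro ε hε
  have hlim : Tendsto (fun n : ℕ => 21 * (M * (9/10:ℝ) ^ n)) atTop (𝓝 0) := by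
    simpa using ((tendsto_pow_atTop_nhds_zero_of_lt_one (r := (9/10:ℝ)) (by norm_num)
      (by norm_num)).const_mul (M:ℝ)).const_mul 21
  obtain ⟨n, hn⟩ := ((tendsto_order.1 hlim).2 ε hε).exists
  refine ⟨min 1 (1 / 2 ^ n), by positivity, ?_⟩
  intro t ht
  rw [Real.dist_eq] at ht
  have ht1 := (ht.trans_le (min_le_left _ _))
  have ht2 := (ht.trans_le (min_le_right _ _))
  rw [abs_lt] at ht1 ht2
  have b : ∀ t : ℝ, t < N → dist (y (wfd n t)) (g t) ≤ M * (9/10:ℝ) ^ n / (1 - 9/10) := fun t ht =>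
    dist_le_of_le_geometric_of_tendsto (9/10) M (by norm_num) (wfgood_succ hM ht) (hg t) n
  have b1 := b t (by linarith)
  have b2 := b t0 (by linarith)
  have b3 : dist (y (wfd n t)) (y (wfd n t0)) ≤ M * (9 / 10 : ℝ) ^ n := by
    rcases le_total t t0 with h | h
    · exact wfgood_close hM (by linarith) h n (by linarith)
    · rw [dist_comm]; exact wfgood_close hM (by linarith) h n (by linarith)
  have := dist_triangle4 (g t) (y (wfd n t)) (y (wfd n t0)) (g t0)
  rw [dist_comm (g t) (y (wfd n t))] at this
  have e : M * (9/10:ℝ) ^ n / (1 - 9/10) = 10 * (M * (9/10:ℝ) ^ n) := by norm_num; ring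
  rw [e] at b1 b2
  linarith

lemma WFDyadic.ae_good {s σ A : ℝ} {α : Measure ℝ} (W : WFDyadic s σ A α) :
    ∀ᵐ ω ∂W.P, WFGood (fun q => W.Y q ω) := by
  unfold WFGood
  rw [ae_all_iff]
  intro N
  set C := 40 * A ^ 4 * (5 * A ^ 2 + 1) with hC
  have hC0 : 0 ≤ C := by positivity
  let Δ : ℕ → ℕ → W.Ω → ℝ := fun n k ω => W.Y ((k + 1 : ℕ) / 2 ^ n) ω - W.Y ((k : ℕ) / 2 ^ n) ω
  have hΔm : ∀ n k, Measurable (Δ n k) := fun n k => (W.measY _).sub (W.measY _)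
  have hΔb : ∀ n k ω, |Δ n k ω| ≤ 1 := by
    intro n k ω
    have h1 := W.Y01 ((k + 1 : ℕ) / 2 ^ n) ω
    have h2 := W.Y01 ((k : ℕ) / 2 ^ n) ω
    rw [abs_le]; constructor <;> simp only [Δ] <;> linarith [h1.1, h1.2, h2.1, h2.2]
  have hI : ∀ n k, ∫⁻ ω, ENNReal.ofReal (Δ n k ω ^ 4) ∂W.P ≤ ENNReal.ofReal (C * (1 / 4) ^ n) := by
    intro n k
    rw [← ofReal_integral_eq_lintegral_ofReal]
    · apply ENNReal.ofReal_le_ofReal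
      have hle : ((k : ℕ) : ℚ) / 2 ^ n ≤ ((k + 1 : ℕ) : ℚ) / 2 ^ n := by
        gcongr; omega
      refine (W.four (((k : ℕ) : ℚ) / 2 ^ n) (((k + 1 : ℕ) : ℚ) / 2 ^ n) ⟨n, k, rfl⟩ ⟨n, k + 1, rfl⟩ hle).trans ?_
      rw [← hC]
      apply le_of_eq
      congr 1
      push_cast
      rw [← sub_div, add_sub_cancel_left, div_pow, ← pow_mul, mul_comm n 2, pow_mul, div_pow]
      norm_num
    · refine Integrable.of_bound ((hΔm n k).pow_const 4).aestronglyMeasurable 1 (ae_of_all _ fun ω => ?_)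
      rw [norm_pow, Real.norm_eq_abs]
      exact pow_le_one₀ (abs_nonneg _) (hΔb n k ω)
    · exact ae_of_all _ fun ω => by positivity
  let S : W.Ω → ℝ≥0∞ := fun ω => ∑' n : ℕ, ENNReal.ofReal ((10/9) ^ (4 * n)) *
    ∑ k ∈ Finset.range (N * 2 ^ n), ENNReal.ofReal (Δ n k ω ^ 4)
  have hSm : ∀ n k, Measurable (fun ω => ENNReal.ofReal (Δ n k ω ^ 4)) := fun n k =>
    ((hΔm n k).pow_const 4).ennreal_ofReal
  have hSn : ∀ n, Measurable (fun ω => ENNReal.ofReal ((10/9) ^ (4 * n)) *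
    ∑ k ∈ Finset.range (N * 2 ^ n), ENNReal.ofReal (Δ n k ω ^ 4)) := fun n =>
    (Finset.measurable_fun_sum _ fun k _ => hSm n k).const_mul _
  have hS : ∫⁻ ω, S ω ∂W.P ≠ ⊤ := by
    simp only [S]
    rw [lintegral_tsum fun n => (hSn n).aemeasurable]
    have hle : ∀ n : ℕ, ∫⁻ ω, ENNReal.ofReal ((10/9) ^ (4 * n)) *
        ∑ k ∈ Finset.range (N * 2 ^ n), ENNReal.ofReal (Δ n k ω ^ 4) ∂W.P
        ≤ ENNReal.ofReal (C * N * (5000/6561) ^ n) := by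
      intro n
      rw [lintegral_const_mul _ (Finset.measurable_fun_sum _ fun k _ => hSm n k),
        lintegral_finsetSum _ fun k _ => hSm n k]
      calc _ ≤ ENNReal.ofReal ((10/9) ^ (4 * n)) *
            ∑ k ∈ Finset.range (N * 2 ^ n), ENNReal.ofReal (C * (1 / 4) ^ n) := by
            gcongr with k hk; exact hI n k
        _ = ENNReal.ofReal (C * N * (5000/6561) ^ n) := by
            rw [Finset.sum_const, Finset.card_range, nsmul_eq_mul, ← ENNReal.ofReal_natCast,
              ← ENNReal.ofReal_mul (by positivity), ← ENNReal.ofReal_mul (by positivity)]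
            congr 1
            push_cast
            have : (5000/6561 : ℝ) ^ n = (10/9) ^ (4 * n) * 2 ^ n * (1/4) ^ n := by
              rw [pow_mul, ← mul_pow, ← mul_pow]; norm_num
            rw [this]; ring
    refine ne_top_of_le_ne_top ?_ (ENNReal.tsum_le_tsum hle)
    have hsum : Summable fun n : ℕ => C * N * (5000/6561 : ℝ) ^ n :=
      (summable_geometric_of_lt_one (by norm_num) (by norm_num)).mul_left _
    exact hsum.tsum_ofReal_ne_top
  have hSmeas : Measurable S := Measurable.tsum hSn
  filter_upwards [ae_lt_top hSmeas hS] with ω hω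
  obtain ⟨M, hM⟩ := exists_nat_gt ((S ω).toReal)
  refine ⟨M + 1, fun n k hk => ?_⟩
  have h1 : ENNReal.ofReal ((10/9) ^ (4 * n)) * ENNReal.ofReal (Δ n k ω ^ 4) ≤ S ω := by
    refine le_trans ?_ (ENNReal.le_tsum n)
    gcongr
    exact Finset.single_le_sum (f := fun k => ENNReal.ofReal (Δ n k ω ^ 4)) (fun _ _ => zero_le)
      (Finset.mem_range.2 hk)
  rw [← ENNReal.ofReal_mul (by positivity)] at h1
  have h2 : (10/9) ^ (4 * n) * Δ n k ω ^ 4 ≤ (S ω).toReal := by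
    have := ENNReal.toReal_mono hω.ne h1
    rwa [ENNReal.toReal_ofReal (by positivity)] at this
  have h3 : ((10/9) ^ n * |Δ n k ω|) ^ 4 ≤ ((M:ℝ) + 1) ^ 4 := by
    have e : ((10/9) ^ n * |Δ n k ω|) ^ 4 = (10/9) ^ (4 * n) * Δ n k ω ^ 4 := by
      rw [mul_pow, ← pow_mul, mul_comm n 4]
      congr 1
      exact Even.pow_abs (by decide) _
    rw [e]
    have : (M:ℝ) + 1 ≤ ((M:ℝ) + 1) ^ 4 := le_self_pow₀ (by linarith [Nat.cast_nonneg (α := ℝ) M]) (by norm_num)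
    linarith
  have h4 : (10/9) ^ n * |Δ n k ω| ≤ (M:ℝ) + 1 :=
    le_of_pow_le_pow_left₀ (by norm_num) (by positivity) h3
  have h5 : |Δ n k ω| = (9/10) ^ n * ((10/9) ^ n * |Δ n k ω|) := by
    rw [← mul_assoc, ← mul_pow]; norm_num
  show |Δ n k ω| ≤ _
  rw [h5, mul_comm]
  push_cast
  gcongr

structure WFCont (s σ A : ℝ) (α : Measure ℝ) where
  (Ω : Type)
  [mΩ : MeasurableSpace Ω]
  (P : Measure Ω)
  (probP : IsProbabilityMeasure P)
  (X : ℝ → Ω → ℝ)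
  (measX : ∀ t, Measurable (X t))
  (contX : ∀ ω, Continuous fun t => X t ω)
  (preZero : ∀ t ≤ (0:ℝ), X t = X 0)
  (range01 : ∀ t ω, X t ω ∈ Icc (0:ℝ) 1)
  (law : P.map (X 0) = α)
  (hA : 1 ≤ A)
  (four : ∀ p q : ℝ, 0 ≤ p → p ≤ q →
    ∫ ω, (X q ω - X p ω) ^ 4 ∂P ≤ 40 * A ^ 4 * (5 * A ^ 2 + 1) * (q - p) ^ 2)
  (first : ∀ (n : ℕ) (u : Fin n → ℝ) (p q : ℝ) (Φ : (Fin n → ℝ) → ℝ) (B ε : ℝ),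
    0 ≤ B → 0 < ε → (∀ i, u i ≤ p) → 0 ≤ p → p ≤ q →
    Continuous Φ → (∀ v, |Φ v| ≤ B) →
    |∫ ω, Φ (fun i => X (u i) ω) * (X q ω - X p ω + s * (q - p) * (X p ω * (1 - X p ω))) ∂P|
      ≤ B * (3 * A ^ 2) * (ε * (q - p) + (5 * A ^ 2 / ε + 1) * (q - p) ^ 2))
  (second : ∀ (n : ℕ) (u : Fin n → ℝ) (p q : ℝ) (Φ : (Fin n → ℝ) → ℝ) (B ε : ℝ),
    0 ≤ B → 0 < ε → (∀ i, u i ≤ p) → 0 ≤ p → p ≤ q →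
    Continuous Φ → (∀ v, |Φ v| ≤ B) →
    |∫ ω, Φ (fun i => X (u i) ω) * ((X q ω - X p ω) ^ 2 - σ ^ 2 * (q - p) * (X p ω * (1 - X p ω))) ∂P|
      ≤ B * (3 * A ^ 2) * (ε * (q - p) + (5 * A ^ 2 / ε + 1) * (q - p) ^ 2))

attribute [instance] WFCont.mΩ WFCont.probP

lemma wfcont_of_dyadic {s σ A : ℝ} {α : Measure ℝ} (W : WFDyadic s σ A α) :
    Nonempty (WFCont s σ A α) := by
  classical
  let Good : Set W.Ω := {ω | WFGood (fun q => W.Y q ω)}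
  have hGm : MeasurableSet Good := by
    have : Good = ⋂ N : ℕ, ⋃ M : ℕ, ⋂ n : ℕ, ⋂ k : ℕ, ⋂ _ : k < N * 2 ^ n,
        {ω | |W.Y ((k + 1 : ℕ) / 2 ^ n) ω - W.Y ((k : ℕ) / 2 ^ n) ω| ≤ M * (9 / 10 : ℝ) ^ n} := by
      ext ω; simp only [Good, WFGood, mem_ofPred_eq, mem_iInter, mem_iUnion]
    rw [this]
    refine MeasurableSet.iInter fun N => MeasurableSet.iUnion fun M => MeasurableSet.iInter fun n =>
      MeasurableSet.iInter fun k => MeasurableSet.iInter fun _ => ?_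
    exact measurableSet_le (((W.measY _).sub (W.measY _)).abs) measurable_const
  have hex : ∀ ω, ∃ g : ℝ → ℝ, Continuous g ∧ ∀ t, Tendsto
      (fun n => if ω ∈ Good then W.Y (wfd n t) ω else W.Y 0 ω) atTop (𝓝 (g t)) := by
    intro ω
    by_cases h : ω ∈ Good
    · simp only [h, if_true]; exact wfgood_lim (y := fun q => W.Y q ω) h
    · simp only [h, if_false]; exact ⟨fun _ => W.Y 0 ω, continuous_const, fun _ => tendsto_const_nhds⟩
  choose X0 hX0c hX0l using hex
  let X : ℝ → W.Ω → ℝ := fun t ω => X0 ω t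
  have hmX : ∀ t, Measurable (X t) := by
    intro t
    refine measurable_of_tendsto_metrizable (f := fun n ω => if ω ∈ Good then W.Y (wfd n t) ω else W.Y 0 ω)
      (fun n => Measurable.ite hGm (W.measY _) (W.measY _)) ?_
    rw [tendsto_pi_nhds]
    exact fun ω => hX0l ω t
  have hae : ∀ᵐ ω ∂W.P, ∀ t, Tendsto (fun n => W.Y (wfd n t) ω) atTop (𝓝 (X t ω)) := by
    filter_upwards [W.ae_good] with ω hω t
    have := hX0l ω t
    have h : ω ∈ Good := hω
    simpa only [h, if_true] using this
  have h01 : ∀ t ω, X t ω ∈ Icc (0:ℝ) 1 := by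
    intro t ω
    refine isClosed_Icc.mem_of_tendsto (hX0l ω t) (Eventually.of_forall fun n => ?_)
    split_ifs
    · exact W.Y01 _ _
    · exact W.Y01 _ _
  have hX00 : X 0 = W.Y 0 := by
    ext ω
    refine tendsto_nhds_unique (hX0l ω 0) (tendsto_const_nhds.congr fun n => ?_)
    rw [wfd_nonpos n le_rfl, ite_self]
  -- generic passage to the limit
  have pass : ∀ (n : ℕ) (u : Fin n → ℝ) (p q : ℝ) (H : ℝ → (Fin n → ℝ) → ℝ → ℝ → ℝ) (C : ℝ),
      0 ≤ p → p ≤ q →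
      Continuous (fun z : ℝ × (Fin n → ℝ) × ℝ × ℝ => H z.1 z.2.1 z.2.2.1 z.2.2.2) →
      (∀ a v x y, |a| ≤ q + 1 → x ∈ Icc (0:ℝ) 1 → y ∈ Icc (0:ℝ) 1 → |H a v x y| ≤ C) →
      Tendsto (fun k => ∫ ω, H ((wfd k q : ℝ) - wfd k p) (fun i => W.Y (wfd k (u i)) ω)
        (W.Y (wfd k p) ω) (W.Y (wfd k q) ω) ∂W.P) atTop
        (𝓝 (∫ ω, H (q - p) (fun i => X (u i) ω) (X p ω) (X q ω) ∂W.P)) := by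
    intro n u p q H C hp hpq hH hC
    have ht : Tendsto (fun k => (wfd k q : ℝ) - wfd k p) atTop (𝓝 (q - p)) :=
      (wfd_tendsto (hp.trans hpq)).sub (wfd_tendsto hp)
    have hle : ∀ᶠ k in atTop, |(wfd k q : ℝ) - wfd k p| ≤ q + 1 := by
      have h2 : |q - p| < q + 1 := by rw [abs_of_nonneg (by linarith)]; linarith
      filter_upwards [(tendsto_order.1 ht.abs).2 _ h2] with k hk using hk.le
    refine tendsto_integral_filter_of_dominated_convergence (fun _ => C) ?_ ?_ (integrable_const _) ?_
    · refine Eventually.of_forall fun k => Measurable.aestronglyMeasurable ?_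
      have : Measurable (fun ω => (((wfd k q : ℝ) - wfd k p), (fun i => W.Y (wfd k (u i)) ω),
          W.Y (wfd k p) ω, W.Y (wfd k q) ω)) :=
        measurable_const.prodMk ((measurable_pi_lambda _ fun i => W.measY _).prodMk
          ((W.measY _).prodMk (W.measY _)))
      exact hH.measurable.comp this
    · filter_upwards [hle] with k hk
      exact ae_of_all _ fun ω => hC _ _ _ _ hk (W.Y01 _ _) (W.Y01 _ _)
    · filter_upwards [hae] with ω hω
      have h3 : Tendsto (fun k => (((wfd k q : ℝ) - wfd k p), (fun i => W.Y (wfd k (u i)) ω),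
          W.Y (wfd k p) ω, W.Y (wfd k q) ω)) atTop
          (𝓝 ((q - p), (fun i => X (u i) ω), X p ω, X q ω)) :=
        ht.prodMk_nhds ((tendsto_pi_nhds.2 fun i => hω (u i)).prodMk_nhds ((hω p).prodMk_nhds (hω q)))
      exact (hH.tendsto _).comp h3
  have tdiff : ∀ p q : ℝ, 0 ≤ p → p ≤ q → Tendsto (fun k => (wfd k q : ℝ) - wfd k p) atTop (𝓝 (q - p)) :=
    fun p q hp hpq => (wfd_tendsto (hp.trans hpq)).sub (wfd_tendsto hp)
  have hd1 : ∀ x y : ℝ, x ∈ Icc (0:ℝ) 1 → y ∈ Icc (0:ℝ) 1 → |y - x| ≤ 1 := by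
    intro x y hx hy
    rw [abs_le]; constructor <;> linarith [hx.1, hx.2, hy.1, hy.2]
  have hd2 : ∀ x : ℝ, x ∈ Icc (0:ℝ) 1 → |x * (1 - x)| ≤ 1 := by
    intro x hx
    rw [abs_le]; constructor <;> nlinarith [hx.1, hx.2]
  refine ⟨{ Ω := W.Ω, P := W.P, probP := inferInstance, X := X, measX := hmX, contX := hX0c
            preZero := ?_, range01 := h01, law := by rw [hX00]; exact W.law
            hA := W.hA, four := ?_, first := ?_, second := ?_ }⟩
  · intro t ht
    ext ω
    refine tendsto_nhds_unique (hX0l ω t) ((hX0l ω 0).congr fun n => ?_)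
    rw [wfd_nonpos n le_rfl, wfd_nonpos n ht]
  · intro p q hp hpq
    refine le_of_tendsto_of_tendsto' (pass 0 (fun i => i.elim0) p q (fun a v x y => (y - x) ^ 4) 1 hp hpq
      (by fun_prop) ?_) (((tdiff p q hp hpq).pow 2).const_mul _)
      (fun k => W.four _ _ (wfd_dy k p) (wfd_dy k q) (wfd_mono k hpq))
    intro a v x y _ hx hy
    rw [abs_pow]; exact pow_le_one₀ (abs_nonneg _) (hd1 x y hx hy)
  · intro n u p q Φ B ε hB hε hu hp hpq hΦ hΦB
    refine le_of_tendsto_of_tendsto' (pass n u p q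
      (fun a v x y => Φ v * (y - x + s * a * (x * (1 - x)))) (B * (1 + |s| * (q + 1) * 1)) hp hpq
      (by fun_prop) ?_).abs ((((tdiff p q hp hpq).const_mul ε).add
        (((tdiff p q hp hpq).pow 2).const_mul (5 * A ^ 2 / ε + 1))).const_mul (B * (3 * A ^ 2)))
      (fun k => W.first n (fun i => wfd k (u i)) _ _ Φ B ε hB hε (fun i => wfd_dy _ _)
        (fun i => wfd_mono k (hu i)) (wfd_dy k p) (wfd_dy k q) (wfd_mono k hpq) hΦ hΦB)
    intro a v x y ha hx hy
    rw [abs_mul]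
    refine mul_le_mul (hΦB v) ?_ (abs_nonneg _) hB
    refine (abs_add_le _ _).trans ?_
    rw [abs_mul, abs_mul]
    gcongr
    · exact hd1 x y hx hy
    · exact mul_nonneg (abs_nonneg _) (by linarith)
    · exact hd2 x hx
  · intro n u p q Φ B ε hB hε hu hp hpq hΦ hΦB
    refine le_of_tendsto_of_tendsto' (pass n u p q
      (fun a v x y => Φ v * ((y - x) ^ 2 - σ ^ 2 * a * (x * (1 - x)))) (B * (1 + |σ ^ 2| * (q + 1) * 1)) hp hpq
      (by fun_prop) ?_).abs ((((tdiff p q hp hpq).const_mul ε).add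
        (((tdiff p q hp hpq).pow 2).const_mul (5 * A ^ 2 / ε + 1))).const_mul (B * (3 * A ^ 2)))
      (fun k => W.second n (fun i => wfd k (u i)) _ _ Φ B ε hB hε (fun i => wfd_dy _ _)
        (fun i => wfd_mono k (hu i)) (wfd_dy k p) (wfd_dy k q) (wfd_mono k hpq) hΦ hΦB)
    intro a v x y ha hx hy
    rw [abs_mul]
    refine mul_le_mul (hΦB v) ?_ (abs_nonneg _) hB
    refine (abs_sub _ _).trans ?_
    rw [abs_mul, abs_mul, abs_pow]
    gcongr
    · exact pow_le_one₀ (abs_nonneg _) (hd1 x y hx hy)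
    · exact mul_nonneg (abs_nonneg _) (by linarith)
    · exact hd2 x hx

lemma wf_c2 {f : ℝ → ℝ} (hf : ContDiff ℝ 2 f) : (∀ x, HasDerivAt f (deriv f x) x) ∧
    (∀ x, HasDerivAt (deriv f) (deriv (deriv f) x) x) ∧ Continuous f ∧ Continuous (deriv f) ∧
    Continuous (deriv (deriv f)) := by
  have h2 : ContDiff ℝ (1 + 1) f := by simpa [one_add_one_eq_two] using hf
  have h1 := (contDiff_succ_iff_deriv.1 h2)
  have h1' : ContDiff ℝ 1 (deriv f) := h1.2.2
  have h0 : ContDiff ℝ (0 + 1) (deriv f) := by simpa using h1'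
  have h0' := contDiff_succ_iff_deriv.1 h0
  exact ⟨fun x => (h1.1 x).hasDerivAt, fun x => (h0'.1 x).hasDerivAt, hf.continuous, h1'.continuous,
    h0'.2.2.continuous⟩

lemma wf_taylor0 {f : ℝ → ℝ} (hf : ContDiff ℝ 2 f) {x y η : ℝ}
    (hη : ∀ z ∈ segment ℝ x y, |deriv (deriv f) z - deriv (deriv f) x| ≤ η) :
    |f y - f x - deriv f x * (y - x) - deriv (deriv f) x / 2 * (y - x) ^ 2| ≤ η * (y - x) ^ 2 := by
  obtain ⟨h1, h2, -, -, -⟩ := wf_c2 hf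
  set a := deriv (deriv f) x with ha
  have hη0 : 0 ≤ η := (abs_nonneg _).trans (hη x (left_mem_segment ℝ x y))
  have s1 : ∀ z ∈ segment ℝ x y, |deriv f z - deriv f x - a * (z - x)| ≤ η * |y - x| := by
    intro z hz
    have := Convex.norm_image_sub_le_of_norm_hasDerivWithin_le (𝕜 := ℝ) (s := segment ℝ x y)
      (f := fun z => deriv f z - a * z) (f' := fun z => deriv (deriv f) z - a * 1) (C := η) (x := x) (y := z)
      (fun w hw => ((h2 w).sub ((hasDerivAt_id w).const_mul a)).hasDerivWithinAt)
      (fun w hw => by simpa using hη w hw) (convex_segment x y) (left_mem_segment ℝ x y) hz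
    simp only [Real.norm_eq_abs] at this
    have hzx : |z - x| ≤ |y - x| := by
      have := abs_sub_left_of_mem_uIcc (segment_eq_uIcc x y ▸ hz)
      exact this
    calc _ = |deriv f z - a * z - (deriv f x - a * x)| := by congr 1; ring
      _ ≤ η * |z - x| := this
      _ ≤ _ := by gcongr
  have := Convex.norm_image_sub_le_of_norm_hasDerivWithin_le (𝕜 := ℝ) (s := segment ℝ x y)
      (f := fun z => f z - deriv f x * (z - x) - a / 2 * (z - x) ^ 2)
      (f' := fun z => deriv f z - deriv f x * 1 - a / 2 * (((2:ℕ):ℝ) * (z - x) ^ (2 - 1) * 1))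
      (C := η * |y - x|) (x := x) (y := y)
      (fun w hw => (((h1 w).sub (((hasDerivAt_id w).sub_const x).const_mul _)).sub
        ((((hasDerivAt_id w).sub_const x).pow 2).const_mul _)).hasDerivWithinAt)
      (fun w hw => by
        have := s1 w hw
        rw [Real.norm_eq_abs]
        convert this using 2
        push_cast; ring) (convex_segment x y) (left_mem_segment ℝ x y) (right_mem_segment ℝ x y)
  simp only [Real.norm_eq_abs] at this
  calc _ = |f y - deriv f x * (y - x) - a / 2 * (y - x) ^ 2 -
        (f x - deriv f x * (x - x) - a / 2 * (x - x) ^ 2)| := by congr 1; ring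
    _ ≤ η * |y - x| * |y - x| := this
    _ = η * (y - x) ^ 2 := by rw [mul_assoc, ← sq, sq_abs]

lemma wf_taylor {f : ℝ → ℝ} (hf : ContDiff ℝ 2 f) {ε : ℝ} (hε : 0 < ε) :
    ∃ C : ℝ, 0 ≤ C ∧ ∀ x ∈ Icc (0:ℝ) 1, ∀ y ∈ Icc (0:ℝ) 1,
      |f y - f x - deriv f x * (y - x) - deriv (deriv f) x / 2 * (y - x) ^ 2|
        ≤ ε * (y - x) ^ 2 + C * (y - x) ^ 4 := by
  obtain ⟨h1, h2, -, -, hc⟩ := wf_c2 hf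
  obtain ⟨M, hM⟩ := isCompact_Icc.exists_bound_of_continuousOn (s := Icc (0:ℝ) 1) hc.continuousOn
  have hM0 : 0 ≤ M := (norm_nonneg _).trans (hM 0 ⟨le_rfl, zero_le_one⟩)
  have huc := isCompact_Icc.uniformContinuousOn_of_continuous (s := Icc (0:ℝ) 1) hc.continuousOn
  obtain ⟨δ, hδ, hd⟩ := Metric.uniformContinuousOn_iff.1 huc ε hε
  refine ⟨2 * M / δ ^ 2, by positivity, fun x hx y hy => ?_⟩
  have hseg : segment ℝ x y ⊆ Icc 0 1 := (convex_Icc 0 1).segment_subset hx hy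
  by_cases hxy : |y - x| < δ
  · have := wf_taylor0 hf (x := x) (y := y) (η := ε) (fun z hz => by
      have hzx : |z - x| ≤ |y - x| := abs_sub_left_of_mem_uIcc (segment_eq_uIcc x y ▸ hz)
      exact (hd z (hseg hz) x hx (hzx.trans_lt hxy)).le)
    have : 0 ≤ 2 * M / δ ^ 2 * (y - x) ^ 4 := by positivity
    linarith
  · have := wf_taylor0 hf (x := x) (y := y) (η := 2 * M) (fun z hz => by
      have a1 := hM z (hseg hz)
      have a2 := hM x hx
      rw [Real.norm_eq_abs] at a1 a2
      exact (abs_sub _ _).trans (by linarith))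
    have h3 : δ ^ 2 ≤ (y - x) ^ 2 := by
      rw [← sq_abs (y - x)]
      exact pow_le_pow_left₀ hδ.le (not_lt.1 hxy) 2
    have h4 : 2 * M * (y - x) ^ 2 ≤ 2 * M / δ ^ 2 * (y - x) ^ 4 := by
      rw [div_mul_eq_mul_div, le_div_iff₀ (by positivity)]
      have : 0 ≤ 2 * M * (y - x) ^ 2 := by positivity
      nlinarith
    have : 0 ≤ ε * (y - x) ^ 2 := by positivity
    linarith

lemma wf_LWF_cont {s σ : ℝ} {f : ℝ → ℝ} (hf : ContDiff ℝ 2 f) : Continuous (LWF s σ f) := by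
  obtain ⟨-, -, h0, h1, h2⟩ := wf_c2 hf
  unfold LWF
  fun_prop

lemma wf_bdd01 {g : ℝ → ℝ} (hg : Continuous g) : ∃ M, 0 ≤ M ∧ ∀ x ∈ Icc (0:ℝ) 1, |g x| ≤ M := by
  obtain ⟨M, hM⟩ := isCompact_Icc.exists_bound_of_continuousOn (s := Icc (0:ℝ) 1) hg.continuousOn
  exact ⟨M, (norm_nonneg _).trans (hM 0 ⟨le_rfl, zero_le_one⟩), hM⟩

def wfcl (x : ℝ) : ℝ := max 0 (min 1 x)

lemma wfcl_mem (x : ℝ) : wfcl x ∈ Icc (0:ℝ) 1 := by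
  unfold wfcl; constructor
  · exact le_max_left _ _
  · exact max_le zero_le_one (min_le_left _ _)

lemma wfcl_of_mem {x : ℝ} (hx : x ∈ Icc (0:ℝ) 1) : wfcl x = x := by
  unfold wfcl; rw [min_eq_right hx.2, max_eq_right hx.1]

lemma wfcl_cont : Continuous wfcl := by unfold wfcl; fun_prop

namespace WFCont

variable {s σ A : ℝ} {α : Measure ℝ} (W : WFCont s σ A α)

lemma intg {n : ℕ} (u : Fin n → ℝ) (p q : ℝ) {Φ : (Fin n → ℝ) → ℝ} {B : ℝ} (hΦ : Continuous Φ)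
    (hB : ∀ v, |Φ v| ≤ B) (H : ℝ → ℝ → ℝ) (hH : Continuous (fun z : ℝ × ℝ => H z.1 z.2)) :
    Integrable (fun ω => Φ (fun i => W.X (u i) ω) * H (W.X p ω) (W.X q ω)) W.P := by
  obtain ⟨M, hM⟩ := (isCompact_Icc.prod isCompact_Icc).exists_bound_of_continuousOn
    (s := Icc (0:ℝ) 1 ×ˢ Icc (0:ℝ) 1) hH.continuousOn
  refine Integrable.of_bound (Measurable.aestronglyMeasurable ?_) (B * M) (ae_of_all _ fun ω => ?_)
  · exact (hΦ.measurable.comp (measurable_pi_lambda _ fun i => W.measX _)).mul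
      (hH.measurable.comp ((W.measX p).prodMk (W.measX q)))
  · rw [norm_mul]
    have := hM (W.X p ω, W.X q ω) ⟨W.range01 _ _, W.range01 _ _⟩
    exact mul_le_mul (hB _) this (norm_nonneg _) ((abs_nonneg _).trans (hB 0))

lemma sec {p q : ℝ} (hp : 0 ≤ p) (hpq : p ≤ q) :
    ∫ ω, (W.X q ω - W.X p ω) ^ 2 ∂W.P
      ≤ (σ ^ 2 + 3 * A ^ 2) * (q - p) + 3 * A ^ 2 * (5 * A ^ 2 + 1) * (q - p) ^ 2 := by
  have h := W.second 0 (fun i => i.elim0) p q (fun _ => 1) 1 1 zero_le_one one_pos (fun i => i.elim0) hp hpq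
    continuous_const (fun _ => by simp)
  simp only [one_mul] at h
  have i1 := W.intg (n := 0) (fun i => i.elim0) p q (Φ := fun _ => 1) (B := 1) continuous_const
    (fun _ => by simp) (fun x y => (y - x) ^ 2) (by fun_prop)
  have i2 := W.intg (n := 0) (fun i => i.elim0) p q (Φ := fun _ => 1) (B := 1) continuous_const
    (fun _ => by simp) (fun x y => σ ^ 2 * (q - p) * (x * (1 - x))) (by fun_prop)
  simp only [one_mul] at i1 i2
  rw [integral_sub i1 i2] at h
  have h2 : ∫ ω, σ ^ 2 * (q - p) * (W.X p ω * (1 - W.X p ω)) ∂W.P ≤ ∫ ω, σ ^ 2 * (q - p) ∂W.P := by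
    refine integral_mono i2 (integrable_const _) fun ω => ?_
    have hx := W.range01 p ω
    have : W.X p ω * (1 - W.X p ω) ≤ 1 := by nlinarith [hx.1, hx.2]
    have h0 : 0 ≤ σ ^ 2 * (q - p) := mul_nonneg (sq_nonneg _) (by linarith)
    nlinarith
  rw [integral_const, probReal_univ, one_smul] at h2
  have := (abs_le.1 h).2
  simp only [div_one] at this
  linarith

lemma infini {f : ℝ → ℝ} (hf : ContDiff ℝ 2 f) {n : ℕ} {Φ : (Fin n → ℝ) → ℝ} {B : ℝ} (hΦ : Continuous Φ)
    (hB : ∀ v, |Φ v| ≤ B) : ∃ D, 0 ≤ D ∧ ∀ ε, 0 < ε → ∃ K, 0 ≤ K ∧ ∀ (u : Fin n → ℝ) (p q : ℝ),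
      (∀ i, u i ≤ p) → 0 ≤ p → p ≤ q →
      |∫ ω, Φ (fun i => W.X (u i) ω) * (f (W.X q ω) - f (W.X p ω) - (q - p) * LWF s σ f (W.X p ω)) ∂W.P|
        ≤ D * (ε * (q - p)) + K * (q - p) ^ 2 := by
  obtain ⟨-, -, c0, c1, c2⟩ := wf_c2 hf
  obtain ⟨M1, hM1, b1⟩ := wf_bdd01 c1
  obtain ⟨M2, hM2, b2⟩ := wf_bdd01 c2
  have hB0 : 0 ≤ B := (abs_nonneg _).trans (hB 0)
  refine ⟨B * M1 * (3 * A ^ 2) + B * M2 * (3 * A ^ 2) + B * (σ ^ 2 + 3 * A ^ 2), by positivity, ?_⟩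
  intro ε hε
  obtain ⟨C, hC, htay⟩ := wf_taylor hf hε
  refine ⟨B * M1 * (3 * A ^ 2) * (5 * A ^ 2 / ε + 1) + B * M2 * (3 * A ^ 2) * (5 * A ^ 2 / ε + 1)
    + B * (ε * (3 * A ^ 2 * (5 * A ^ 2 + 1)) + C * (40 * A ^ 4 * (5 * A ^ 2 + 1))), by positivity, ?_⟩
  intro u p q hu hp hpq
  have hd : 0 ≤ q - p := by linarith
  -- enlarged test functions
  have mk : ∀ g : ℝ → ℝ, Continuous g → ∀ M, 0 ≤ M → (∀ x ∈ Icc (0:ℝ) 1, |g x| ≤ M) →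
      Continuous (fun v : Fin (n + 1) → ℝ => Φ (fun i => v i.succ) * g (wfcl (v 0))) ∧
      ∀ v : Fin (n + 1) → ℝ, |Φ (fun i => v i.succ) * g (wfcl (v 0))| ≤ B * M := by
    intro g hg M hM hb
    constructor
    · have := wfcl_cont
      have h2 : Continuous (fun v : Fin (n + 1) → ℝ => Φ (fun i => v i.succ)) :=
        hΦ.comp (continuous_pi fun i => continuous_apply _)
      fun_prop
    · intro v
      rw [abs_mul]
      exact mul_le_mul (hB _) (hb _ (wfcl_mem _)) (abs_nonneg _) hB0
  let u' : Fin (n + 1) → ℝ := Fin.cons p u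
  have hu' : ∀ i, u' i ≤ p := by
    intro i; refine Fin.cases ?_ (fun j => ?_) i
    · simp [u']
    · simpa [u'] using hu j
  have e1 := W.first (n + 1) u' p q _ (B * M1) ε (by positivity) hε hu' hp hpq (mk _ c1 M1 hM1 b1).1
    (mk _ c1 M1 hM1 b1).2
  have e2 := W.second (n + 1) u' p q _ (B * M2) ε (by positivity) hε hu' hp hpq (mk _ c2 M2 hM2 b2).1
    (mk _ c2 M2 hM2 b2).2
  simp only [u', Fin.cons_succ, Fin.cons_zero, wfcl_of_mem (W.range01 _ _)] at e1 e2
  have e3 : |∫ ω, Φ (fun i => W.X (u i) ω) * (f (W.X q ω) - f (W.X p ω) - deriv f (W.X p ω) * (W.X q ω - W.X p ω)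
      - deriv (deriv f) (W.X p ω) / 2 * (W.X q ω - W.X p ω) ^ 2) ∂W.P|
      ≤ B * (ε * ((σ ^ 2 + 3 * A ^ 2) * (q - p) + 3 * A ^ 2 * (5 * A ^ 2 + 1) * (q - p) ^ 2)
        + C * (40 * A ^ 4 * (5 * A ^ 2 + 1) * (q - p) ^ 2)) := by
    have i1 := W.intg (n := 0) (fun i => i.elim0) p q (Φ := fun _ => 1) (B := 1) continuous_const
      (fun _ => by simp) (fun x y => (y - x) ^ 2) (by fun_prop)
    have i2 := W.intg (n := 0) (fun i => i.elim0) p q (Φ := fun _ => 1) (B := 1) continuous_const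
      (fun _ => by simp) (fun x y => (y - x) ^ 4) (by fun_prop)
    simp only [one_mul] at i1 i2
    have h4 := W.four p q hp hpq
    have h2 := W.sec hp hpq
    have i3 : Integrable (fun ω => B * (ε * (W.X q ω - W.X p ω) ^ 2 + C * (W.X q ω - W.X p ω) ^ 4)) W.P :=
      ((i1.const_mul ε).add (i2.const_mul C)).const_mul B
    rw [← Real.norm_eq_abs]
    refine (norm_integral_le_of_norm_le i3 (ae_of_all _ fun ω => ?_)).trans ?_
    · rw [norm_mul]
      exact mul_le_mul (hB _) (htay _ (W.range01 _ _) _ (W.range01 _ _)) (norm_nonneg _) hB0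
    · rw [integral_const_mul, integral_add (i1.const_mul ε) (i2.const_mul C), integral_const_mul,
        integral_const_mul]
      gcongr
  have j1 := W.intg u p q hΦ hB (fun x y => deriv f x * (y - x + s * (q - p) * (x * (1 - x)))) (by fun_prop)
  have j2 := W.intg u p q hΦ hB (fun x y => deriv (deriv f) x * ((y - x) ^ 2 - σ ^ 2 * (q - p) * (x * (1 - x)))) (by fun_prop)
  have j3 := W.intg u p q hΦ hB (fun x y => f y - f x - deriv f x * (y - x) - deriv (deriv f) x / 2 * (y - x) ^ 2) (by fun_prop)
  have hsum : ∫ ω, Φ (fun i => W.X (u i) ω) * (f (W.X q ω) - f (W.X p ω) - (q - p) * LWF s σ f (W.X p ω)) ∂W.P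
      = (∫ ω, Φ (fun i => W.X (u i) ω) * deriv f (W.X p ω) * (W.X q ω - W.X p ω + s * (q - p) * (W.X p ω * (1 - W.X p ω))) ∂W.P)
      + 1 / 2 * (∫ ω, Φ (fun i => W.X (u i) ω) * deriv (deriv f) (W.X p ω) * ((W.X q ω - W.X p ω) ^ 2 - σ ^ 2 * (q - p) * (W.X p ω * (1 - W.X p ω))) ∂W.P)
      + ∫ ω, Φ (fun i => W.X (u i) ω) * (f (W.X q ω) - f (W.X p ω) - deriv f (W.X p ω) * (W.X q ω - W.X p ω)
      - deriv (deriv f) (W.X p ω) / 2 * (W.X q ω - W.X p ω) ^ 2) ∂W.P := by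
    simp only [mul_assoc] at j1 j2 ⊢
    rw [← integral_const_mul, ← integral_add j1 (j2.const_mul _)]
    refine Eq.trans ?_ (integral_add (j1.add (j2.const_mul (1 / 2))) j3)
    refine integral_congr_ae (ae_of_all _ fun ω => ?_)
    simp only [LWF, Pi.add_apply]
    ring
  rw [hsum]
  refine (abs_add_le _ _).trans ?_
  refine (add_le_add_left (abs_add_le _ _) _).trans ?_
  rw [abs_mul, abs_of_pos (by norm_num : (0:ℝ) < 1 / 2)]
  have : 0 ≤ B * M2 * (3 * A ^ 2) * (ε * (q - p) + (5 * A ^ 2 / ε + 1) * (q - p) ^ 2) := by positivity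
  linarith

end WFCont

lemma wf_meas_int {Ω : Type*} [MeasurableSpace Ω] {Y : ℝ → Ω → ℝ} (hm : ∀ t, Measurable (Y t))
    (hc : ∀ ω, Continuous fun t => Y t ω) {g : ℝ → ℝ} (hg : Continuous g) (a b : ℝ) :
    Measurable (fun ω => ∫ u in Ioc a b, g (Y u ω)) := by
  have h1 : Measurable (Function.uncurry Y) := measurable_uncurry_of_continuous_of_measurable hc hm
  have h2 : StronglyMeasurable (fun z : ℝ × Ω => g (Y z.1 z.2)) :=
    (hg.measurable.comp h1).stronglyMeasurable
  exact (StronglyMeasurable.integral_prod_left (μ := volume.restrict (Ioc a b)) h2).measurable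

namespace WFCont

variable {s σ A : ℝ} {α : Measure ℝ} (W : WFCont s σ A α)

lemma dynkin {f : ℝ → ℝ} (hf : ContDiff ℝ 2 f) {n : ℕ} {Φ : (Fin n → ℝ) → ℝ} {B : ℝ} (hΦ : Continuous Φ)
    (hB : ∀ v, |Φ v| ≤ B) (u : Fin n → ℝ) {p q : ℝ} (hu : ∀ i, u i ≤ p) (hp : 0 ≤ p) (hpq : p ≤ q) :
    ∫ ω, Φ (fun i => W.X (u i) ω) * (f (W.X q ω) - f (W.X p ω) - ∫ v in Ioc p q, LWF s σ f (W.X v ω)) ∂W.P = 0 := by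
  have cL : Continuous (LWF s σ f) := wf_LWF_cont hf
  have cf := hf.continuous
  obtain ⟨D, hD, hin⟩ := W.infini hf hΦ hB
  have hB0 : 0 ≤ B := (abs_nonneg _).trans (hB 0)
  have mΦ : Measurable (fun ω => Φ (fun i => W.X (u i) ω)) :=
    hΦ.measurable.comp (measurable_pi_lambda _ fun i => W.measX _)
  have hcont : ∀ g : ℝ → ℝ, Continuous g →
      Continuous (fun t => ∫ ω, Φ (fun i => W.X (u i) ω) * g (W.X t ω) ∂W.P) := by
    intro g hg
    obtain ⟨M, hM, b⟩ := wf_bdd01 hg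
    refine continuous_of_dominated (bound := fun _ => B * M) (fun t => ?_) (fun t => ?_) (integrable_const _) ?_
    · exact (mΦ.mul (hg.measurable.comp (W.measX t))).aestronglyMeasurable
    · refine ae_of_all _ fun ω => ?_
      rw [norm_mul]
      exact mul_le_mul (hB _) (b _ (W.range01 _ _)) (norm_nonneg _) hB0
    · exact ae_of_all _ fun ω => continuous_const.mul (hg.comp (W.contX ω))
  have hI : ∀ t (g : ℝ → ℝ), Continuous g → Integrable (fun ω => Φ (fun i => W.X (u i) ω) * g (W.X t ω)) W.P :=
    fun t g hg => W.intg u t t hΦ hB (fun x y => g x) (by fun_prop)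
  have hder : ∀ t ∈ Ioo (min p q) (max p q), HasDerivWithinAt
      (fun t => ∫ ω, Φ (fun i => W.X (u i) ω) * f (W.X t ω) ∂W.P)
      (∫ ω, Φ (fun i => W.X (u i) ω) * LWF s σ f (W.X t ω) ∂W.P) (Ioi t) t := by
    intro t ht
    rw [min_eq_left hpq] at ht
    rw [hasDerivWithinAt_iff_isLittleO, Asymptotics.isLittleO_iff]
    intro c hc
    obtain ⟨K, hK, hb⟩ := hin (c / (2 * (D + 1))) (by positivity)
    have hmem : Ioo t (t + c / (2 * (K + 1))) ∈ 𝓝[>] t :=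
      Ioo_mem_nhdsGT (by have : 0 < c / (2 * (K + 1)) := by positivity
                         linarith)
    filter_upwards [hmem] with t' ht'
    have h1 := hb u t t' (fun i => (hu i).trans ht.1.le) (hp.trans ht.1.le) ht'.1.le
    have e : ∫ ω, Φ (fun i => W.X (u i) ω) * (f (W.X t' ω) - f (W.X t ω) - (t' - t) * LWF s σ f (W.X t ω)) ∂W.P
        = ∫ ω, Φ (fun i => W.X (u i) ω) * f (W.X t' ω) ∂W.P - ∫ ω, Φ (fun i => W.X (u i) ω) * f (W.X t ω) ∂W.P
        - (t' - t) * ∫ ω, Φ (fun i => W.X (u i) ω) * LWF s σ f (W.X t ω) ∂W.P := by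
      rw [← integral_const_mul, ← integral_sub (hI t' f cf) (hI t f cf)]
      refine Eq.trans ?_ (integral_sub ((hI t' f cf).sub (hI t f cf)) ((hI t _ cL).const_mul (t' - t)))
      refine integral_congr_ae (ae_of_all _ fun ω => ?_)
      simp only [Pi.sub_apply]
      ring
    rw [e] at h1
    rw [Real.norm_eq_abs, Real.norm_eq_abs, smul_eq_mul]
    refine h1.trans ?_
    have hd : 0 < t' - t := by linarith [ht'.1]
    rw [abs_of_pos hd]
    have h2 : t' - t < c / (2 * (K + 1)) := by linarith [ht'.2]
    have h3 : K * (t' - t) ≤ c / 2 := by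
      rw [lt_div_iff₀ (by positivity)] at h2
      nlinarith
    have h4 : D * (c / (2 * (D + 1))) ≤ c / 2 := by
      rw [mul_div_assoc', div_le_div_iff₀ (by positivity) (by positivity)]
      nlinarith
    calc D * (c / (2 * (D + 1)) * (t' - t)) + K * (t' - t) ^ 2
        = (D * (c / (2 * (D + 1))) + K * (t' - t)) * (t' - t) := by ring
      _ ≤ (c / 2 + c / 2) * (t' - t) := by gcongr
      _ = c * (t' - t) := by ring
  have key := intervalIntegral.integral_eq_sub_of_hasDeriv_right (hcont f cf).continuousOn hder
    ((hcont _ cL).intervalIntegrable p q)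
  rw [intervalIntegral.integral_of_le hpq] at key
  obtain ⟨M, hM, b⟩ := wf_bdd01 cL
  have jm : Measurable (Function.uncurry W.X) := measurable_uncurry_of_continuous_of_measurable W.contX W.measX
  have hfub : ∫ t in Ioc p q, (∫ ω, Φ (fun i => W.X (u i) ω) * LWF s σ f (W.X t ω) ∂W.P)
      = ∫ ω, (∫ t in Ioc p q, Φ (fun i => W.X (u i) ω) * LWF s σ f (W.X t ω)) ∂W.P := by
    apply integral_integral_swap
    refine Integrable.of_bound (Measurable.aestronglyMeasurable ?_) (B * M) (ae_of_all _ fun z => ?_)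
    · exact (mΦ.comp measurable_snd).mul (cL.measurable.comp jm)
    · simp only [Function.uncurry]
      rw [norm_mul]
      exact mul_le_mul (hB _) (b _ (W.range01 _ _)) (norm_nonneg _) hB0
  rw [hfub] at key
  simp only [integral_const_mul] at key
  have hIL : Integrable (fun ω => Φ (fun i => W.X (u i) ω) * ∫ t in Ioc p q, LWF s σ f (W.X t ω)) W.P := by
    refine Integrable.of_bound (mΦ.mul (wf_meas_int W.measX W.contX cL p q)).aestronglyMeasurable
      (B * (M * (q - p))) (ae_of_all _ fun ω => ?_)
    rw [norm_mul]
    refine mul_le_mul (hB _) ?_ (norm_nonneg _) hB0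
    refine (norm_setIntegral_le_of_norm_le_const (C := M) (by simp) (fun t _ => b _ (W.range01 _ _))).trans ?_
    simp [hpq]
  have := integral_sub ((hI q f cf).sub (hI p f cf)) hIL
  simp only [Pi.sub_apply] at this
  rw [integral_sub (hI q f cf) (hI p f cf), key, sub_self] at this
  rw [← this]
  refine integral_congr_ae (ae_of_all _ fun ω => ?_)
  simp only
  ring

end WFCont

namespace WFCont

variable {s σ A : ℝ} {α : Measure ℝ} (W : WFCont s σ A α)

def Mf (f : ℝ → ℝ) (t : ℝ) (ω : W.Ω) : ℝ := f (W.X t ω) - ∫ u in Ioc (0:ℝ) t, LWF s σ f (W.X u ω)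

lemma Mf_max (f : ℝ → ℝ) (t : ℝ) : W.Mf f t = W.Mf f (max t 0) := by
  rcases le_total t 0 with h | h
  · rw [max_eq_right h]
    ext ω
    simp only [Mf, W.preZero t h, Ioc_eq_empty (not_lt.2 h), Ioc_self]
  · rw [max_eq_left h]

lemma intL {f : ℝ → ℝ} (hf : ContDiff ℝ 2 f) (ω : W.Ω) (a b : ℝ) :
    IntervalIntegrable (fun u => LWF s σ f (W.X u ω)) volume a b :=
  ((wf_LWF_cont hf).comp (W.contX ω)).intervalIntegrable a b

lemma Mf_sub {f : ℝ → ℝ} (hf : ContDiff ℝ 2 f) {p q : ℝ} (hp : 0 ≤ p) (hpq : p ≤ q) (ω : W.Ω) :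
    W.Mf f q ω - W.Mf f p ω = f (W.X q ω) - f (W.X p ω) - ∫ v in Ioc p q, LWF s σ f (W.X v ω) := by
  simp only [Mf]
  rw [← intervalIntegral.integral_of_le hpq, ← intervalIntegral.integral_of_le hp,
    ← intervalIntegral.integral_of_le (hp.trans hpq),
    ← intervalIntegral.integral_add_adjacent_intervals (W.intL hf ω 0 p) (W.intL hf ω p q)]
  ring

lemma ortho {f : ℝ → ℝ} (hf : ContDiff ℝ 2 f) {n : ℕ} {Φ : (Fin n → ℝ) → ℝ} {B : ℝ} (hΦ : Continuous Φ)
    (hB : ∀ v, |Φ v| ≤ B) (u : Fin n → ℝ) {p q : ℝ} (hu : ∀ i, u i ≤ p) (hpq : p ≤ q) :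
    ∫ ω, Φ (fun i => W.X (u i) ω) * (W.Mf f q ω - W.Mf f p ω) ∂W.P = 0 := by
  rw [W.Mf_max f q, W.Mf_max f p]
  have h := W.dynkin hf hΦ hB u (p := max p 0) (q := max q 0) (fun i => (hu i).trans (le_max_left _ _))
    (le_max_right _ _) (max_le_max hpq le_rfl)
  simpa only [W.Mf_sub hf (le_max_right p 0) (max_le_max hpq le_rfl)] using h

def Fil : Filtration ℝ W.mΩ := Filtration.natural W.X (fun t => (W.measX t).stronglyMeasurable)

lemma measFil {t u : ℝ} (h : u ≤ t) : Measurable[W.Fil t] (W.X u) :=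
  measurable_iff_comap_le.2 (le_iSup₂_of_le (f := fun j (_ : j ≤ t) =>
    MeasurableSpace.comap (W.X j) _) u h le_rfl)

lemma Mf_adapted {f : ℝ → ℝ} (hf : ContDiff ℝ 2 f) (t : ℝ) : Measurable[W.Fil t] (W.Mf f t) := by
  have h1 : Measurable[W.Fil t] (fun ω => f (W.X t ω)) := hf.continuous.measurable.comp (W.measFil le_rfl)
  have h2 : Measurable[W.Fil t] (fun ω => ∫ u in Ioc (0:ℝ) t, LWF s σ f (W.X (min u t) ω)) :=
    @wf_meas_int W.Ω (W.Fil t) (fun u => W.X (min u t)) (fun u => W.measFil (min_le_right _ _))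
      (fun ω => (W.contX ω).comp (continuous_id.min continuous_const)) _ (wf_LWF_cont hf) 0 t
  have h3 : W.Mf f t = fun ω => f (W.X t ω) - ∫ u in Ioc (0:ℝ) t, LWF s σ f (W.X (min u t) ω) := by
    ext ω
    simp only [Mf]
    congr 1
    refine setIntegral_congr_fun measurableSet_Ioc fun u hu => ?_
    simp only [min_eq_left hu.2]
  rw [h3]
  exact h1.sub h2

lemma Mf_bdd {f : ℝ → ℝ} (hf : ContDiff ℝ 2 f) (t : ℝ) : ∃ C, 0 ≤ C ∧ ∀ ω, |W.Mf f t ω| ≤ C := by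
  obtain ⟨M0, hM0, b0⟩ := wf_bdd01 hf.continuous
  obtain ⟨M, hM, b⟩ := wf_bdd01 (wf_LWF_cont (s := s) (σ := σ) hf)
  refine ⟨M0 + M * (volume.real (Ioc 0 t)), by positivity, fun ω => ?_⟩
  refine (abs_sub _ _).trans (add_le_add (b0 _ (W.range01 _ _)) ?_)
  exact norm_setIntegral_le_of_norm_le_const (C := M) (f := fun u => LWF s σ f (W.X u ω)) (by simp) (fun t _ => b _ (W.range01 _ _))

lemma zero_of_ortho {p : ℝ} {N : W.Ω → ℝ} (hN : Measurable N) {C : ℝ} (hC : ∀ ω, |N ω| ≤ C)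
    (h : ∀ (n : ℕ) (u : Fin n → ℝ) (Φ : (Fin n → ℝ) → ℝ) (B : ℝ), Continuous Φ → (∀ v, |Φ v| ≤ B) →
      (∀ i, u i ≤ p) → ∫ ω, Φ (fun i => W.X (u i) ω) * N ω ∂W.P = 0)
    {S : Set W.Ω} (hS : MeasurableSet[W.Fil p] S) : ∫ ω in S, N ω ∂W.P = 0 := by
  let Z : W.Ω → (Iic p → ℝ) := fun ω j => W.X j ω
  have hZ : Measurable Z := measurable_pi_lambda _ fun j => W.measX _
  let D1 : W.Ω → ℝ≥0∞ := fun ω => ENNReal.ofReal (N ω)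
  let D2 : W.Ω → ℝ≥0∞ := fun ω => ENNReal.ofReal (-N ω)
  have m1 : Measurable D1 := hN.ennreal_ofReal
  have m2 : Measurable D2 := hN.neg.ennreal_ofReal
  have iN : Integrable N W.P := Integrable.of_bound hN.aestronglyMeasurable C (ae_of_all _ hC)
  have f1 : IsFiniteMeasure (W.P.withDensity D1) := isFiniteMeasure_withDensity_ofReal iN.2
  have f2 : IsFiniteMeasure (W.P.withDensity D2) := isFiniteMeasure_withDensity_ofReal iN.neg.2
  have heq : (W.P.withDensity D1).map Z = (W.P.withDensity D2).map Z := by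
    refine IsProjectiveLimit.unique (P := fun I => ((W.P.withDensity D2).map Z).map I.restrict) ?_ (fun I => rfl)
    intro I
    have mI : Measurable (I.restrict (π := fun _ : Iic p => ℝ)) := Finset.measurable_restrict I
    apply ext_of_forall_integral_eq_of_IsFiniteMeasure
    intro g
    have gI : Measurable (fun x : Iic p → ℝ => g (I.restrict x)) := g.continuous.measurable.comp mI
    rw [integral_map mI.aemeasurable g.continuous.measurable.aestronglyMeasurable,
      integral_map mI.aemeasurable g.continuous.measurable.aestronglyMeasurable,
      integral_map hZ.aemeasurable gI.aestronglyMeasurable,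
      integral_map hZ.aemeasurable gI.aestronglyMeasurable,
      integral_withDensity_eq_integral_toReal_smul m1 (ae_of_all _ fun _ => ENNReal.ofReal_lt_top),
      integral_withDensity_eq_integral_toReal_smul m2 (ae_of_all _ fun _ => ENNReal.ofReal_lt_top)]
    have gm : Measurable (fun ω => g (I.restrict (Z ω))) := g.continuous.measurable.comp (mI.comp hZ)
    have ib : ∀ N' : W.Ω → ℝ, Measurable N' → (∀ ω, |N' ω| ≤ C) → Integrable
        (fun ω => (ENNReal.ofReal (N' ω)).toReal • g (I.restrict (Z ω))) W.P := by
      intro N' hN' hb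
      refine Integrable.of_bound (hN'.ennreal_ofReal.ennreal_toReal.smul gm).aestronglyMeasurable
        (C * ‖g‖) (ae_of_all _ fun ω => ?_)
      rw [norm_smul]
      refine mul_le_mul ?_ (g.norm_coe_le_norm _) (norm_nonneg _) ((abs_nonneg _).trans (hb ω))
      rw [Real.norm_eq_abs, ENNReal.abs_toReal, ENNReal.toReal_ofReal']
      exact max_le ((le_abs_self _).trans (hb ω)) ((abs_nonneg _).trans (hb ω))
    rw [← sub_eq_zero, ← integral_sub (ib N hN hC) (ib (fun ω => -N ω) hN.neg (fun ω => by rw [abs_neg]; exact hC ω))]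
    have := h I.card (fun k => ((I.equivFin.symm k : Iic p) : ℝ)) (fun v => g (fun i => v (I.equivFin i))) ‖g‖
      (g.continuous.comp (continuous_pi fun i => continuous_apply _)) (fun v => g.norm_coe_le_norm _)
      (fun i => (I.equivFin.symm i : Iic p).2)
    rw [← this]
    refine integral_congr_ae (ae_of_all _ fun ω => ?_)
    simp only [smul_eq_mul, ← sub_mul, ENNReal.toReal_ofReal', Equiv.symm_apply_apply]
    rw [mul_comm]
    congr 1
    rcases le_total (N ω) 0 with h0 | h0
    · rw [max_eq_right h0, max_eq_left (by linarith)]; ring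
    · rw [max_eq_left h0, max_eq_right (by linarith)]; ring
  have hS' : MeasurableSet[MeasurableSpace.comap Z inferInstance] S := by
    have := Filtration.natural_eq_comap W.X (fun t => (W.measX t).stronglyMeasurable) p
    rw [Fil, this] at hS
    exact hS
  obtain ⟨T, hT, rfl⟩ := hS'
  have h1 := congrArg (fun μ => μ T) heq
  simp only [Measure.map_apply hZ hT] at h1
  rw [withDensity_apply _ (hZ hT), withDensity_apply _ (hZ hT)] at h1
  rw [integral_eq_lintegral_pos_part_sub_lintegral_neg_part iN.integrableOn, h1, sub_self]

lemma mart {f : ℝ → ℝ} (hf : ContDiff ℝ 2 f) : Martingale (W.Mf f) W.Fil W.P := by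
  have hm : ∀ t, Measurable (W.Mf f t) := fun t => (W.Mf_adapted hf t).mono (W.Fil.le t) le_rfl
  have hi : ∀ t, Integrable (W.Mf f t) W.P := by
    intro t
    obtain ⟨C, -, hC⟩ := W.Mf_bdd hf t
    exact Integrable.of_bound (hm t).aestronglyMeasurable C (ae_of_all _ hC)
  refine ⟨fun t => (W.Mf_adapted hf t).stronglyMeasurable, fun p q hpq => ?_⟩
  refine (ae_eq_condExp_of_forall_setIntegral_eq (W.Fil.le p) (hi q) (fun _ _ _ => (hi p).integrableOn) ?_
    (W.Mf_adapted hf p).stronglyMeasurable.aestronglyMeasurable).symm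
  intro S hS _
  obtain ⟨C1, -, hC1⟩ := W.Mf_bdd hf p
  obtain ⟨C2, -, hC2⟩ := W.Mf_bdd hf q
  have := W.zero_of_ortho (p := p) (N := fun ω => W.Mf f q ω - W.Mf f p ω) ((hm q).sub (hm p)) (C := C2 + C1)
    (fun ω => (abs_sub _ _).trans (add_le_add (hC2 ω) (hC1 ω)))
    (fun n u Φ B hΦ hB hu => W.ortho hf hΦ hB u hu hpq) hS
  rw [integral_sub (hi q).integrableOn (hi p).integrableOn] at this
  linarith

end WFCont

def WFCont.extend {s σ A : ℝ} {α : Measure ℝ} (W : WFCont s σ A α) : WFCont s σ A α :=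
  haveI := isProbabilityMeasure_expMeasure (r := 1) one_pos
  { Ω := W.Ω × ℝ
    P := W.P.prod (expMeasure 1)
    probP := inferInstance
    X := fun t z => W.X t z.1
    measX := fun t => (W.measX t).comp measurable_fst
    contX := fun z => W.contX z.1
    preZero := fun t ht => by rw [W.preZero t ht]
    range01 := fun t z => W.range01 t z.1
    law := by
      have : (fun z : W.Ω × ℝ => W.X 0 z.1) = W.X 0 ∘ Prod.fst := rfl
      rw [this, ← Measure.map_map (W.measX 0) measurable_fst, Measure.map_fst_prod, measure_univ, one_smul, W.law]
    hA := W.hA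
    four := fun p q h1 h2 => by
      rw [integral_fun_fst (fun ω => (W.X q ω - W.X p ω) ^ 4), probReal_univ, one_smul]
      exact W.four p q h1 h2
    first := fun n u p q Φ B ε h1 h2 h3 h4 h5 h6 h7 => by
      rw [integral_fun_fst (fun ω => Φ (fun i => W.X (u i) ω) * (W.X q ω - W.X p ω + s * (q - p) * (W.X p ω * (1 - W.X p ω)))), probReal_univ, one_smul]
      exact W.first n u p q Φ B ε h1 h2 h3 h4 h5 h6 h7
    second := fun n u p q Φ B ε h1 h2 h3 h4 h5 h6 h7 => by
      rw [integral_fun_fst (fun ω => Φ (fun i => W.X (u i) ω) * ((W.X q ω - W.X p ω) ^ 2 - σ ^ 2 * (q - p) * (W.X p ω * (1 - W.X p ω)))), probReal_univ, one_smul]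
      exact W.second n u p q Φ B ε h1 h2 h3 h4 h5 h6 h7 }

lemma wf_expLaw (t : ℝ) (ht : 0 ≤ t) : expMeasure 1 (Ioi t) = ENNReal.ofReal (Real.exp (-t)) := by
  haveI := isProbabilityMeasure_expMeasure (r := 1) one_pos
  have h := cdf_expMeasure_eq (r := 1) one_pos t
  rw [cdf_eq_real, if_pos ht, one_mul] at h
  rw [← compl_Iic, prob_compl_eq_one_sub measurableSet_Iic, ← ENNReal.ofReal_toReal (measure_ne_top (expMeasure 1) (Iic t))]
  change 1 - ENNReal.ofReal ((expMeasure 1).real (Iic t)) = _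
  rw [h, ← ENNReal.ofReal_one, ← ENNReal.ofReal_sub _ (by simp [ht])]
  congr 1; ring

def WFCont.killed {s σ A : ℝ} {α : Measure ℝ} (W : WFCont s σ A α) (r : ℝ → ℝ) : WFKilled s σ r α :=
  haveI := isProbabilityMeasure_expMeasure (r := 1) one_pos
  { Ω := W.Ω × ℝ
    P := W.P.prod (expMeasure 1)
    probP := inferInstance
    X := fun t z => W.X t z.1
    measX := W.extend.measX
    contX := W.extend.contX
    preZero := W.extend.preZero
    range01 := W.extend.range01
    initLaw := W.extend.law
    ℱ := W.extend.Fil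
    adaptedX := fun t => W.extend.measFil le_rfl
    martProblem := fun f hf => W.extend.mart hf
    Tkill := Prod.snd
    measT := measurable_snd
    expLaw := fun t ht => by
      have : {z : W.Ω × ℝ | t < z.2} = univ ×ˢ Ioi t := by ext; simp
      rw [this, Measure.prod_prod, measure_univ, one_mul, wf_expLaw t ht]
    indepT := indepFun_prod (X := fun ω t => W.X t ω) (Y := id) (measurable_pi_lambda _ fun t => W.measX t) measurable_id }

namespace WFCont

variable {s σ A : ℝ} {α : Measure ℝ} (W : WFCont s σ A α)

lemma int1 {g : ℝ → ℝ} (hg : Continuous g) (t : ℝ) : Integrable (fun ω => g (W.X t ω)) W.P := by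
  obtain ⟨M, hM, b⟩ := wf_bdd01 hg
  exact Integrable.of_bound (hg.measurable.comp (W.measX t)).aestronglyMeasurable M
    (ae_of_all _ fun ω => b _ (W.range01 t ω))

lemma super {V : ℝ → ℝ} (hV : ContDiff ℝ 2 V) (hL : ∀ x ∈ Icc (0:ℝ) 1, LWF s σ V x ≤ 0)
    {p q : ℝ} (hp : 0 ≤ p) (hpq : p ≤ q) {B : Set W.Ω} (hB : MeasurableSet[W.Fil p] B) :
    ∫ ω in B, V (W.X q ω) ∂W.P ≤ ∫ ω in B, V (W.X p ω) ∂W.P := by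
  have hM := W.mart hV
  have h := hM.setIntegral_eq hpq hB
  have i1 := (W.int1 hV.continuous q).integrableOn (s := B)
  have i2 := (W.int1 hV.continuous p).integrableOn (s := B)
  have j1 := (hM.integrable q).integrableOn (s := B)
  have j2 := (hM.integrable p).integrableOn (s := B)
  have : ∫ ω in B, (V (W.X q ω) - V (W.X p ω)) ∂W.P ≤ ∫ ω in B, (W.Mf V q ω - W.Mf V p ω) ∂W.P := by
    refine integral_mono (i1.sub i2) (j1.sub j2) fun ω => ?_
    simp only
    rw [W.Mf_sub hV hp hpq]
    have : ∫ v in Ioc p q, LWF s σ V (W.X v ω) ≤ 0 :=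
      integral_nonpos fun v => hL _ (W.range01 v ω)
    linarith
  rw [integral_sub i1 i2, integral_sub j1 j2] at this
  linarith

lemma absorb_fin {V : ℝ → ℝ} (hV : ContDiff ℝ 2 V)
    (hL : ∀ x ∈ Icc (0:ℝ) 1, LWF s σ V x ≤ 0) {t ε : ℝ} (hε : 0 ≤ ε) (T : Finset ℝ) :
    (∀ u ∈ T, u ≤ t) → ∀ a, 0 ≤ a → (∀ u ∈ T, a ≤ u) → ∀ B : Set W.Ω, MeasurableSet[W.Fil a] B →
      ∫ ω in B ∩ {ω | ∃ u ∈ T, V (W.X u ω) ≤ ε}, V (W.X t ω) ∂W.P ≤ ε * W.P.real B := by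
  classical
  have mV : ∀ u c, MeasurableSet {ω | V (W.X u ω) ≤ c} := fun u c =>
    measurableSet_le (hV.continuous.measurable.comp (W.measX u)) measurable_const
  induction T using Finset.induction_on_min with
  | empty =>
    intro _ a ha _ B hB
    simp only [Finset.notMem_empty, false_and, exists_false, ofPred_false, inter_empty, setIntegral_empty]
    positivity
  | insert a0 T h0 ih =>
    intro hT a ha haT B hB
    have ha0 : a ≤ a0 := haT a0 (Finset.mem_insert_self _ _)
    have ha0t : a0 ≤ t := hT a0 (Finset.mem_insert_self _ _)
    have hB0 : MeasurableSet[W.Fil a0] B := W.Fil.mono ha0 B hB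
    have mF : MeasurableSet[W.Fil a0] {ω | V (W.X a0 ω) ≤ ε} :=
      @measurableSet_le _ _ _ _ _ (W.Fil a0) _ _ _ _ _ (hV.continuous.measurable.comp (W.measFil le_rfl)) measurable_const
    have hB1 : MeasurableSet[W.Fil a0] (B ∩ {ω | V (W.X a0 ω) ≤ ε}) := hB0.inter mF
    have hB2 : MeasurableSet[W.Fil a0] (B \ {ω | V (W.X a0 ω) ≤ ε}) := hB0.diff mF
    have hB1' := W.Fil.le _ _ hB1
    have hB2' := W.Fil.le _ _ hB2
    have e : B ∩ {ω | ∃ u ∈ insert a0 T, V (W.X u ω) ≤ ε} = (B ∩ {ω | V (W.X a0 ω) ≤ ε}) ∪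
        ((B \ {ω | V (W.X a0 ω) ≤ ε}) ∩ {ω | ∃ u ∈ T, V (W.X u ω) ≤ ε}) := by
      ext ω
      simp only [Finset.exists_mem_insert, mem_inter_iff, mem_union, Set.mem_sdiff, mem_ofPred_eq]
      tauto
    have mT : MeasurableSet {ω | ∃ u ∈ T, V (W.X u ω) ≤ ε} := by
      have : {ω | ∃ u ∈ T, V (W.X u ω) ≤ ε} = ⋃ u ∈ T, {ω | V (W.X u ω) ≤ ε} := by ext; simp
      rw [this]
      exact T.measurableSet_biUnion fun u _ => mV u ε
    have iV := W.int1 hV.continuous t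
    rw [e, setIntegral_union (by
      rw [Set.disjoint_left]
      rintro ω ⟨_, h⟩ ⟨⟨_, h'⟩, _⟩
      exact h' h) (hB2'.inter mT) iV.integrableOn iV.integrableOn]
    have g1 : ∫ ω in B ∩ {ω | V (W.X a0 ω) ≤ ε}, V (W.X t ω) ∂W.P
        ≤ ε * W.P.real (B ∩ {ω | V (W.X a0 ω) ≤ ε}) := by
      refine (W.super hV hL (ha.trans ha0) ha0t hB1).trans ?_
      have := setIntegral_mono_on (W.int1 hV.continuous a0).integrableOn
        (integrable_const ε).integrableOn hB1' (fun ω hω => hω.2)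
      rw [setIntegral_const, smul_eq_mul, mul_comm] at this
      exact this
    have g2 := ih (fun u hu => hT u (Finset.mem_insert_of_mem hu)) a0 (ha.trans ha0)
      (fun u hu => (h0 u hu).le) _ hB2
    have g3 := measureReal_inter_add_sdiff (μ := W.P) (s := B) (W.Fil.le _ _ mF)
    rw [← g3, mul_add]
    exact add_le_add g1 g2

lemma absorb {V : ℝ → ℝ} (hV : ContDiff ℝ 2 V) (h0 : ∀ x ∈ Icc (0:ℝ) 1, 0 ≤ V x)
    (hL : ∀ x ∈ Icc (0:ℝ) 1, LWF s σ V x ≤ 0) {t : ℝ} (ht : 0 < t) :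
    ∀ᵐ ω ∂W.P, (∃ u ∈ Icc (0:ℝ) t, V (W.X u ω) = 0) → V (W.X t ω) = 0 := by
  haveI : Nonempty (Icc (0:ℝ) t) := ⟨⟨0, le_rfl, ht.le⟩⟩
  let d : ℕ → Icc (0:ℝ) t := TopologicalSpace.denseSeq _
  have hd : DenseRange d := TopologicalSpace.denseRange_denseSeq _
  have mV : ∀ u c, MeasurableSet {ω | V (W.X u ω) ≤ c} := fun u c =>
    measurableSet_le (hV.continuous.measurable.comp (W.measX u)) measurable_const
  let S : ℕ → ℕ → Set W.Ω := fun m n => {ω | ∃ u ∈ (Finset.range n).image (fun k => (d k : ℝ)), V (W.X u ω) ≤ 1 / ((m:ℝ) + 1)}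
  have mS : ∀ m n, MeasurableSet (S m n) := by
    intro m n
    have : S m n = ⋃ u ∈ (Finset.range n).image (fun k => (d k : ℝ)), {ω | V (W.X u ω) ≤ 1 / ((m:ℝ) + 1)} := by
      ext; simp [S]
    rw [this]
    exact Finset.measurableSet_biUnion _ fun u _ => mV u _
  have iV := W.int1 hV.continuous t
  have b1 : ∀ m n, ∫ ω in S m n, V (W.X t ω) ∂W.P ≤ 1 / ((m:ℝ) + 1) := by
    intro m n
    have := W.absorb_fin hV hL (t := t) (ε := 1 / ((m:ℝ) + 1)) (by positivity)
      ((Finset.range n).image (fun k => (d k : ℝ)))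
      (fun u hu => by obtain ⟨k, -, rfl⟩ := Finset.mem_image.1 hu; exact (d k).2.2) 0 le_rfl
      (fun u hu => by obtain ⟨k, -, rfl⟩ := Finset.mem_image.1 hu; exact (d k).2.1) univ MeasurableSet.univ
    rwa [univ_inter, probReal_univ, mul_one] at this
  have mono : ∀ m, Monotone (S m) := by
    intro m n n' h ω hω
    obtain ⟨u, hu, h2⟩ := hω
    exact ⟨u, Finset.image_subset_image (Finset.range_mono h) hu, h2⟩
  have b2 : ∀ m, ∫ ω in ⋃ n, S m n, V (W.X t ω) ∂W.P ≤ 1 / ((m:ℝ) + 1) := fun m =>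
    le_of_tendsto' (tendsto_setIntegral_of_monotone (mS m) (mono m) iV.integrableOn) (b1 m)
  let N := ⋂ m, ⋃ n, S m n
  have mN : MeasurableSet N := MeasurableSet.iInter fun m => MeasurableSet.iUnion fun n => mS m n
  have b3 : ∀ m : ℕ, ∫ ω in N, V (W.X t ω) ∂W.P ≤ 1 / ((m:ℝ) + 1) := fun m =>
    (setIntegral_mono_set iV.integrableOn (ae_of_all _ fun ω => h0 _ (W.range01 t ω))
      (HasSubset.Subset.eventuallyLE (iInter_subset _ m))).trans (b2 m)
  have b4 : ∫ ω in N, V (W.X t ω) ∂W.P = 0 :=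
    le_antisymm (ge_of_tendsto' tendsto_one_div_add_atTop_nhds_zero_nat b3)
      (integral_nonneg fun ω => h0 _ (W.range01 t ω))
  rw [setIntegral_eq_zero_iff_of_nonneg_ae (ae_of_all _ fun ω => h0 _ (W.range01 t ω)) iV.integrableOn] at b4
  have b5 := (ae_restrict_iff' mN).1 b4
  filter_upwards [b5] with ω hω hu
  refine hω ?_
  obtain ⟨u, hu, h1⟩ := hu
  simp only [N, mem_iInter, mem_iUnion]
  intro m
  have ho : IsOpen {v : Icc (0:ℝ) t | V (W.X v ω) < 1 / ((m:ℝ) + 1)} :=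
    isOpen_lt ((hV.continuous.comp (W.contX ω)).comp continuous_subtype_val) continuous_const
  obtain ⟨k, hk⟩ := hd.exists_mem_open ho ⟨⟨u, hu⟩, by simp only [mem_ofPred_eq, h1]; positivity⟩
  exact ⟨k + 1, d k, Finset.mem_image.2 ⟨k, by simp, rfl⟩, le_of_lt hk⟩

lemma absorb0 (hs : 0 ≤ s) {t : ℝ} (ht : 0 < t) :
    ∀ᵐ ω ∂W.P, (∃ u ∈ Icc (0:ℝ) t, W.X u ω = 0) → W.X t ω = 0 := by
  refine W.absorb (V := fun x => x) contDiff_id (fun x hx => hx.1) (fun x hx => ?_) ht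
  have e1 : deriv (fun x : ℝ => x) = fun _ => 1 := by ext; simp
  simp only [LWF, e1, deriv_const]
  have := mul_nonneg hs (mul_nonneg hx.1 (sub_nonneg.2 hx.2))
  linarith

lemma absorb1 (hs : 0 ≤ s) (hσ : 0 < σ) {t : ℝ} (ht : 0 < t) :
    ∀ᵐ ω ∂W.P, (∃ u ∈ Icc (0:ℝ) t, W.X u ω = 1) → W.X t ω = 1 := by
  let c := 1 + 2 * s / σ ^ 2
  have hc : 0 < c := by positivity
  have d1 : ∀ x, HasDerivAt (fun x => Real.exp c - Real.exp (c * x)) (-(c * Real.exp (c * x))) x := by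
    intro x
    have := (((hasDerivAt_id x).const_mul c).exp).const_sub (Real.exp c)
    simpa [mul_comm] using this
  have d2 : ∀ x, HasDerivAt (fun x => -(c * Real.exp (c * x))) (-(c * (c * Real.exp (c * x)))) x := by
    intro x
    have := ((((hasDerivAt_id x).const_mul c).exp).const_mul c).fun_neg
    simpa [mul_comm] using this
  have e1 : deriv (fun x => Real.exp c - Real.exp (c * x)) = fun x => -(c * Real.exp (c * x)) := funext fun x => (d1 x).deriv
  have e2 : deriv (fun x => -(c * Real.exp (c * x))) = fun x => -(c * (c * Real.exp (c * x))) := funext fun x => (d2 x).deriv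
  have h := W.absorb (V := fun x => Real.exp c - Real.exp (c * x))
    (contDiff_const.sub (contDiff_const.mul contDiff_id).exp) (fun x hx => ?_) (fun x hx => ?_) ht
  · filter_upwards [h] with ω hω hu
    have := hω (by
      obtain ⟨u, hu, h1⟩ := hu
      exact ⟨u, hu, by simp [h1]⟩)
    rw [sub_eq_zero, Real.exp_eq_exp] at this
    nlinarith
  · rw [sub_nonneg]
    exact Real.exp_le_exp.2 (by nlinarith [hx.2])
  · simp only [LWF, e1, e2]
    have h1 : s - σ ^ 2 / 2 * c = - (σ ^ 2 / 2) := by simp only [c]; field_simp; ring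
    have h2 : -s * x * (1 - x) * -(c * Real.exp (c * x)) + σ ^ 2 / 2 * (x * (1 - x)) * -(c * (c * Real.exp (c * x)))
      = (x * (1 - x) * (c * Real.exp (c * x))) * (s - σ ^ 2 / 2 * c) := by ring
    rw [h2, h1]
    have : 0 ≤ x * (1 - x) * (c * Real.exp (c * x)) :=
      mul_nonneg (mul_nonneg hx.1 (sub_nonneg.2 hx.2)) (by positivity)
    have : 0 ≤ x * (1 - x) * (c * Real.exp (c * x)) * (σ ^ 2 / 2) := by positivity
    linarith

end WFCont

lemma wf_avg {y : ℝ → ℝ} (hy : Continuous y) :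
    Tendsto (fun t : ℝ => t⁻¹ * ∫ u in Ioc (0:ℝ) t, y u) (𝓝[>] 0) (𝓝 (y 0)) := by
  have h := (hy.integral_hasStrictDerivAt 0 0).hasDerivAt.tendsto_slope_zero_right
  refine h.congr' ?_
  filter_upwards [self_mem_nhdsWithin] with t ht
  rw [zero_add, intervalIntegral.integral_same, sub_zero, intervalIntegral.integral_of_le (le_of_lt ht), smul_eq_mul]

namespace WFCont

variable {s σ A : ℝ} {α : Measure ℝ} (W : WFCont s σ A α)

def It (r : ℝ → ℝ) (t : ℝ) (ω : W.Ω) : ℝ := ∫ u in Ioc (0:ℝ) t, (-(r (W.X u ω)))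

lemma It_meas {r : ℝ → ℝ} (hr : Continuous r) (t : ℝ) : Measurable (W.It r t) :=
  wf_meas_int (g := fun x => -(r x)) W.measX W.contX hr.neg 0 t

lemma qsd_step {r : ℝ → ℝ} (hr : Continuous r) (hr0 : ∀ x ∈ Icc (0:ℝ) 1, r x ≤ 0) {ρ : ℝ}
    (hs : 0 ≤ s) (hσ : 0 < σ) (hQ : IsQSD s σ r α ρ) {f : ℝ → ℝ} (hf : Continuous f)
    (f0 : ∀ x ∈ Icc (0:ℝ) 1, 0 ≤ f x) (fz : f 0 = 0) (fo : f 1 = 0) {t : ℝ} (ht : 0 < t) :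
    ∫ ω, f (W.X t ω) * Real.exp (-(W.It r t ω)) ∂W.P ≤ Real.exp (-(ρ * t)) * ∫ x, f x ∂α := by
  have hexp := isProbabilityMeasure_expMeasure (r := 1) one_pos
  obtain ⟨hα, hα0, hq⟩ := hQ
  let K := W.killed r
  have hq := hq K t ht
  let E : Set (W.Ω × ℝ) := K.aliveAll t
  let μ : Measure (W.Ω × ℝ) := W.P.prod (expMeasure 1)
  let g : W.Ω × ℝ → ℝ≥0∞ := fun z => ENNReal.ofReal (f (W.X t z.1))
  have mg : Measurable g := (hf.measurable.comp ((W.measX t).comp measurable_fst)).ennreal_ofReal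
  have mK : Measurable (fun z : W.Ω × ℝ => W.X t z.1) := (W.measX t).comp measurable_fst
  have e1 : (μ.restrict E).map (fun z => W.X t z.1) = ENNReal.ofReal (Real.exp (-(ρ * t))) • α := by
    ext B hB
    rw [Measure.map_apply mK hB, Measure.restrict_apply (mK hB), Measure.smul_apply, smul_eq_mul]
    exact hq B hB
  have e2 : ∫⁻ z in E, g z ∂μ = ENNReal.ofReal (Real.exp (-(ρ * t))) * ∫⁻ x, ENNReal.ofReal (f x) ∂α := by
    have := congrArg (fun ν => ∫⁻ x, ENNReal.ofReal (f x) ∂ν) e1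
    rwa [lintegral_map hf.measurable.ennreal_ofReal mK, lintegral_smul_measure, smul_eq_mul] at this
  let S : Set (W.Ω × ℝ) := {z | W.It r t z.1 < z.2}
  have mS : MeasurableSet S := measurableSet_lt ((W.It_meas hr t).comp measurable_fst) measurable_snd
  have mG : MeasurableSet {z | g z ≠ 0} := (mg (measurableSet_singleton 0)).compl
  have e3 : ∫⁻ z in S, g z ∂μ ≤ ∫⁻ z in E, g z ∂μ := by
    have : ∫⁻ z in S, g z ∂μ = ∫⁻ z in S ∩ {z | g z ≠ 0}, g z ∂μ := by
      rw [← lintegral_indicator mS, ← lintegral_indicator (mS.inter mG)]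
      congr 1
      ext z
      by_cases h1 : z ∈ S <;> by_cases h2 : g z = 0 <;> simp [indicator, h1, h2]
    rw [this]
    refine lintegral_mono_set' ?_
    have a0 := Measure.quasiMeasurePreserving_fst (μ := W.P) (ν := expMeasure 1) |>.ae (W.absorb0 hs ht)
    have a1 := Measure.quasiMeasurePreserving_fst (μ := W.P) (ν := expMeasure 1) |>.ae (W.absorb1 hs hσ ht)
    filter_upwards [a0, a1] with z h0 h1 hz
    obtain ⟨hz1, hz2⟩ := hz
    refine ⟨⟨hz1, ?_⟩, ?_⟩
    · intro u hu hX
      apply hz2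
      have := h0 ⟨u, hu, hX⟩
      simp only [g, this, fz, ENNReal.ofReal_zero]
    · intro u hu hX
      apply hz2
      have := h1 ⟨u, hu, hX⟩
      simp only [g, this, fo, ENNReal.ofReal_zero]
  have hI : ∀ ω, 0 ≤ W.It r t ω := fun ω => integral_nonneg fun u => neg_nonneg.2 (hr0 _ (W.range01 u ω))
  have e4 : ∫⁻ z in S, g z ∂μ = ∫⁻ ω, ENNReal.ofReal (f (W.X t ω) * Real.exp (-(W.It r t ω))) ∂W.P := by
    rw [← lintegral_indicator mS, lintegral_prod _ (mg.indicator mS).aemeasurable]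
    congr 1
    ext ω
    have : (fun y => S.indicator g (ω, y)) = (Ioi (W.It r t ω)).indicator (fun _ => ENNReal.ofReal (f (W.X t ω))) := by
      ext y
      simp only [indicator, S, g, mem_ofPred_eq, mem_Ioi]
    rw [this, lintegral_indicator_const measurableSet_Ioi, wf_expLaw _ (hI ω), ENNReal.ofReal_mul (f0 _ (W.range01 t ω))]
  rw [e2, e4] at e3
  obtain ⟨M, hM, bM⟩ := wf_bdd01 hf
  have i1 : Integrable (fun ω => f (W.X t ω) * Real.exp (-(W.It r t ω))) W.P := by
    refine Integrable.of_bound ((hf.measurable.comp (W.measX t)).mul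
      (Real.measurable_exp.comp (W.It_meas hr t).neg)).aestronglyMeasurable (M * 1) (ae_of_all _ fun ω => ?_)
    rw [norm_mul, Real.norm_eq_abs, Real.norm_eq_abs, Real.abs_exp]
    exact mul_le_mul (bM _ (W.range01 t ω)) (Real.exp_le_one_iff.2 (neg_nonpos.2 (hI ω))) (Real.exp_pos _).le hM
  have ha : ∀ᵐ x ∂α, x ∈ Icc (0:ℝ) 1 := by
    have : ∀ᵐ x ∂α, x ∈ Ioo (0:ℝ) 1 := hα0
    exact this.mono fun x hx => Ioo_subset_Icc_self hx
  have i2 : Integrable f α := Integrable.of_bound hf.measurable.aestronglyMeasurable M (ha.mono fun x hx => bM x hx)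
  rw [← ofReal_integral_eq_lintegral_ofReal i1 (ae_of_all _ fun ω => mul_nonneg (f0 _ (W.range01 t ω)) (Real.exp_pos _).le),
    ← ofReal_integral_eq_lintegral_ofReal i2 (ha.mono fun x hx => f0 x hx), ← ENNReal.ofReal_mul (Real.exp_pos _).le] at e3
  exact (ENNReal.ofReal_le_ofReal_iff (mul_nonneg (Real.exp_pos _).le (integral_nonneg_of_ae (ha.mono fun x hx => f0 x hx)))).1 e3

lemma qsd_ineq (W : WFCont s σ A α) {r : ℝ → ℝ} (hr : Continuous r) (hr0 : ∀ x ∈ Icc (0:ℝ) 1, r x ≤ 0) {ρ : ℝ}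
    (hs : 0 ≤ s) (hσ : 0 < σ) (hQ : IsQSD s σ r α ρ) {f : ℝ → ℝ} (hf : ContDiff ℝ 2 f)
    (f0 : ∀ x ∈ Icc (0:ℝ) 1, 0 ≤ f x) (fz : f 0 = 0) (fo : f 1 = 0) :
    ∫ x, (LWF s σ f x + r x * f x) ∂α ≤ -ρ * ∫ x, f x ∂α := by
  have cL := wf_LWF_cont (s := s) (σ := σ) hf
  have cf := hf.continuous
  have toα : ∀ h : ℝ → ℝ, Continuous h → ∫ x, h x ∂α = ∫ ω, h (W.X 0 ω) ∂W.P := by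
    intro h hh
    have h1 := integral_map (μ := W.P) (W.measX 0).aemeasurable (hh.measurable.aestronglyMeasurable (μ := W.P.map (W.X 0)))
    exact (congrArg (fun ν => ∫ x, h x ∂ν) W.law).symm.trans h1
  have cr : Continuous (fun x => LWF s σ f x + r x * f x) := by fun_prop
  obtain ⟨M, hM, bM⟩ := wf_bdd01 cf
  obtain ⟨ML, hML, bL⟩ := wf_bdd01 cL
  obtain ⟨Mr, hMr, br⟩ := wf_bdd01 hr
  have bJ : ∀ t, 0 < t → ∀ ω, |∫ u in Ioc (0:ℝ) t, LWF s σ f (W.X u ω)| ≤ ML * t := by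
    intro t ht ω
    have := norm_setIntegral_le_of_norm_le_const (C := ML) (μ := volume) (s := Ioc 0 t) (f := fun u => LWF s σ f (W.X u ω)) (by simp) (fun t _ => bL _ (W.range01 _ _))
    rwa [Real.volume_real_Ioc_of_le ht.le, sub_zero] at this
  have bI : ∀ t, 0 < t → ∀ ω, |W.It r t ω| ≤ Mr * t := by
    intro t ht ω
    have := norm_setIntegral_le_of_norm_le_const (C := Mr) (μ := volume) (s := Ioc 0 t) (f := fun u => -(r (W.X u ω))) (by simp) (fun t _ => by rw [norm_neg]; exact br _ (W.range01 _ _))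
    rwa [Real.volume_real_Ioc_of_le ht.le, sub_zero] at this
  have mJ : ∀ t, Measurable (fun ω => ∫ u in Ioc (0:ℝ) t, LWF s σ f (W.X u ω)) := fun t => wf_meas_int W.measX W.contX cL 0 t
  have mI := fun t => W.It_meas hr t
  have mf : ∀ t, Measurable (fun ω => f (W.X t ω)) := fun t => cf.measurable.comp (W.measX t)
  let H : ℝ → W.Ω → ℝ := fun t ω => t⁻¹ * (∫ u in Ioc (0:ℝ) t, LWF s σ f (W.X u ω)) - f (W.X t ω) * (t⁻¹ * W.It r t ω)
  have key : ∀ t, 0 < t → ∫ ω, H t ω ∂W.P ≤ t⁻¹ * (Real.exp (-(ρ * t)) - 1) * ∫ x, f x ∂α := by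
    intro t ht
    have h1 := W.qsd_step hr hr0 hs hσ hQ cf f0 fz fo ht
    have iJ : Integrable (fun ω => ∫ u in Ioc (0:ℝ) t, LWF s σ f (W.X u ω)) W.P :=
      Integrable.of_bound (mJ t).aestronglyMeasurable _ (ae_of_all _ (bJ t ht))
    have iff' : Integrable (fun ω => f (W.X t ω)) W.P := W.int1 cf t
    have ifI : Integrable (fun ω => f (W.X t ω) * W.It r t ω) W.P := by
      refine Integrable.of_bound ((mf t).mul (mI t)).aestronglyMeasurable (M * (Mr * t)) (ae_of_all _ fun ω => ?_)
      rw [norm_mul]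
      exact mul_le_mul (bM _ (W.range01 t ω)) (bI t ht ω) (norm_nonneg _) hM
    have hI : ∀ ω, 0 ≤ W.It r t ω := fun ω => integral_nonneg fun u => neg_nonneg.2 (hr0 _ (W.range01 u ω))
    have i1 : Integrable (fun ω => f (W.X t ω) * Real.exp (-(W.It r t ω))) W.P := by
      refine Integrable.of_bound ((mf t).mul
        (Real.measurable_exp.comp (mI t).neg)).aestronglyMeasurable (M * 1) (ae_of_all _ fun ω => ?_)
      rw [norm_mul, Real.norm_eq_abs, Real.norm_eq_abs, Real.abs_exp]
      exact mul_le_mul (bM _ (W.range01 t ω)) (Real.exp_le_one_iff.2 (neg_nonpos.2 (hI ω))) (Real.exp_pos _).le hM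
    have h2 : ∫ ω, (f (W.X t ω) - f (W.X t ω) * W.It r t ω) ∂W.P ≤ ∫ ω, f (W.X t ω) * Real.exp (-(W.It r t ω)) ∂W.P := by
      refine integral_mono (iff'.sub ifI) i1 fun ω => ?_
      have := Real.add_one_le_exp (-(W.It r t ω))
      have := f0 _ (W.range01 t ω)
      simp only
      nlinarith
    rw [integral_sub iff' ifI] at h2
    have h3 := (W.mart hf).setIntegral_eq ht.le (s := univ) MeasurableSet.univ
    simp only [Mf, Measure.restrict_univ, Ioc_self, Measure.restrict_empty, integral_zero_measure, sub_zero] at h3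
    rw [integral_sub iff' iJ, ← toα f cf] at h3
    have h4 : ∫ ω, H t ω ∂W.P = t⁻¹ * (∫ ω, (∫ u in Ioc (0:ℝ) t, LWF s σ f (W.X u ω)) ∂W.P - ∫ ω, f (W.X t ω) * W.It r t ω ∂W.P) := by
      rw [← integral_sub iJ ifI, ← integral_const_mul]
      congr 1
      ext ω
      simp only [H]
      ring
    rw [h4, mul_assoc]
    refine mul_le_mul_of_nonneg_left ?_ (by positivity)
    linarith
  have lim1 : Tendsto (fun t => ∫ ω, H t ω ∂W.P) (𝓝[>] 0) (𝓝 (∫ x, (LWF s σ f x + r x * f x) ∂α)) := by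
    rw [toα _ cr]
    refine tendsto_integral_filter_of_dominated_convergence (fun _ => ML + M * Mr) ?_ ?_ (integrable_const _) ?_
    · exact Eventually.of_forall fun t => (((mJ t).const_mul _).sub ((mf t).mul ((mI t).const_mul _))).aestronglyMeasurable
    · filter_upwards [self_mem_nhdsWithin] with t ht
      have ht : 0 < t := ht
      refine ae_of_all _ fun ω => ?_
      refine (norm_sub_le _ _).trans (add_le_add ?_ ?_)
      · rw [norm_mul, Real.norm_eq_abs, Real.norm_eq_abs, abs_of_pos (inv_pos.2 ht), inv_mul_le_iff₀ ht, mul_comm t]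
        exact bJ t ht ω
      · rw [norm_mul, norm_mul, Real.norm_eq_abs t⁻¹, abs_of_pos (inv_pos.2 ht)]
        refine mul_le_mul (bM _ (W.range01 t ω)) ?_ (by positivity) hM
        rw [inv_mul_le_iff₀ ht, mul_comm t]
        exact bI t ht ω
    · refine ae_of_all _ fun ω => ?_
      have l1 := wf_avg (cL.comp (W.contX ω))
      have l2 := wf_avg (hr.neg.comp (W.contX ω))
      have l3 : Tendsto (fun t => f (W.X t ω)) (𝓝[>] 0) (𝓝 (f (W.X 0 ω))) :=
        ((cf.comp (W.contX ω)).tendsto 0).mono_left nhdsWithin_le_nhds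
      have := l1.sub (l3.mul l2)
      refine this.congr' ?_ |>.trans_eq ?_ 
      · exact Eventually.of_forall fun t => rfl
      · congr 1
        simp only [Function.comp, Pi.neg_apply]
        ring
  have lim2 : Tendsto (fun t => t⁻¹ * (Real.exp (-(ρ * t)) - 1) * ∫ x, f x ∂α) (𝓝[>] 0) (𝓝 (-ρ * ∫ x, f x ∂α)) := by
    refine Tendsto.mul_const _ ?_
    have h : HasDerivAt (fun t => Real.exp (-(ρ * t))) (-ρ) 0 := by
      have := (((hasDerivAt_id (0:ℝ)).const_mul ρ).fun_neg).exp
      simpa using this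
    have := h.tendsto_slope_zero_right
    simpa using this
  exact le_of_tendsto_of_tendsto lim1 lim2 (by
    filter_upwards [self_mem_nhdsWithin] with t ht using key t ht)

end WFCont

lemma wfcont_exists (s σ : ℝ) (hs : 0 ≤ s) (α : Measure ℝ) [IsProbabilityMeasure α] (hα : α (Icc 0 1)ᶜ = 0) :
    Nonempty (WFCont s σ (1+s+σ^2+σ^4+σ^2*s) α) := by
  obtain ⟨W⟩ := wfdyadic_exists s σ hs α hα
  exact wfcont_of_dyadic W

lemma wf_rate {s σ ρ C : ℝ} {r f : ℝ → ℝ} {α : Measure ℝ} (hs : 0 ≤ s) (hσ : 0 < σ) (hr : Continuous r)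
    (hr0 : ∀ x ∈ Icc (0:ℝ) 1, r x ≤ 0) (hQ : IsQSD s σ r α ρ) (hf : ContDiff ℝ 2 f)
    (f0 : ∀ x ∈ Icc (0:ℝ) 1, 0 ≤ f x) (fz : f 0 = 0) (fo : f 1 = 0)
    (hC : ∀ᵐ x ∂α, -C * f x ≤ LWF s σ f x + r x * f x) (hp : α {x | 0 < f x} ≠ 0) : ρ ≤ C := by
  obtain ⟨hα, hα0, hq⟩ := id hQ
  have ha : ∀ᵐ x ∂α, x ∈ Icc (0:ℝ) 1 := by
    have : ∀ᵐ x ∂α, x ∈ Ioo (0:ℝ) 1 := hα0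
    exact this.mono fun x hx => Ioo_subset_Icc_self hx
  obtain ⟨W⟩ := wfcont_exists s σ hs α ha
  have h := W.qsd_ineq hr hr0 hs hσ hQ hf f0 fz fo
  have ib : ∀ g : ℝ → ℝ, Continuous g → Integrable g α := by
    intro g hg
    obtain ⟨M, hM, bM⟩ := wf_bdd01 hg
    exact Integrable.of_bound hg.measurable.aestronglyMeasurable M (ha.mono fun x hx => bM x hx)
  have cL := wf_LWF_cont (s := s) (σ := σ) hf
  have cf := hf.continuous
  have h1 : ∫ x, -C * f x ∂α ≤ ∫ x, (LWF s σ f x + r x * f x) ∂α :=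
    integral_mono_ae ((ib f cf).const_mul _) (ib _ (by fun_prop)) hC
  rw [integral_const_mul] at h1
  have h2 : 0 < ∫ x, f x ∂α := by
    rw [integral_pos_iff_support_of_nonneg_ae (ha.mono fun x hx => f0 x hx) (ib f cf)]
    refine (pos_iff_ne_zero.2 hp).trans_le (measure_mono fun x hx => ?_)
    exact ne_of_gt hx
  have h3 := h1.trans h
  nlinarith

lemma wf_LWF_congr {s σ x : ℝ} {f g : ℝ → ℝ} (h : f =ᶠ[𝓝 x] g) : LWF s σ f x = LWF s σ g x := by
  simp only [LWF, h.deriv_eq, h.deriv.deriv_eq]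

lemma wf_LWF_eq {s σ : ℝ} {f f' f'' : ℝ → ℝ} (h1 : ∀ x, HasDerivAt f (f' x) x) (h2 : ∀ x, HasDerivAt f' (f'' x) x) (x : ℝ) :
    LWF s σ f x = -s * x * (1 - x) * f' x + σ ^ 2 / 2 * (x * (1 - x)) * f'' x := by
  have e1 : deriv f = f' := funext fun x => (h1 x).deriv
  have e2 : deriv f' = f'' := funext fun x => (h2 x).deriv
  simp only [LWF, e1, e2]

lemma wf_contDiff2 {f f' f'' : ℝ → ℝ} (h1 : ∀ x, HasDerivAt f (f' x) x) (h2 : ∀ x, HasDerivAt f' (f'' x) x)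
    (h3 : Continuous f'') : ContDiff ℝ 2 f := by
  have e1 : deriv f = f' := funext fun x => (h1 x).deriv
  have e2 : deriv f' = f'' := funext fun x => (h2 x).deriv
  have a : ContDiff ℝ 1 f' := contDiff_one_iff_deriv.2 ⟨fun x => (h2 x).differentiableAt, by rw [e2]; exact h3⟩
  have b : ContDiff ℝ (1 + 1) f := contDiff_succ_iff_deriv.2 ⟨fun x => (h1 x).differentiableAt, by simp, by rw [e1]; exact a⟩
  simpa [one_add_one_eq_two] using b

lemma wf_maxpow (n : ℕ) (y : ℝ) : HasDerivAt (fun y : ℝ => (max y 0) ^ (n + 2)) ((n + 2 : ℕ) * (max y 0) ^ (n + 1)) y := by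
  have h1 : HasDerivAt (fun y : ℝ => y ^ (n + 2)) ((n + 2 : ℕ) * y ^ (n + 1)) y := hasDerivAt_pow (n + 2) y
  rcases lt_trichotomy y 0 with h | h | h
  · rw [max_eq_right h.le, zero_pow (by omega), mul_zero]
    refine (hasDerivAt_const y (0:ℝ)).congr_of_eventuallyEq ?_
    filter_upwards [Iio_mem_nhds h] with z hz
    rw [max_eq_right (le_of_lt hz), zero_pow (by omega)]
  · subst h
    simp only [max_self] at h1 ⊢
    rw [← hasDerivWithinAt_univ, ← Iic_union_Ici (a := (0:ℝ))]
    refine HasDerivWithinAt.union ?_ ?_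
    · rw [zero_pow (by omega), mul_zero]
      refine (hasDerivWithinAt_const (0:ℝ) _ (0:ℝ)).congr (fun z hz => ?_) ?_
      · rw [max_eq_right hz, zero_pow (by omega)]
      · simp
    · refine h1.hasDerivWithinAt.congr (fun z hz => ?_) ?_
      · rw [max_eq_left hz]
      · simp
  · rw [max_eq_left h.le]
    refine h1.congr_of_eventuallyEq ?_
    filter_upwards [Ioi_mem_nhds h] with z hz
    rw [max_eq_left (le_of_lt hz)]

lemma wf_cut {a b : ℝ} (hab : a < b) : ∃ χ : ℝ → ℝ, ContDiff ℝ 2 χ ∧ (∀ x, 0 ≤ χ x) ∧ (∀ x, χ x ≤ 1) ∧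
    ∃ c d, a < c ∧ d < b ∧ (∀ x ≤ c, χ x = 1) ∧ (∀ x, d ≤ x → χ x = 0) := by
  refine ⟨fun x => Real.smoothTransition (((2 * b + a) / 3 - x) * (3 / (b - a))), ?_, fun x => Real.smoothTransition.nonneg _,
    fun x => Real.smoothTransition.le_one _, (2 * a + b) / 3, (2 * b + a) / 3, by linarith, by linarith, ?_, ?_⟩
  · exact Real.smoothTransition.contDiff.comp (by fun_prop)
  · intro x hx
    apply Real.smoothTransition.one_of_one_le
    rw [← mul_div_assoc, le_div_iff₀ (by linarith)]
    linarith
  · intro x hx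
    apply Real.smoothTransition.zero_of_nonpos
    exact mul_nonpos_of_nonpos_of_nonneg (by linarith) (div_nonneg (by norm_num) (by linarith))

lemma wf_left {s σ ρ a b Bd : ℝ} {r : ℝ → ℝ} {α : Measure ℝ} (hs : 0 ≤ s) (hσ : 0 < σ) (hr : Continuous r)
    (hr0 : ∀ x ∈ Icc (0:ℝ) 1, r x ≤ 0) (hQ : IsQSD s σ r α ρ) (h0a : 0 < a) (hab : a < b) (hb1 : b < 1)
    (hBd : ∀ x ∈ Icc (0:ℝ) 1, -Bd ≤ r x) (hα : α (Ioo a b) = 0) (hp : α (Ioc 0 a) ≠ 0) : ρ ≤ 0 := by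
  obtain ⟨χ, cχ, χ0, χ1, c, d, hac, hdb, hc, hd⟩ := wf_cut hab
  obtain ⟨n, hn⟩ := exists_nat_ge (max (Bd / (1 - a)) ((s + 1) * (2 / σ ^ 2)))
  have hn1 : Bd ≤ (1 - a) * n := by
    have := (le_max_left _ _).trans hn
    rw [div_le_iff₀ (by linarith)] at this
    linarith
  have hn2 : s + 1 ≤ σ ^ 2 / 2 * n := by
    have := (le_max_right _ _).trans hn
    have h2 : (s + 1) = σ ^ 2 / 2 * ((s + 1) * (2 / σ ^ 2)) := by field_simp
    rw [h2]
    gcongr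
  let g : ℝ → ℝ := fun x => x ^ (n + 2) * χ x
  have cg : ContDiff ℝ 2 g := (contDiff_id.pow _).mul cχ
  have d1 : ∀ x : ℝ, HasDerivAt (fun x : ℝ => x ^ (n + 2)) ((n + 2 : ℕ) * x ^ (n + 1)) x := fun x => hasDerivAt_pow (n + 2) x
  have d2 : ∀ x : ℝ, HasDerivAt (fun x : ℝ => (n + 2 : ℕ) * x ^ (n + 1)) ((n + 2 : ℕ) * ((n + 1 : ℕ) * x ^ n)) x := fun x => (hasDerivAt_pow (n + 1) x).const_mul _
  have hα' : ∀ᵐ x ∂α, x ∈ Ioo (0:ℝ) 1 := hQ.2.1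
  have hα2 : ∀ᵐ x ∂α, x ∉ Ioo a b := measure_eq_zero_iff_ae_notMem.1 hα
  refine wf_rate (C := 0) hs hσ hr hr0 hQ cg (fun x hx => mul_nonneg (pow_nonneg hx.1 _) (χ0 x)) (by simp [g])
    (by simp [g, hd 1 (by linarith)]) ?_ ?_
  · filter_upwards [hα', hα2] with x hx hx2
    rw [neg_zero, zero_mul]
    rcases le_or_gt x a with hxa | hxa
    · have e : g =ᶠ[𝓝 x] fun x => x ^ (n + 2) := by
        filter_upwards [Iio_mem_nhds (hxa.trans_lt hac)] with z hz
        simp only [g, hc z (le_of_lt hz), mul_one]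
      rw [wf_LWF_congr e, wf_LWF_eq d1 d2, e.eq_of_nhds]
      have hb := hBd x ⟨hx.1.le, hx.2.le⟩
      have hx0 := hx.1
      have hx1 := hx.2
      have hxn : 0 < x ^ n := pow_pos hx0 n
      have e1 : -s * x * (1 - x) * ((n + 2 : ℕ) * x ^ (n + 1)) + σ ^ 2 / 2 * (x * (1 - x)) * ((n + 2 : ℕ) * ((n + 1 : ℕ) * x ^ n)) + r x * x ^ (n + 2)
        = x ^ (n + 1) * (((1 - x) * (n + 2)) * (σ ^ 2 / 2 * (n + 1) - s * x) + r x * x) := by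
        push_cast; ring
      rw [e1]
      refine mul_nonneg (by positivity) ?_
      have k1 : 1 ≤ σ ^ 2 / 2 * (n + 1) - s * x := by
        have : s * x ≤ s := mul_le_of_le_one_right hs hx1.le
        have : 0 < σ ^ 2 := by positivity
        linarith
      have hn0 : (0:ℝ) ≤ n := Nat.cast_nonneg n
      have k2 : (1 - a) * n ≤ (1 - x) * (n + 2) := by nlinarith
      have k3 : (1 - x) * (n + 2) * 1 ≤ (1 - x) * (n + 2) * (σ ^ 2 / 2 * (n + 1) - s * x) :=
        mul_le_mul_of_nonneg_left k1 (by nlinarith)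
      have k4 : r x ≤ r x * x := by nlinarith [hr0 x ⟨hx.1.le, hx.2.le⟩]
      linarith
    · have hxb : b ≤ x := by
        by_contra hh
        exact hx2 ⟨hxa, not_le.1 hh⟩
      have e : g =ᶠ[𝓝 x] fun _ => 0 := by
        filter_upwards [Ioi_mem_nhds (hdb.trans_le hxb)] with z hz
        simp only [g, hd z (le_of_lt hz), mul_zero]
      rw [wf_LWF_congr e, e.eq_of_nhds, wf_LWF_eq (fun x => hasDerivAt_const x (0:ℝ)) (fun x => hasDerivAt_const x (0:ℝ))]
      simp
  · intro h
    apply hp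
    refine measure_mono_null (fun x hx => ?_) h
    simp only [g, mem_ofPred_eq, hc x (hx.2.trans hac.le), mul_one]
    exact pow_pos hx.1 _

lemma wf_right {s σ ρ a b Bd : ℝ} {r : ℝ → ℝ} {α : Measure ℝ} (hs : 0 ≤ s) (hσ : 0 < σ) (hr : Continuous r)
    (hr0 : ∀ x ∈ Icc (0:ℝ) 1, r x ≤ 0) (hQ : IsQSD s σ r α ρ) (h0a : 0 < a) (hab : a < b) (hb1 : b < 1)
    (hBd : ∀ x ∈ Icc (0:ℝ) 1, -Bd ≤ r x) (hα : α (Ioo a b) = 0) (hp : α (Ico b 1) ≠ 0) : ρ ≤ 0 := by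
  obtain ⟨χ, cχ, χ0, χ1, c, d, hac, hdb, hc, hd⟩ := wf_cut hab
  obtain ⟨n, hn⟩ := exists_nat_ge (Bd * (2 / (σ ^ 2 * b)))
  have hb0 : 0 < b := h0a.trans hab
  have hn1 : Bd ≤ b * (σ ^ 2 / 2) * n := by
    have h2 : Bd = b * (σ ^ 2 / 2) * (Bd * (2 / (σ ^ 2 * b))) := by field_simp
    rw [h2]
    gcongr
  let g : ℝ → ℝ := fun x => (1 - x) ^ (n + 2) * (1 - χ x)
  have cg : ContDiff ℝ 2 g := ((contDiff_const.sub contDiff_id).pow _).mul (contDiff_const.sub cχ)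
  have d0 : ∀ x : ℝ, HasDerivAt (fun x : ℝ => 1 - x) (-1) x := fun x => by
    simpa using (hasDerivAt_id x).const_sub 1
  have d1 : ∀ x : ℝ, HasDerivAt (fun x : ℝ => (1 - x) ^ (n + 2)) ((n + 2 : ℕ) * (1 - x) ^ (n + 1) * -1) x := fun x => (d0 x).fun_pow (n + 2)
  have d2 : ∀ x : ℝ, HasDerivAt (fun x : ℝ => (n + 2 : ℕ) * (1 - x) ^ (n + 1) * -1) ((n + 2 : ℕ) * ((n + 1 : ℕ) * (1 - x) ^ n * -1) * -1) x := fun x => (((d0 x).fun_pow (n + 1)).const_mul _).mul_const _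
  have hα' : ∀ᵐ x ∂α, x ∈ Ioo (0:ℝ) 1 := hQ.2.1
  have hα2 : ∀ᵐ x ∂α, x ∉ Ioo a b := measure_eq_zero_iff_ae_notMem.1 hα
  refine wf_rate (C := 0) hs hσ hr hr0 hQ cg (fun x hx => mul_nonneg (pow_nonneg (by linarith [hx.2]) _) (by linarith [χ1 x]))
    (by simp [g, hc 0 (by linarith)]) (by simp [g]) ?_ ?_
  · filter_upwards [hα', hα2] with x hx hx2
    rw [neg_zero, zero_mul]
    rcases le_or_gt x a with hxa | hxa
    · have e : g =ᶠ[𝓝 x] fun _ => 0 := by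
        filter_upwards [Iio_mem_nhds (hxa.trans_lt hac)] with z hz
        simp only [g, hc z (le_of_lt hz), sub_self, mul_zero]
      rw [wf_LWF_congr e, e.eq_of_nhds, wf_LWF_eq (fun x => hasDerivAt_const x (0:ℝ)) (fun x => hasDerivAt_const x (0:ℝ))]
      simp
    · have hxb : b ≤ x := by
        by_contra hh
        exact hx2 ⟨hxa, not_le.1 hh⟩
      have e : g =ᶠ[𝓝 x] fun x => (1 - x) ^ (n + 2) := by
        filter_upwards [Ioi_mem_nhds (hdb.trans_le hxb)] with z hz
        simp only [g, hd z (le_of_lt hz), sub_zero, mul_one]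
      rw [wf_LWF_congr e, wf_LWF_eq d1 d2, e.eq_of_nhds]
      have hb := hBd x ⟨hx.1.le, hx.2.le⟩
      have hx0 := hx.1
      have hx1 : 0 < 1 - x := sub_pos.2 hx.2
      have e1 : -s * x * (1 - x) * ((n + 2 : ℕ) * (1 - x) ^ (n + 1) * -1) + σ ^ 2 / 2 * (x * (1 - x)) * ((n + 2 : ℕ) * ((n + 1 : ℕ) * (1 - x) ^ n * -1) * -1) + r x * (1 - x) ^ (n + 2)
        = (1 - x) ^ (n + 1) * (s * x * (1 - x) * (n + 2) + x * (σ ^ 2 / 2) * ((n + 2) * (n + 1)) + r x * (1 - x)) := by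
        push_cast; ring
      rw [e1]
      refine mul_nonneg (by positivity) ?_
      have hn0 : (0:ℝ) ≤ n := Nat.cast_nonneg n
      have k1 : 0 ≤ s * x * (1 - x) * (n + 2) := by positivity
      have k2 : b * (σ ^ 2 / 2) * n ≤ x * (σ ^ 2 / 2) * ((n + 2) * (n + 1)) := by
        gcongr
        nlinarith
      have k4 : r x ≤ r x * (1 - x) := by nlinarith [hr0 x ⟨hx.1.le, hx.2.le⟩]
      linarith
  · intro h
    apply hp
    refine measure_mono_null (fun x hx => ?_) h
    simp only [g, mem_ofPred_eq, hd x (hdb.le.trans hx.1), sub_zero, mul_one]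
    exact pow_pos (sub_pos.2 hx.2) _

lemma wf_mid {s σ ρ a b D : ℝ} {r : ℝ → ℝ} {α : Measure ℝ} (hs : 0 ≤ s) (hσ : 0 < σ) (hr : Continuous r)
    (hr0 : ∀ x ∈ Icc (0:ℝ) 1, r x ≤ 0) (hQ : IsQSD s σ r α ρ) (h0a : 0 < a) (hab : a < b) (hb1 : b < 1)
    (hD : ∀ x ∈ Icc a b, -D ≤ r x) (hp : α (Ioo a b) ≠ 0) :
    ρ ≤ (15 * σ ^ 2 + 3 * s) ^ 2 / (12 * σ ^ 2 * (b - a) ^ 2) + D := by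
  set C := (15 * σ ^ 2 + 3 * s) ^ 2 / (12 * σ ^ 2 * (b - a) ^ 2) with hCdef
  let q : ℝ → ℝ := fun x => (x - a) * (b - x)
  let m : ℝ → ℝ := fun x => max (q x) 0
  have dq : ∀ x, HasDerivAt q (a + b - 2 * x) x := by
    intro x
    have h : HasDerivAt q (1 * (b - x) + (x - a) * (-1)) x :=
      ((hasDerivAt_id x).sub_const a).fun_mul ((hasDerivAt_id x).const_sub b)
    have e : 1 * (b - x) + (x - a) * (-1) = a + b - 2 * x := by ring
    rwa [e] at h
  have dq' : ∀ x, HasDerivAt (fun x : ℝ => a + b - 2 * x) (-2) x := by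
    intro x
    simpa using ((hasDerivAt_id x).const_mul 2).const_sub (a + b)
  let f : ℝ → ℝ := fun x => m x ^ 3
  let f1 : ℝ → ℝ := fun x => (3 * m x ^ 2) * (a + b - 2 * x)
  let f2 : ℝ → ℝ := fun x => (3 * (2 * m x * (a + b - 2 * x))) * (a + b - 2 * x) + (3 * m x ^ 2) * (-2)
  have h1 : ∀ x, HasDerivAt f (f1 x) x := by
    intro x
    have h : HasDerivAt f (((1 + 2 : ℕ) : ℝ) * (max (q x) 0) ^ (1 + 1) * (a + b - 2 * x)) x :=
      (wf_maxpow 1 (q x)).comp x (dq x)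
    norm_num at h
    exact h
  have h2 : ∀ x, HasDerivAt f1 (f2 x) x := by
    intro x
    have h : HasDerivAt (fun x => m x ^ 2) (((0 + 2 : ℕ) : ℝ) * (max (q x) 0) ^ (0 + 1) * (a + b - 2 * x)) x :=
      (wf_maxpow 0 (q x)).comp x (dq x)
    have h' : HasDerivAt (fun x => m x ^ 2) (2 * m x * (a + b - 2 * x)) x := by
      norm_num at h
      exact h
    exact (h'.const_mul 3).fun_mul (dq' x)
  have cm : Continuous m := by simp only [m, q]; fun_prop
  have cf : ContDiff ℝ 2 f := wf_contDiff2 h1 h2 (by simp only [f2]; fun_prop)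
  have m0 : ∀ x, 0 ≤ m x := fun x => le_max_right _ _
  have hα' : ∀ᵐ x ∂α, x ∈ Ioo (0:ℝ) 1 := hQ.2.1
  have mz : ∀ x, q x ≤ 0 → m x = 0 := fun x hx => max_eq_right hx
  refine wf_rate hs hσ hr hr0 hQ cf (fun x _ => pow_nonneg (m0 x) 3) ?_ ?_ ?_ ?_
  · simp only [f, mz 0 (by simp only [q]; nlinarith)]; norm_num
  · simp only [f, mz 1 (by simp only [q]; nlinarith)]; norm_num
  · filter_upwards [hα'] with x hx
    rw [wf_LWF_eq h1 h2]
    rcases le_or_gt (q x) 0 with hq | hq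
    · simp only [f, f1, f2, mz x hq]; norm_num
    · have hm : m x = q x := max_eq_left hq.le
      have hxab : a < x ∧ x < b := by
        have : 0 < (x - a) * (b - x) := hq
        rcases lt_or_ge a x with h | h
        · exact ⟨h, by nlinarith⟩
        · exfalso; nlinarith
      have hrx := hD x ⟨hxab.1.le, hxab.2.le⟩
      simp only [f, f1, f2, hm]
      set Q := q x with hQd
      set v := a + b - 2 * x with hv
      have hv2 : v ^ 2 = (b - a) ^ 2 - 4 * Q := by simp only [hv, hQd, q]; ring
      have hvl : v ≤ 1 := by simp only [hv]; linarith [hxab.1, hxab.2]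
      have hx0 : 0 ≤ x * (1 - x) := mul_nonneg hx.1.le (sub_nonneg.2 hx.2.le)
      have hx1 : x * (1 - x) ≤ 1 := by nlinarith [hx.1, hx.2]
      have hw : 0 < (b - a) ^ 2 := by have := sub_pos.2 hab; positivity
      have hσ2 : 0 < σ ^ 2 := by positivity
      have e1 : -s * x * (1 - x) * (3 * Q ^ 2 * v) + σ ^ 2 / 2 * (x * (1 - x)) * (3 * (2 * Q * v) * v + 3 * Q ^ 2 * -2) + r x * Q ^ 3
        = x * (1 - x) * Q * (3 * σ ^ 2 * v ^ 2 - 3 * σ ^ 2 * Q - 3 * s * Q * v) + r x * Q ^ 3 := by ring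
      rw [e1, hv2]
      have hC0 : 0 ≤ C := by positivity
      have hCe : C * (12 * σ ^ 2 * (b - a) ^ 2) = (15 * σ ^ 2 + 3 * s) ^ 2 := by
        rw [hCdef]; exact div_mul_cancel₀ _ (by positivity)
      have k1 : -(C * Q ^ 2) ≤ 3 * σ ^ 2 * (b - a) ^ 2 - (15 * σ ^ 2 + 3 * s) * Q := by
        have hsq := sq_nonneg (6 * σ ^ 2 * (b - a) ^ 2 - (15 * σ ^ 2 + 3 * s) * Q)
        have e : (6 * σ ^ 2 * (b - a) ^ 2 - (15 * σ ^ 2 + 3 * s) * Q) ^ 2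
          = 12 * σ ^ 2 * (b - a) ^ 2 * (3 * σ ^ 2 * (b - a) ^ 2 - (15 * σ ^ 2 + 3 * s) * Q + C * Q ^ 2) := by
          have : ((15 * σ ^ 2 + 3 * s) * Q) ^ 2 = C * (12 * σ ^ 2 * (b - a) ^ 2) * Q ^ 2 := by rw [hCe]; ring
          linear_combination this
        rw [e] at hsq
        have := nonneg_of_mul_nonneg_right hsq (by positivity)
        linarith
      have k2 : s * Q * v ≤ s * Q := mul_le_of_le_one_right (by positivity) hvl
      have k3 : -(C * Q ^ 2) ≤ 3 * σ ^ 2 * ((b - a) ^ 2 - 4 * Q) - 3 * σ ^ 2 * Q - 3 * s * Q * v := by linarith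
      have k4 : x * (1 - x) * Q * -(C * Q ^ 2) ≤ x * (1 - x) * Q * (3 * σ ^ 2 * ((b - a) ^ 2 - 4 * Q) - 3 * σ ^ 2 * Q - 3 * s * Q * v) :=
        mul_le_mul_of_nonneg_left k3 (by positivity)
      have k5 : x * (1 - x) * (C * Q ^ 3) ≤ C * Q ^ 3 := mul_le_of_le_one_left (by positivity) hx1
      have k6 : -D * Q ^ 3 ≤ r x * Q ^ 3 := mul_le_mul_of_nonneg_right hrx (by positivity)
      linarith
  · intro h
    apply hp
    refine measure_mono_null (fun x hx => ?_) h
    have : 0 < q x := mul_pos (sub_pos.2 hx.1) (sub_pos.2 hx.2)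
    have hm : m x = q x := max_eq_left this.le
    simp only [f, mem_ofPred_eq, hm]
    positivity

lemma wf_final
    (s σ : ℝ) (hs : 0 ≤ s) (hσ : 0 < σ)
    (r0 : ℝ → ℝ) (hr0cont : Continuous r0)
    (hmaxInterior : ∀ x ∈ Icc (0:ℝ) 1, (∀ y ∈ Icc (0:ℝ) 1, r0 y ≤ r0 x) → x ∈ Ioo (0:ℝ) 1) :
    ∃ Rc : ℝ, 0 < Rc ∧ ∀ R : ℝ, Rc < R →
      ∀ (α : Measure ℝ) (ρα : ℝ),
        IsQSD s σ (fun x => R * (r0 x - sSup (r0 '' Icc (0:ℝ) 1))) α ρα →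
        ρα < min (-(R * (r0 0 - sSup (r0 '' Icc (0:ℝ) 1))))
                 (-(R * (r0 1 - sSup (r0 '' Icc (0:ℝ) 1)))) := by
  obtain ⟨xs, hxs, hmax⟩ := (isCompact_Icc (a := (0:ℝ)) (b := 1)).exists_isMaxOn ⟨0, by simp⟩ hr0cont.continuousOn
  have hmax' : ∀ y ∈ Icc (0:ℝ) 1, r0 y ≤ r0 xs := fun y hy => hmax hy
  have hM : sSup (r0 '' Icc (0:ℝ) 1) = r0 xs :=
    IsGreatest.csSup_eq ⟨mem_image_of_mem _ hxs, by rintro _ ⟨y, hy, rfl⟩; exact hmax' y hy⟩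
  rw [hM]
  have hI := hmaxInterior xs hxs hmax'
  have b0 : r0 0 < r0 xs := by
    by_contra h
    have := hmaxInterior 0 (by simp) (fun y hy => (hmax' y hy).trans (not_lt.1 h))
    exact lt_irrefl _ this.1
  have b1 : r0 1 < r0 xs := by
    by_contra h
    have := hmaxInterior 1 (by simp) (fun y hy => (hmax' y hy).trans (not_lt.1 h))
    exact lt_irrefl _ this.2
  set δ := min (r0 xs - r0 0) (r0 xs - r0 1) with hδ
  have hδ0 : 0 < δ := lt_min (by linarith) (by linarith)
  obtain ⟨η, hη, hηb⟩ := Metric.continuousAt_iff.1 (hr0cont.continuousAt (x := xs)) (δ / 2) (half_pos hδ0)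
  set e := min η (min xs (1 - xs)) / 2 with he
  have hmn : 0 < min η (min xs (1 - xs)) := lt_min hη (lt_min hI.1 (by linarith [hI.2]))
  have e0 : 0 < e := half_pos hmn
  have e1 : e < η := (half_lt_self hmn).trans_le (min_le_left _ _)
  have e2 : e < xs := (half_lt_self hmn).trans_le ((min_le_right _ _).trans (min_le_left _ _))
  have e3 : e < 1 - xs := (half_lt_self hmn).trans_le ((min_le_right _ _).trans (min_le_right _ _))
  have hab : xs - e < xs + e := by linarith
  set C := (15 * σ ^ 2 + 3 * s) ^ 2 / (12 * σ ^ 2 * ((xs + e) - (xs - e)) ^ 2) with hC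
  have hC0 : 0 ≤ C := by positivity
  refine ⟨2 * C / δ + 1, by positivity, fun R hR α ρ hQ => ?_⟩
  have hR1 : 2 * C / δ < R := by linarith
  have hR0 : 0 < R := lt_of_le_of_lt (by positivity) hR1
  have hR2 : C < R * δ / 2 := by
    rw [div_lt_iff₀ hδ0] at hR1
    linarith
  have hr : Continuous (fun x => R * (r0 x - r0 xs)) := by fun_prop
  have hrn : ∀ x ∈ Icc (0:ℝ) 1, R * (r0 x - r0 xs) ≤ 0 := fun x hx =>
    mul_nonpos_of_nonneg_of_nonpos hR0.le (by linarith [hmax' x hx])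
  have main : ρ < R * δ := by
    by_cases hm : α (Ioo (xs - e) (xs + e)) = 0
    · obtain ⟨Bd, -, hBd⟩ := wf_bdd01 hr
      have hBd' : ∀ x ∈ Icc (0:ℝ) 1, -Bd ≤ R * (r0 x - r0 xs) := fun x hx => (abs_le.1 (hBd x hx)).1
      have hρ : ρ ≤ 0 := by
        by_cases hl : α (Ioc 0 (xs - e)) = 0
        · refine wf_right hs hσ hr hrn hQ (by linarith) hab (by linarith) hBd' hm fun hrr => ?_
          have hp : IsProbabilityMeasure α := hQ.1
          have : α (univ : Set ℝ) = 0 := by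
            refine measure_mono_null (t := (((Ioo (0:ℝ) 1)ᶜ ∪ Ioc 0 (xs - e)) ∪ Ioo (xs - e) (xs + e)) ∪ Ico (xs + e) 1) ?_
              (measure_union_null (measure_union_null (measure_union_null hQ.2.1 hl) hm) hrr)
            intro x _
            by_cases h1 : x ∈ Ioo (0:ℝ) 1
            · rcases le_or_gt x (xs - e) with h2 | h2
              · exact Or.inl (Or.inl (Or.inr ⟨h1.1, h2⟩))
              · rcases lt_or_ge x (xs + e) with h3 | h3
                · exact Or.inl (Or.inr ⟨h2, h3⟩)
                · exact Or.inr ⟨h3, h1.2⟩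
            · exact Or.inl (Or.inl (Or.inl h1))
          rw [measure_univ] at this
          exact one_ne_zero this
        · exact wf_left hs hσ hr hrn hQ (by linarith) hab (by linarith) hBd' hm hl
      exact hρ.trans_lt (by positivity)
    · have := wf_mid (D := R * δ / 2) hs hσ hr hrn hQ (by linarith) hab (by linarith) (fun x hx => by
        have hd : dist x xs < η := by
          rw [Real.dist_eq]
          exact (abs_le.2 ⟨by linarith [hx.1], by linarith [hx.2]⟩ : |x - xs| ≤ e).trans_lt e1
        have := hηb hd
        rw [Real.dist_eq] at this
        have := (abs_lt.1 this).1
        nlinarith) hm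
      linarith
  have hd0 : δ ≤ r0 xs - r0 0 := min_le_left _ _
  have hd1 : δ ≤ r0 xs - r0 1 := min_le_right _ _
  exact lt_min (by nlinarith) (by nlinarith)

/-- For fixed `σ > 0`, `s ≥ 0` and a bounded continuous group-level
selection profile `r⁰` attaining its maximum on `[0,1]` only in the interior `(0,1)`,
there is a critical value `R_∨ > 0` such that for every `R > R_∨`, the killed system
with (normalized) killing rate `r = R (r⁰ - max r⁰) ≤ 0` satisfies
`ρ_α < ρ_0 ∧ ρ_1`: the extinction rate of the QSD on `(0,1)` is strictly smaller than
the extinction rates at both absorbing boundaries. -/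
theorem wf_strong_group_selection_maintains_polymorphism
    (s σ : ℝ) (hs : 0 ≤ s) (hσ : 0 < σ)
    (r0 : ℝ → ℝ) (hr0cont : Continuous r0) (hr0Bdd : ∃ M, ∀ x, |r0 x| ≤ M)
    (hmaxInterior : ∀ x ∈ Icc (0:ℝ) 1, (∀ y ∈ Icc (0:ℝ) 1, r0 y ≤ r0 x) → x ∈ Ioo (0:ℝ) 1) :
    ∃ Rc : ℝ, 0 < Rc ∧ ∀ R : ℝ, Rc < R →
      ∀ (α : Measure ℝ) (ρα : ℝ),
        IsQSD s σ (fun x => R * (r0 x - sSup (r0 '' Icc (0:ℝ) 1))) α ρα →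
        ρα < min (-(R * (r0 0 - sSup (r0 '' Icc (0:ℝ) 1))))
                 (-(R * (r0 1 - sSup (r0 '' Icc (0:ℝ) 1)))) := by
  exact wf_final s σ hs hσ r0 hr0cont hmaxInterior

end
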